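/- Suppose either r ≥ 4 and q ≥ C(r+1,2) + 2, or r = 3 and q ≥ 9. Then for every ε > 0 there exist ζ > 0 and n₀ such that for all n ≥ n₀ with r | n: if G is an n-vertex graph with minimum degree δ(G) ≥ ((r−1)/r + ε)·n and f : E(G) → {1,…,q} is any q-edge-coloring of G, then there is a K_r-tiling T of G and a color c such that c appears on at least (e(T) + ζn)/q of the edges of T. In other words, δ_{r,q} ≤ (r−1)/r in this range of q, so the discrepancy threshold coincides with the Hajnal–Szemerédi existence threshold. -/

import Mathlib

open Finset

variable {V : Type*}

/-- A `Kᵣ`-tiling of the vertex set `W`: a collection of pairwise-disjoint `r`-cliques of `G`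
whose union is `W`. -/
def IsKrTilingOn [DecidableEq V] (G : SimpleGraph V) (r : ℕ)
    (T : Finset (Finset V)) (W : Finset V) : Prop :=
  (∀ K ∈ T, G.IsNClique r K) ∧
  (∀ K ∈ T, ∀ K' ∈ T, K ≠ K' → Disjoint K K') ∧
  T.biUnion id = W

/-- A perfect `Kᵣ`-tiling of `G`. -/
def IsKrTiling [Fintype V] [DecidableEq V] (G : SimpleGraph V) (r : ℕ)
    (T : Finset (Finset V)) : Prop :=
  IsKrTilingOn G r T Finset.univ

/-- The number of edges of color `c` lying inside the cliques of `T`. -/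
def tilingColorCount [DecidableEq V] {q : ℕ} (f : Sym2 V → Fin q)
    (T : Finset (Finset V)) (c : Fin q) : ℕ :=
  ∑ K ∈ T, (K.sym2.filter fun e => ¬ e.IsDiag ∧ f e = c).card

/-- The total number of edges lying inside the cliques of `T`. -/
def tilingEdgeCount [DecidableEq V] (T : Finset (Finset V)) : ℕ :=
  ∑ K ∈ T, (K.sym2.filter fun e => ¬ e.IsDiag).card




section HSz
open scoped Classical

/-- Colour class. -/
noncomputable def hsCls (W : Finset V) (f : V → ℕ) (c : ℕ) : Finset V := W.filter (fun x => f x = c)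

lemma mem_hsCls {W : Finset V} {f : V → ℕ} {c : ℕ} {x : V} :
    x ∈ hsCls W f c ↔ x ∈ W ∧ f x = c := by simp [hsCls]

def hsProper (H : SimpleGraph V) (W : Finset V) (f : V → ℕ) : Prop :=
  ∀ x ∈ W, ∀ y ∈ W, H.Adj x y → f x ≠ f y

def hsMov (H : SimpleGraph V) (W : Finset V) (f : V → ℕ) (z : V) (d : ℕ) : Prop :=
  ∀ x ∈ W, f x = d → ¬ H.Adj z x

inductive hsAcc (H : SimpleGraph V) (W : Finset V) (f : V → ℕ) (d : ℕ) : Finset ℕ → ℕ → Prop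
  | base : hsAcc H W f d {d} d
  | step (D : Finset ℕ) (c c' : ℕ) (w : V) : w ∈ W → f w = c → hsMov H W f w c' → c ∉ D →
      hsAcc H W f d D c' → hsAcc H W f d (insert c D) c

lemma hsAcc_mem {H : SimpleGraph V} {W : Finset V} {f : V → ℕ} {d : ℕ} {D : Finset ℕ} {c : ℕ}
    (h : hsAcc H W f d D c) : d ∈ D ∧ c ∈ D := by
  induction h with
  | base => simp
  | step D c c' w _ _ _ _ _ ih => simp [ih.1]

lemma hsAcc_sub {H : SimpleGraph V} {W : Finset V} {f : V → ℕ} {d : ℕ} {D : Finset ℕ} {c : ℕ}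
    (h : hsAcc H W f d D c) : ∀ e ∈ D, ∃ D' ⊆ D, hsAcc H W f d D' e := by
  induction h with
  | base => intro e he; rw [mem_singleton] at he; subst he; exact ⟨_, subset_rfl, hsAcc.base⟩
  | step D c c' w h1 h2 h3 h4 h5 ih =>
    intro e he
    rw [mem_insert] at he
    rcases he with rfl | he
    · exact ⟨_, subset_rfl, hsAcc.step D e c' w h1 h2 h3 h4 h5⟩
    · obtain ⟨D', hD', h'⟩ := ih e he
      exact ⟨D', hD'.trans (subset_insert _ _), h'⟩

/-- `c` reaches `d` inside the colour set `X`. -/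
def hsR (H : SimpleGraph V) (W : Finset V) (f : V → ℕ) (d : ℕ) (X : Finset ℕ) (c : ℕ) : Prop :=
  ∃ D ⊆ X, hsAcc H W f d D c

lemma hsR_step {H : SimpleGraph V} {W : Finset V} {f : V → ℕ} {d : ℕ} {X : Finset ℕ} {c' : ℕ}
    (w : V) (hw : w ∈ W) (hX : f w ∈ X) (hm : hsMov H W f w c')
    (h : hsR H W f d X c') : hsR H W f d X (f w) := by
  obtain ⟨D, hD, h⟩ := h
  by_cases hc : f w ∈ D
  · obtain ⟨D', hD', h'⟩ := hsAcc_sub h _ hc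
    exact ⟨D', hD'.trans hD, h'⟩
  · exact ⟨insert (f w) D, insert_subset hX hD, hsAcc.step D _ c' w hw rfl hm hc h⟩

lemma hsAcc_congr {H : SimpleGraph V} {W : Finset V} {f g : V → ℕ} {d : ℕ} {D : Finset ℕ} {c : ℕ}
    (h : hsAcc H W f d D c) : (∀ e ∈ D, ∀ x ∈ W, (f x = e ↔ g x = e)) → hsAcc H W g d D c := by
  induction h with
  | base => intro _; exact hsAcc.base
  | step D c c' w h1 h2 h3 h4 h5 ih =>
    intro hh
    refine hsAcc.step D c c' w h1 ((hh c (mem_insert_self _ _) w h1).1 h2) ?_ h4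
      (ih fun e he => hh e (mem_insert_of_mem he))
    intro x hx hgx
    exact h3 x hx ((hh c' (mem_insert_of_mem (hsAcc_mem h5).2) x hx).2 hgx)

lemma hs_shift {H : SimpleGraph V} {W : Finset V} {f : V → ℕ} {d : ℕ} {D : Finset ℕ} {c : ℕ}
    (hP : hsProper H W f) (h : hsAcc H W f d D c) : ∀ z ∈ W, f z ∉ D → hsMov H W f z c →
    ∃ f' : V → ℕ, hsProper H W f' ∧ (∀ x, x ≠ z → f x ∉ D → f' x = f x) ∧
      (∀ x, f x ∈ D → f' x ∈ D) ∧ f' z ∈ D ∧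
      ∀ e ∈ D, (hsCls W f' e).card = (hsCls W f e).card + if e = d then 1 else 0 := by
  induction h with
  | base =>
    intro z hz hzD hm
    have hzd : f z ≠ d := by simpa using hzD
    refine ⟨Function.update f z d, ?_, ?_, ?_, ?_, ?_⟩
    · intro x hx y hy hxy
      by_cases h1 : x = z
      · subst h1
        have h2 : y ≠ x := hxy.ne'
        simp only [Function.update_self, Function.update_of_ne h2]
        intro h3; exact hm y hy h3.symm hxy
      · by_cases h2 : y = z
        · subst h2
          simp only [Function.update_self, Function.update_of_ne h1]
          intro h3; exact hm x hx h3 hxy.symm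
        · simp only [Function.update_of_ne h1, Function.update_of_ne h2]
          exact hP x hx y hy hxy
    · intro x hx _; simp [Function.update_of_ne hx]
    · intro x hx
      have : x ≠ z := by rintro rfl; exact hzD hx
      simpa [Function.update_of_ne this] using hx
    · simp
    · intro e he
      rw [mem_singleton] at he
      subst he
      have : hsCls W (Function.update f z e) e = insert z (hsCls W f e) := by
        ext x
        simp only [mem_insert, mem_hsCls]
        by_cases h1 : x = z
        · subst h1; simp [hz]
        · simp [Function.update_of_ne h1, h1]
      rw [this, card_insert_of_notMem (by simp [mem_hsCls, hzd])]
      simp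
  | step D c c' w h1 h2 h3 h4 h5 ih =>
    intro z hz hzD hm
    rw [mem_insert, not_or] at hzD
    obtain ⟨f1, hf1, hf2, hf3, hf4, hf5⟩ := ih w h1 (h2 ▸ h4) h3
    have hzw : z ≠ w := by rintro rfl; exact hzD.1 h2
    have hf1z : f1 z = f z := hf2 z hzw hzD.2
    have key : ∀ x, f1 x = c ↔ (f x = c ∧ x ≠ w) := by
      intro x
      by_cases hxw : x = w
      · subst hxw
        constructor
        · intro h; rw [h] at hf4; exact absurd hf4 h4
        · intro h; exact absurd rfl h.2
      · by_cases hxD : f x ∈ D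
        · constructor
          · intro h; have := hf3 x hxD; rw [h] at this; exact absurd this h4
          · intro h; rw [h.1] at hxD; exact absurd hxD h4
        · rw [hf2 x hxw hxD]; simp [hxw]
    refine ⟨Function.update f1 z c, ?_, ?_, ?_, ?_, ?_⟩
    · intro x hx y hy hxy
      by_cases h1' : x = z
      · subst h1'
        have h2' : y ≠ x := hxy.ne'
        simp only [Function.update_self, Function.update_of_ne h2']
        intro h3'; exact hm y hy ((key y).1 h3'.symm).1 hxy
      · by_cases h2' : y = z
        · subst h2'
          simp only [Function.update_self, Function.update_of_ne h1']
          intro h3'; exact hm x hx ((key x).1 h3').1 hxy.symm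
        · simp only [Function.update_of_ne h1', Function.update_of_ne h2']
          exact hf1 x hx y hy hxy
    · intro x hx hxD
      rw [mem_insert, not_or] at hxD
      rw [Function.update_of_ne hx]
      refine hf2 x ?_ hxD.2
      rintro rfl; exact hxD.1 h2
    · intro x hx
      have hxz : x ≠ z := by
        rintro rfl
        rw [mem_insert] at hx
        tauto
      rw [Function.update_of_ne hxz]
      by_cases hxw : x = w
      · subst hxw; exact mem_insert_of_mem hf4
      · rcases mem_insert.1 hx with hx | hx
        · rw [(key x).2 ⟨hx, hxw⟩]; exact mem_insert_self _ _
        · exact mem_insert_of_mem (hf3 x hx)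
    · simp
    · intro e he
      rcases mem_insert.1 he with rfl | he
      · have h6 : hsCls W (Function.update f1 z e) e = insert z ((hsCls W f e).erase w) := by
          ext x
          simp only [mem_insert, mem_hsCls, mem_erase]
          by_cases h1 : x = z
          · subst h1; simp [hz]
          · simp only [Function.update_of_ne h1, h1, false_or, key]; tauto
        have hwm : w ∈ hsCls W f e := mem_hsCls.2 ⟨h1, h2⟩
        rw [h6, card_insert_of_notMem (by simp [mem_hsCls, hzD.1]), card_erase_of_mem hwm]
        have hed : e ≠ d := by rintro rfl; exact h4 (hsAcc_mem h5).1
        have := card_pos.2 ⟨w, hwm⟩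
        simp [hed]; omega
      · rw [← hf5 e he]
        congr 1
        ext x
        simp only [mem_hsCls]
        by_cases h1 : x = z
        · subst h1
          simp only [Function.update_self, hf1z]
          have e1 : c ≠ e := by rintro rfl; exact h4 he
          have e2 : f x ≠ e := by rintro h; rw [h] at hzD; exact hzD.2 he
          simp [e1, e2]
        · simp [Function.update_of_ne h1]

end HSz



section HSz2
open scoped Classical

noncomputable def hsDg (H : SimpleGraph V) (S : Finset V) (v : V) : ℕ := (S.filter (fun x => H.Adj v x)).card

structure hsEq (H : SimpleGraph V) (W : Finset V) (f : V → ℕ) (C : Finset ℕ) (s : ℕ) : Prop where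
  col : ∀ v ∈ W, f v ∈ C
  prop : hsProper H W f
  siz : ∀ c ∈ C, (hsCls W f c).card = s

structure hsNear (H : SimpleGraph V) (W : Finset V) (f : V → ℕ) (C : Finset ℕ) (s cm cp : ℕ) : Prop where
  col : ∀ v ∈ W, f v ∈ C
  prop : hsProper H W f
  hm : cm ∈ C
  hp : cp ∈ C
  ne : cm ≠ cp
  sizm : (hsCls W f cm).card + 1 = s
  sizp : (hsCls W f cp).card = s + 1
  siz : ∀ c ∈ C, c ≠ cm → c ≠ cp → (hsCls W f c).card = s

noncomputable def hsA (H : SimpleGraph V) (W : Finset V) (f : V → ℕ) (C : Finset ℕ) (cm : ℕ) : Finset ℕ :=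
  C.filter (fun c => hsR H W f cm C c)

noncomputable def hsB (W : Finset V) (f : V → ℕ) (A : Finset ℕ) : Finset V :=
  W.filter (fun x => f x ∉ A)

lemma mem_hsB {W : Finset V} {f : V → ℕ} {A : Finset ℕ} {x : V} :
    x ∈ hsB W f A ↔ x ∈ W ∧ f x ∉ A := by simp [hsB]

def HSk (V : Type*) (k : ℕ) : Prop := ∀ (H : SimpleGraph V) (W : Finset V) (C : Finset ℕ) (s : ℕ),
  C.card = k → W.card = k * s → (∀ v ∈ W, hsDg H W v < k) → ∃ f, hsEq H W f C s

lemma hsDg_pos {H : SimpleGraph V} {W : Finset V} {f : V → ℕ} {v : V} {c : ℕ}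
    (h : ¬ hsMov H W f v c) : 1 ≤ hsDg H (hsCls W f c) v := by
  unfold hsMov at h
  push Not at h
  obtain ⟨x, hx, h1, h2⟩ := h
  exact card_pos.2 ⟨x, by simp [mem_hsCls, hx, h1, h2]⟩

lemma hsDg_split (H : SimpleGraph V) (W : Finset V) (f : V → ℕ) (A : Finset ℕ) (v : V) :
    hsDg H W v = ∑ c ∈ A, hsDg H (hsCls W f c) v + hsDg H (hsB W f A) v := by
  unfold hsDg
  rw [← card_filter_add_card_filter_not (s := W.filter (fun x => H.Adj v x)) (fun x => f x ∈ A)]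
  congr 1
  · rw [card_eq_sum_card_fiberwise (f := f) (t := A) (by intro x hx; simp at hx; exact hx.2)]
    apply sum_congr rfl
    intro c hc
    congr 1
    ext x; simp only [mem_filter, mem_hsCls]; constructor
    · tauto
    · rintro ⟨⟨h1, h2⟩, h3⟩; subst h2; tauto
  · congr 1
    ext x; simp only [mem_filter, mem_hsB]; tauto

lemma hsB_card {H : SimpleGraph V} {W : Finset V} {f : V → ℕ} {C : Finset ℕ} {s cm cp : ℕ}
    (hN : hsNear H W f C s cm cp) {A : Finset ℕ} (hA : A ⊆ C) (hcm : cm ∈ A) (hcp : cp ∉ A) :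
    (hsB W f A).card = (C \ A).card * s + 1 := by
  have h1 : (hsB W f A).card = ∑ c ∈ C \ A, (hsCls W f c).card := by
    rw [card_eq_sum_card_fiberwise (f := f) (t := C \ A)]
    · apply sum_congr rfl
      intro c hc
      congr 1
      ext x; simp only [mem_filter, mem_hsCls, mem_hsB]; constructor
      · tauto
      · rintro ⟨h1, h2⟩; subst h2; simp at hc; tauto
    · intro x hx
      have := mem_hsB.1 hx
      simp [this.2, hN.col x this.1]
  have hcpm : cp ∈ C \ A := by simp [hN.hp, hcp]
  rw [h1, ← add_sum_erase _ _ hcpm, hN.sizp,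
    sum_congr rfl (g := fun _ => s), sum_const, card_erase_of_mem hcpm]
  · have := card_pos.2 ⟨cp, hcpm⟩
    obtain ⟨m, hm⟩ := Nat.exists_eq_add_of_lt this
    simp only [smul_eq_mul]
    rw [hm]; simp; ring
  · intro c hc
    simp at hc
    refine hN.siz c hc.2.1 ?_ hc.1
    rintro rfl; tauto

lemma hs_done {H : SimpleGraph V} {W : Finset V} {f : V → ℕ} {C : Finset ℕ} {s cm cp : ℕ}
    (hN : hsNear H W f C s cm cp) (h : hsR H W f cm C cp) : ∃ f', hsEq H W f' C s := by
  obtain ⟨D, hD, h⟩ := h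
  cases h with
  | base => exact absurd rfl hN.ne
  | step D' _ c' w h1 h2 h3 h4 h5 =>
    obtain ⟨f1, hf1, hf2, hf3, hf4, hf5⟩ := hs_shift hN.prop h5 w h1 (h2 ▸ h4) h3
    have hD' : D' ⊆ C := (subset_insert _ _).trans hD
    refine ⟨f1, ?_, hf1, ?_⟩
    · intro v hv
      by_cases hvw : v = w
      · subst hvw; exact hD' hf4
      by_cases hvD : f v ∈ D'
      · exact hD' (hf3 v hvD)
      · rw [hf2 v hvw hvD]; exact hN.col v hv
    · intro c hc
      by_cases hcD : c ∈ D'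
      · rw [hf5 c hcD]
        by_cases hcm : c = cm
        · subst hcm; simpa using hN.sizm
        · simp [hcm, hN.siz c hc hcm (by rintro rfl; exact h4 hcD)]
      have key : ∀ x, f1 x = c ↔ (f x = c ∧ x ≠ w) := by
        intro x
        by_cases hxw : x = w
        · subst hxw
          constructor
          · intro h; rw [h] at hf4; exact absurd hf4 hcD
          · intro h; exact absurd rfl h.2
        · by_cases hxD : f x ∈ D'
          · constructor
            · intro h; have := hf3 x hxD; rw [h] at this; exact absurd this hcD
            · intro h; rw [h.1] at hxD; exact absurd hxD hcD
          · rw [hf2 x hxw hxD]; simp [hxw]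
      have e : hsCls W f1 c = (hsCls W f c).erase w := by
        ext x; simp only [mem_hsCls, mem_erase, key]; tauto
      rw [e]
      by_cases hccp : c = cp
      · subst hccp
        rw [card_erase_of_mem (mem_hsCls.2 ⟨h1, h2⟩), hN.sizp]; simp
      · rw [erase_eq_of_notMem, hN.siz c hc _ hccp]
        · rintro rfl; exact hcD (hsAcc_mem h5).1
        · simp [mem_hsCls, h2]; intro _ h; exact hccp h.symm

/-- Solo vertex `z` of colour `w0` that can be moved: finish. -/
lemma hs_solo_move {H : SimpleGraph V} {W : Finset V} {f : V → ℕ} {C : Finset ℕ} {s cm cp : ℕ}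
    (hN : hsNear H W f C s cm cp) {A : Finset ℕ} (hA : A ⊆ C) (hcp : cp ∉ A)
    {w0 : ℕ} (hw0 : w0 ∈ A) (hw0m : w0 ≠ cm) {z y : V} (hz : z ∈ W) (hzw : f z = w0)
    (hy : y ∈ hsB W f A) (hsolo : ∀ x ∈ W, f x = w0 → H.Adj y x → x = z)
    {X : ℕ} (hX : hsR H W f cm (A.erase w0) X) (hmov : hsMov H W f z X)
    {g : V → ℕ} (hg : hsEq H ((hsB W f A).erase y) g (C \ A) s) : ∃ f', hsEq H W f' C s := by
  obtain ⟨D, hD, h⟩ := hX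
  have hw0D : w0 ∉ D := fun h => by simpa using hD h
  have hDA : D ⊆ A := hD.trans (erase_subset _ _)
  obtain ⟨f1, hf1, hf2, hf3, hf4, hf5⟩ := hs_shift hN.prop h z hz (hzw ▸ hw0D) hmov
  have hyW := (mem_hsB.1 hy).1
  have hyA := (mem_hsB.1 hy).2
  have hf1A : ∀ x, f x ∈ A → f1 x ∈ A := by
    intro x hx
    by_cases hxz : x = z
    · subst hxz; exact hDA hf4
    by_cases hxD : f x ∈ D
    · exact hDA (hf3 x hxD)
    · rw [hf2 x hxz hxD]; exact hx
  have key : ∀ x c, c ∉ D → (f1 x = c ↔ (f x = c ∧ x ≠ z)) := by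
    intro x c hcD
    by_cases hxw : x = z
    · subst hxw
      constructor
      · intro h; rw [h] at hf4; exact absurd hf4 hcD
      · intro h; exact absurd rfl h.2
    · by_cases hxD : f x ∈ D
      · constructor
        · intro h; have := hf3 x hxD; rw [h] at this; exact absurd this hcD
        · intro h; rw [h.1] at hxD; exact absurd hxD hcD
      · rw [hf2 x hxw hxD]; simp [hxw]
  have hf1nA : ∀ x, f x ∉ A → f1 x = f x := by
    intro x hx
    refine hf2 x ?_ fun h => hx (hDA h)
    rintro rfl; exact hx (hzw ▸ hw0)
  let f2 : V → ℕ := fun x => if x = y then w0 else if f x ∈ A then f1 x else g x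
  have f2y : f2 y = w0 := by simp [f2]
  have f2A : ∀ x, f x ∈ A → f2 x = f1 x := by
    intro x hx
    have : x ≠ y := by rintro rfl; exact hyA hx
    simp [f2, this, hx]
  have f2B : ∀ x, x ≠ y → f x ∉ A → f2 x = g x := by
    intro x hx hxA; simp [f2, hx, hxA]
  have hBm : ∀ x ∈ W, x ≠ y → f x ∉ A → x ∈ (hsB W f A).erase y := by
    intro x h1 h2 h3; simp [h2, mem_hsB, h1, h3]
  have hgc : ∀ x ∈ W, x ≠ y → f x ∉ A → g x ∈ C ∧ g x ∉ A := by
    intro x h1 h2 h3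
    simpa using hg.col x (hBm x h1 h2 h3)
  have hyadj : ∀ x ∈ W, f x ∈ A → H.Adj y x → f1 x ≠ w0 := by
    intro x hx hxA hadj h1
    have := (key x w0 hw0D).1 h1
    exact this.2 (hsolo x hx this.1 hadj)
  refine ⟨f2, ?_, ?_, ?_⟩
  · intro v hv
    by_cases h1 : v = y
    · subst h1; rw [f2y]; exact hA hw0
    by_cases h2 : f v ∈ A
    · rw [f2A v h2]; exact hA (hf1A v h2)
    · rw [f2B v h1 h2]; exact (hgc v hv h1 h2).1
  · have half : ∀ x ∈ W, ∀ x' ∈ W, H.Adj x x' → f x ∈ A → f2 x ≠ f2 x' := by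
      intro x hx x' hx' hadj h
      rw [f2A x h]
      by_cases h1 : x' = y
      · subst h1; rw [f2y]; exact hyadj x hx h hadj.symm
      by_cases h2 : f x' ∈ A
      · rw [f2A x' h2]; exact hf1 x hx x' hx' hadj
      · rw [f2B x' h1 h2]; intro h3
        exact (hgc x' hx' h1 h2).2 (h3 ▸ hf1A x h)
    intro x hx x' hx' hadj
    by_cases h : f x ∈ A
    · exact half x hx x' hx' hadj h
    by_cases h' : f x' ∈ A
    · exact (half x' hx' x hx hadj.symm h').symm
    by_cases e : x = y
    · subst e
      have e' : x' ≠ x := hadj.ne'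
      rw [f2y, f2B x' e' h']
      intro h3
      exact (hgc x' hx' e' h').2 (h3 ▸ hw0)
    by_cases e' : x' = y
    · subst e'
      rw [f2y, f2B x e h]
      intro h3
      exact (hgc x hx e h).2 (h3 ▸ hw0)
    rw [f2B x e h, f2B x' e' h']
    exact hg.prop x (hBm x hx e h) x' (hBm x' hx' e' h') hadj
  · intro c hc
    by_cases hcA : c ∈ A
    · have hccp : c ≠ cp := by rintro rfl; exact hcp hcA
      by_cases hcw : c = w0
      · have e : hsCls W f2 c = insert y ((hsCls W f c).erase z) := by
          subst hcw
          ext x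
          simp only [mem_insert, mem_erase, mem_hsCls]
          by_cases h1 : x = y
          · subst h1; simp [hyW, f2y]
          by_cases h2 : f x ∈ A
          · rw [f2A x h2, key x c hw0D]; tauto
          · rw [f2B x h1 h2]; constructor
            · rintro ⟨h3, h4⟩; exact absurd (h4 ▸ hcA) (hgc x h3 h1 h2).2
            · rintro (h3 | ⟨_, h3, h4⟩)
              · tauto
              · exact absurd (h4 ▸ hcA) h2
        have hzm : z ∈ hsCls W f c := mem_hsCls.2 ⟨hz, hzw.trans hcw.symm⟩
        rw [e, card_insert_of_notMem, card_erase_of_mem hzm]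
        · have := card_pos.2 ⟨z, hzm⟩
          rw [hN.siz c hc (hcw ▸ hw0m) hccp] at this ⊢
          omega
        · simp only [mem_erase, mem_hsCls]; rintro ⟨_, _, h⟩; exact hyA (h ▸ hcA)
      · have e : hsCls W f2 c = hsCls W f1 c := by
          ext x
          simp only [mem_hsCls]
          by_cases h1 : x = y
          · subst h1; rw [f2y, hf1nA x hyA]
            constructor
            · rintro ⟨_, h⟩; exact absurd h.symm hcw
            · rintro ⟨_, h⟩; exact absurd (h ▸ hcA) hyA
          by_cases h2 : f x ∈ A
          · rw [f2A x h2]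
          · rw [f2B x h1 h2, hf1nA x h2]; constructor
            · rintro ⟨h3, h4⟩; exact absurd (h4 ▸ hcA) (hgc x h3 h1 h2).2
            · rintro ⟨h3, h4⟩
              exact absurd (h4 ▸ hcA) h2
        rw [e]
        by_cases hcD : c ∈ D
        · rw [hf5 c hcD]
          by_cases hcm : c = cm
          · subst hcm; simpa using hN.sizm
          · simp [hcm, hN.siz c hc hcm hccp]
        · have e : hsCls W f1 c = hsCls W f c := by
            ext x
            simp only [mem_hsCls, key x c hcD]
            constructor
            · tauto
            · rintro ⟨h1, h2⟩; refine ⟨h1, h2, ?_⟩; rintro rfl; exact hcw (h2.symm.trans hzw)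
          rw [e]
          refine hN.siz c hc ?_ hccp
          rintro rfl; exact hcD (hsAcc_mem h).1
    · rw [← hg.siz c (by simp [hc, hcA])]
      congr 1
      ext x
      simp only [mem_hsCls, mem_erase, mem_hsB]
      by_cases h1 : x = y
      · subst h1; rw [f2y]; simp; intro _ h; exact hcA (h ▸ hw0)
      by_cases h2 : f x ∈ A
      · rw [f2A x h2]; simp [h2]; intro _ h; exact hcA (h ▸ hf1A x h2)
      · rw [f2B x h1 h2]; tauto

end HSz2



section HSz3
open scoped Classical

lemma hsA_mem {H : SimpleGraph V} {W : Finset V} {f : V → ℕ} {C : Finset ℕ} {cm c : ℕ} :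
    c ∈ hsA H W f C cm ↔ c ∈ C ∧ hsR H W f cm C c := by simp [hsA]

lemma hsA_sub {H : SimpleGraph V} {W : Finset V} {f : V → ℕ} {C : Finset ℕ} {cm : ℕ}
    {D : Finset ℕ} {c : ℕ} (hD : D ⊆ C) (h : hsAcc H W f cm D c) : D ⊆ hsA H W f C cm := by
  intro e he
  obtain ⟨D', hD', h'⟩ := hsAcc_sub h e he
  exact hsA_mem.2 ⟨hD he, D', hD'.trans hD, h'⟩

lemma hs_swap {H : SimpleGraph V} {W : Finset V} {f : V → ℕ} {C : Finset ℕ} {s cm cp : ℕ}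
    (hN : hsNear H W f C s cm cp) {A : Finset ℕ} (hAdef : A = hsA H W f C cm) (hcp : cp ∉ A)
    {w0 : ℕ} (hw0 : w0 ∈ A) (hw0m : w0 ≠ cm) (hterm : ∀ X ∈ A, X ≠ w0 → hsR H W f cm (A.erase w0) X)
    {z y1 y2 : V} (hz : z ∈ W) (hzw : f z = w0)
    (hzn : ∀ X ∈ A, X ≠ w0 → ¬ hsMov H W f z X)
    (hy1 : y1 ∈ hsB W f A) (hy2 : y2 ∈ hsB W f A) (hne : y1 ≠ y2) (hna : ¬ H.Adj y1 y2)
    (hsolo1 : ∀ x ∈ W, f x = w0 → H.Adj y1 x → x = z)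
    (hsolo2 : ∀ x ∈ W, f x = w0 → H.Adj y2 x → x = z)
    {g : V → ℕ} (hg : hsEq H ((hsB W f A).erase y1) g (C \ A) s) {c : ℕ} (hc : c ∈ C \ A)
    (hcz : ∀ x ∈ (hsB W f A).erase y1, g x = c → ¬ H.Adj z x) :
    ∃ f', hsNear H W f' C s cm c ∧ A.card < (hsA H W f' C cm).card := by
  have hA : A ⊆ C := by rw [hAdef]; exact filter_subset _ _
  have hcA : c ∉ A := (mem_sdiff.1 hc).2
  have hcC : c ∈ C := (mem_sdiff.1 hc).1
  have hyW := (mem_hsB.1 hy1).1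
  have hyA := (mem_hsB.1 hy1).2
  have hzA : f z ∈ A := hzw ▸ hw0
  have hzy : z ≠ y1 := by rintro rfl; exact hyA hzA
  have hzy2 : z ≠ y2 := by rintro rfl; exact (mem_hsB.1 hy2).2 hzA
  let f2 : V → ℕ := fun x => if x = y1 then w0 else if x = z then c else if f x ∈ A then f x else g x
  have f2y : f2 y1 = w0 := by simp [f2]
  have f2z : f2 z = c := by simp [f2, hzy]
  have f2A : ∀ x, x ≠ z → f x ∈ A → f2 x = f x := by
    intro x hxz hx
    have : x ≠ y1 := by rintro rfl; exact hyA hx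
    simp [f2, this, hx, hxz]
  have f2B : ∀ x, x ≠ y1 → f x ∉ A → f2 x = g x := by
    intro x hx hxA
    have : x ≠ z := by rintro rfl; exact hxA hzA
    simp [f2, hx, hxA, this]
  have hBm : ∀ x ∈ W, x ≠ y1 → f x ∉ A → x ∈ (hsB W f A).erase y1 := by
    intro x h1 h2 h3; simp [h2, mem_hsB, h1, h3]
  have hgc : ∀ x ∈ W, x ≠ y1 → f x ∉ A → g x ∈ C ∧ g x ∉ A := by
    intro x h1 h2 h3
    simpa using hg.col x (hBm x h1 h2 h3)
  -- case principle
  have cases4 : ∀ x, x = y1 ∨ x = z ∨ (x ≠ z ∧ x ≠ y1 ∧ f x ∈ A) ∨ (x ≠ z ∧ x ≠ y1 ∧ f x ∉ A) := by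
    intro x; tauto
  have key : ∀ e ∈ A, e ≠ w0 → ∀ x ∈ W, (f x = e ↔ f2 x = e) := by
    intro e heA hew x hx
    rcases cases4 x with rfl | rfl | ⟨h1, h2, h3⟩ | ⟨h1, h2, h3⟩
    · rw [f2y]; constructor
      · rintro rfl; exact absurd heA hyA
      · intro h; exact absurd h.symm hew
    · rw [f2z, hzw]; constructor
      · intro h; exact absurd h.symm hew
      · rintro rfl; exact absurd heA hcA
    · rw [f2A x h1 h3]
    · rw [f2B x h2 h3]; constructor
      · rintro rfl; exact absurd heA h3
      · rintro rfl; exact absurd heA (hgc x hx h2 h3).2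
  have keyw : ∀ x ∈ W, (f2 x = w0 ↔ x = y1 ∨ (x ≠ z ∧ f x = w0)) := by
    intro x hx
    rcases cases4 x with rfl | rfl | ⟨h1, h2, h3⟩ | ⟨h1, h2, h3⟩
    · simp [f2y]
    · rw [f2z]; constructor
      · rintro rfl; exact absurd hw0 hcA
      · rintro (h | h) <;> tauto
    · rw [f2A x h1 h3]; tauto
    · rw [f2B x h2 h3]; constructor
      · intro h; exact absurd hw0 (h ▸ (hgc x hx h2 h3).2)
      · rintro (h | ⟨_, h⟩)
        · tauto
        · exact absurd (h ▸ hw0) h3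
  have keyB : ∀ e ∈ C, e ∉ A → ∀ x ∈ W, (f2 x = e ↔ (x = z ∧ e = c) ∨ (x ∈ (hsB W f A).erase y1 ∧ g x = e)) := by
    intro e heC heA x hx
    simp only [mem_erase, mem_hsB]
    rcases cases4 x with rfl | rfl | ⟨h1, h2, h3⟩ | ⟨h1, h2, h3⟩
    · rw [f2y]; constructor
      · rintro rfl; exact absurd hw0 heA
      · rintro (⟨h, _⟩ | h)
        · exact absurd h.symm hzy
        · tauto
    · rw [f2z]; constructor
      · rintro rfl; simp
      · rintro (h | h)
        · exact h.2.symm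
        · tauto
    · rw [f2A x h1 h3]; constructor
      · rintro rfl; exact absurd h3 heA
      · tauto
    · rw [f2B x h2 h3]; tauto
  have hnear : hsNear H W f2 C s cm c := by
    have hcmA : cm ∈ A := by rw [hAdef]; exact hsA_mem.2 ⟨hN.hm, {cm}, by simpa using hN.hm, hsAcc.base⟩
    have clsA : ∀ e ∈ A, e ≠ w0 → hsCls W f2 e = hsCls W f e := by
      intro e h1 h2; ext x; simp only [mem_hsCls]
      constructor
      · rintro ⟨h3, h4⟩; exact ⟨h3, (key e h1 h2 x h3).2 h4⟩
      · rintro ⟨h3, h4⟩; exact ⟨h3, (key e h1 h2 x h3).1 h4⟩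
    have ncp : ∀ e ∈ A, e ≠ cp := by rintro e h rfl; exact hcp h
    have clsB : ∀ e ∈ C, e ∉ A → e ≠ c → hsCls W f2 e = hsCls ((hsB W f A).erase y1) g e := by
      intro e h1 h2 h3; ext x; simp only [mem_hsCls]
      constructor
      · rintro ⟨h4, h5⟩
        rcases (keyB e h1 h2 x h4).1 h5 with h | h <;> tauto
      · rintro ⟨h4, h5⟩
        have hxW : x ∈ W := (mem_hsB.1 (mem_erase.1 h4).2).1
        exact ⟨hxW, (keyB e h1 h2 x hxW).2 (Or.inr ⟨h4, h5⟩)⟩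
    have clsC : hsCls W f2 c = insert z (hsCls ((hsB W f A).erase y1) g c) := by
      ext x; simp only [mem_hsCls, mem_insert]
      constructor
      · rintro ⟨h4, h5⟩
        rcases (keyB c hcC hcA x h4).1 h5 with h | h <;> tauto
      · rintro (rfl | ⟨h4, h5⟩)
        · exact ⟨hz, f2z⟩
        have hxW : x ∈ W := (mem_hsB.1 (mem_erase.1 h4).2).1
        exact ⟨hxW, (keyB c hcC hcA x hxW).2 (Or.inr ⟨h4, h5⟩)⟩
    refine ⟨?_, ?_, hN.hm, hcC, ?_, ?_, ?_, ?_⟩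
    · intro x hx
      rcases cases4 x with rfl | rfl | ⟨h1, h2, h3⟩ | ⟨h1, h2, h3⟩
      · rw [f2y]; exact hA hw0
      · rw [f2z]; exact hcC
      · rw [f2A x h1 h3]; exact hA h3
      · rw [f2B x h2 h3]; exact (hgc x hx h2 h3).1
    · have mem : ∀ x ∈ W, f2 x ∈ C := by
        intro x hx
        rcases cases4 x with rfl | rfl | ⟨h1, h2, h3⟩ | ⟨h1, h2, h3⟩
        · rw [f2y]; exact hA hw0
        · rw [f2z]; exact hcC
        · rw [f2A x h1 h3]; exact hA h3
        · rw [f2B x h2 h3]; exact (hgc x hx h2 h3).1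
      intro x hx x' hx' hadj heq
      by_cases he : f2 x ∈ A
      · by_cases hew : f2 x = w0
        · have hew' := heq ▸ hew
          rcases (keyw x hx).1 hew with rfl | ⟨h1, h2⟩
          · rcases (keyw x' hx').1 hew' with rfl | ⟨h3, h4⟩
            · exact hadj.ne rfl
            · exact h3 (hsolo1 x' hx' h4 hadj)
          · rcases (keyw x' hx').1 hew' with rfl | ⟨h3, h4⟩
            · exact h1 (hsolo1 x hx h2 hadj.symm)
            · exact hN.prop x hx x' hx' hadj (h2.trans h4.symm)
        · have a1 := (key _ he hew x hx).2 rfl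
          have a2 := (key _ he hew x' hx').2 heq.symm
          exact hN.prop x hx x' hx' hadj (a1.trans a2.symm)
      · rcases (keyB _ (mem x hx) he x hx).1 rfl with ⟨rfl, h1⟩ | ⟨h1, h2⟩
        · rcases (keyB _ (mem x hx) he x' hx').1 heq.symm with ⟨rfl, h3⟩ | ⟨h3, h4⟩
          · exact hadj.ne rfl
          · exact hcz x' h3 (h4.trans h1) hadj
        · rcases (keyB _ (mem x hx) he x' hx').1 heq.symm with ⟨rfl, h3⟩ | ⟨h3, h4⟩
          · exact hcz x h1 (h2.trans h3) hadj.symm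
          · exact hg.prop x h1 x' h3 hadj (h2.trans h4.symm)
    · rintro rfl; exact hcA hcmA
    · rw [clsA cm hcmA hw0m.symm]; exact hN.sizm
    · rw [clsC, card_insert_of_notMem, hg.siz c hc]
      simp only [mem_hsCls, mem_erase, mem_hsB]; tauto
    · intro e he hem hec
      by_cases heA : e ∈ A
      · by_cases hew : e = w0
        · have e1 : hsCls W f2 e = insert y1 ((hsCls W f e).erase z) := by
            subst hew
            ext x; simp only [mem_hsCls, mem_insert, mem_erase]
            constructor
            · rintro ⟨h1, h2⟩
              rcases (keyw x h1).1 h2 with h | h <;> tauto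
            · rintro (rfl | ⟨h1, h2, h3⟩)
              · exact ⟨hyW, f2y⟩
              · exact ⟨h2, (keyw x h2).2 (Or.inr ⟨h1, h3⟩)⟩
          have hzm : z ∈ hsCls W f e := mem_hsCls.2 ⟨hz, hzw.trans hew.symm⟩
          rw [e1, card_insert_of_notMem, card_erase_of_mem hzm]
          · have := card_pos.2 ⟨z, hzm⟩
            rw [hN.siz e he hem (ncp e heA)] at this ⊢
            omega
          · simp only [mem_erase, mem_hsCls]; rintro ⟨_, _, h⟩; exact hyA (h ▸ heA)
        · rw [clsA e heA hew]; exact hN.siz e he hem (ncp e heA)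
      · rw [clsB e he heA hec]; exact hg.siz e (by simp [he, heA])
  refine ⟨f2, hnear, ?_⟩
  have r1 : ∀ X ∈ A, X ≠ w0 → hsR H W f2 cm C X := by
    intro X hX hXw
    obtain ⟨D, hD, h⟩ := hterm X hX hXw
    refine ⟨D, hD.trans ((erase_subset _ _).trans hA), hsAcc_congr h ?_⟩
    intro e he
    have := hD he
    rw [mem_erase] at this
    exact key e this.2 this.1
  have r2 : hsR H W f2 cm C w0 := by
    have h0 := hw0
    rw [hAdef] at h0
    obtain ⟨D, hD, h⟩ := (hsA_mem.1 h0).2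
    cases h with
    | base => exact absurd rfl hw0m
    | step D' _ c' w h1 h2 h3 h4 h5 =>
      have hc'D := (hsAcc_mem h5).2
      have hc'A : c' ∈ A := by
        rw [hAdef]; exact hsA_sub ((subset_insert _ _).trans hD) h5 hc'D
      have hc'w : c' ≠ w0 := by rintro rfl; exact h4 hc'D
      have hwz : w ≠ z := by rintro rfl; exact hzn c' hc'A hc'w h3
      have hfw : f2 w = w0 := (keyw w h1).2 (Or.inr ⟨hwz, h2⟩)
      rw [← hfw]
      refine hsR_step w h1 (hfw ▸ hA hw0) (c' := c') ?_ (r1 c' hc'A hc'w)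
      intro x hx hx2
      exact h3 x hx ((key c' hc'A hc'w x hx).2 hx2)
  have hy2W := (mem_hsB.1 hy2).1
  have hy2A := (mem_hsB.1 hy2).2
  have gy2 := hgc y2 hy2W hne.symm hy2A
  have f2y2 : f2 y2 = g y2 := f2B y2 hne.symm hy2A
  have r3 : hsR H W f2 cm C (g y2) := by
    rw [← f2y2]
    refine hsR_step y2 hy2W (f2y2 ▸ gy2.1) (c' := w0) ?_ r2
    intro x hx hx2 hadj
    rcases (keyw x hx).1 hx2 with rfl | ⟨h3, h4⟩
    · exact hna hadj.symm
    · exact h3 (hsolo2 x hx h4 hadj)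
  refine card_lt_card ⟨?_, fun h => gy2.2 (h (hsA_mem.2 ⟨gy2.1, r3⟩))⟩
  intro X hX
  refine hsA_mem.2 ⟨hA hX, ?_⟩
  by_cases hXw : X = w0
  · rw [hXw]; exact r2
  · exact r1 X hX hXw

/-- terminal classes. -/
lemma hs_terminal {H : SimpleGraph V} {W : Finset V} {f : V → ℕ} {cm : ℕ} {A : Finset ℕ}
    (hcm : cm ∈ A) (hacc : ∀ X ∈ A, hsR H W f cm A X) (ha : 2 ≤ A.card) :
    ∃ U ∈ A, ∃ A' ⊆ A.erase U, A'.Nonempty ∧ cm ∉ A' ∧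
      (∀ w0 ∈ A', ∀ x ∈ W, f x = w0 → ∀ X ∈ A, X ≠ U → X ∉ A' → ¬ hsMov H W f x X) ∧
      (∀ w0 ∈ A', ∀ X ∈ A, X ≠ w0 → hsR H W f cm (A.erase w0) X) := by
  let N : ℕ → Finset ℕ := fun U => (A.erase U).filter (fun X => ¬ hsR H W f cm (A.erase U) X)
  have hNm : ∀ U X, X ∈ N U ↔ X ≠ U ∧ X ∈ A ∧ ¬ hsR H W f cm (A.erase U) X := by
    intro U X; simp [N, and_assoc]
  have hex : (A.filter fun U => (N U).Nonempty).Nonempty := by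
    refine ⟨cm, ?_⟩
    rw [mem_filter]
    refine ⟨hcm, ?_⟩
    obtain ⟨X, hX, hXc⟩ := exists_mem_ne (by omega : 1 < A.card) cm
    refine ⟨X, (hNm _ _).2 ⟨hXc, hX, ?_⟩⟩
    rintro ⟨D, hD, h⟩
    have := hD (hsAcc_mem h).1
    simp at this
  obtain ⟨U, hU, hmin⟩ := exists_min_image _ (fun U => (N U).card) hex
  rw [mem_filter] at hU
  have base : ∀ w0, w0 ≠ cm → hsR H W f cm (A.erase w0) cm := by
    intro w0 h
    exact ⟨{cm}, by simp [hcm, h.symm], hsAcc.base⟩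
  have hcmN : cm ∉ N U := by
    intro h
    have h1 := (hNm _ _).1 h
    exact h1.2.2 (base U h1.1.symm)
  refine ⟨U, hU.1, N U, filter_subset _ _, hU.2, hcmN, ?_, ?_⟩
  · intro w0 hw0 x hx hfx X hX hXU hXN hmov
    have h1 := (hNm _ _).1 hw0
    have h2 : hsR H W f cm (A.erase U) X := by
      by_contra h; exact hXN ((hNm _ _).2 ⟨hXU, hX, h⟩)
    apply h1.2.2
    rw [← hfx]
    exact hsR_step x hx (by rw [hfx, mem_erase]; exact ⟨h1.1, h1.2.1⟩) hmov h2
  · intro w0 hw0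
    have h1 := (hNm _ _).1 hw0
    by_contra hcon
    push Not at hcon
    obtain ⟨X0, hX0, hX0w, hX0r⟩ := hcon
    have hw0cm : w0 ≠ cm := by rintro rfl; exact hcmN hw0
    have hne : (N w0).Nonempty := ⟨X0, (hNm _ _).2 ⟨hX0w, hX0, hX0r⟩⟩
    have hle := hmin w0 (by rw [mem_filter]; exact ⟨h1.2.1, hne⟩)
    have hss : N w0 ⊂ N U := by
      refine ⟨?_, fun h => by simpa using ((hNm _ _).1 (h hw0)).1⟩
      intro X hX
      have h2 := (hNm _ _).1 hX
      refine (hNm _ _).2 ⟨?_, h2.2.1, ?_⟩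
      · rintro rfl
        obtain ⟨D, hD, h⟩ := hacc X h2.2.1
        cases h with
        | base => exact h2.2.2 (base w0 hw0cm)
        | step D' _ c' w g1 g2 g3 g4 g5 =>
          by_cases hw0D : w0 ∈ D'
          · obtain ⟨D2, hD2, h'⟩ := hsAcc_sub g5 w0 hw0D
            apply h1.2.2
            refine ⟨D2, ?_, h'⟩
            intro e he
            rw [mem_erase]
            refine ⟨?_, hD (mem_insert_of_mem (hD2 he))⟩
            rintro rfl; exact g4 (hD2 he)
          · apply h2.2.2
            refine ⟨_, ?_, hsAcc.step D' _ c' w g1 g2 g3 g4 g5⟩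
            intro e he
            rw [mem_erase]
            refine ⟨?_, hD he⟩
            rintro rfl
            rcases mem_insert.1 he with rfl | he
            · exact h2.1 rfl
            · exact hw0D he
      · rintro ⟨D, hD, h⟩
        by_cases hw0D : w0 ∈ D
        · obtain ⟨D2, hD2, h'⟩ := hsAcc_sub h w0 hw0D
          exact h1.2.2 ⟨D2, hD2.trans hD, h'⟩
        · apply h2.2.2
          refine ⟨D, ?_, h⟩
          intro e he
          rw [mem_erase]
          refine ⟨?_, (mem_erase.1 (hD he)).2⟩
          rintro rfl; exact hw0D he
    exact absurd (card_lt_card hss) (by omega)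

end HSz3



section HSz4
open scoped Classical

lemma hsDg_comm (H : SimpleGraph V) (S T : Finset V) :
    ∑ y ∈ T, hsDg H S y = ∑ x ∈ S, hsDg H T x := by
  unfold hsDg
  simp only [card_filter]
  rw [sum_comm]
  simp only [H.adj_comm]

lemma hsDg_mono (H : SimpleGraph V) {S T : Finset V} (h : S ⊆ T) (v : V) : hsDg H S v ≤ hsDg H T v :=
  card_le_card (filter_subset_filter _ h)

lemma hs_two_le {H : SimpleGraph V} {W : Finset V} {f : V → ℕ} {C : Finset ℕ} {s cm cp : ℕ}
    (hN : hsNear H W f C s cm cp) (hdeg : ∀ v ∈ W, hsDg H W v < C.card)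
    {A : Finset ℕ} (hA : A ⊆ C) (hcm : cm ∈ A) (hcp : cp ∉ A)
    (hBmov : ∀ y ∈ hsB W f A, ∀ X ∈ A, ¬ hsMov H W f y X) : 2 ≤ A.card := by
  by_contra hlt
  have h1 : 0 < A.card := card_pos.2 ⟨cm, hcm⟩
  have ha : A.card = 1 := by omega
  have hB := hsB_card hN hA hcm hcp
  rw [card_sdiff_of_subset hA, ha] at hB
  have h2 : (hsB W f A).card ≤ ∑ y ∈ hsB W f A, hsDg H (hsCls W f cm) y := by
    rw [card_eq_sum_ones]
    exact sum_le_sum fun y hy => hsDg_pos (hBmov y hy cm hcm)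
  rw [hsDg_comm] at h2
  have h3 : ∑ x ∈ hsCls W f cm, hsDg H (hsB W f A) x ≤ (hsCls W f cm).card * (C.card - 1) := by
    rw [← smul_eq_mul]
    refine sum_le_card_nsmul _ _ _ fun x hx => ?_
    have := hdeg x (mem_hsCls.1 hx).1
    have hsub : hsB W f A ⊆ W := filter_subset _ _
    have := hsDg_mono H hsub x
    omega
  have h4 := hN.sizm
  have : (hsCls W f cm).card * (C.card - 1) ≤ (C.card - 1) * s := by
    rw [mul_comm]; exact Nat.mul_le_mul_left _ (by omega)
  omega

def hsInd (H : SimpleGraph V) (I : Finset V) : Prop := ∀ x ∈ I, ∀ y ∈ I, ¬ H.Adj x y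

lemma hs_indep (H : SimpleGraph V) (B : Finset V) : ∃ I ⊆ B, (∀ x ∈ I, ∀ y ∈ I, ¬ H.Adj x y) ∧
    B.card ≤ ∑ y ∈ I, (1 + hsDg H B y) := by
  have hne : (B.powerset.filter fun I => hsInd H I).Nonempty := 
    ⟨∅, by rw [mem_filter]; exact ⟨by simp, by intro x hx; simp at hx⟩⟩
  obtain ⟨I, hI, hmax⟩ := exists_max_image _ card hne
  rw [mem_filter, mem_powerset] at hI
  refine ⟨I, hI.1, hI.2, ?_⟩
  have hsub : B ⊆ I.biUnion fun y => insert y (B.filter fun x => H.Adj y x) := by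
    intro x hx
    rw [mem_biUnion]
    by_contra hcon
    push Not at hcon
    have hxI : x ∉ I := fun h => hcon x h (mem_insert_self _ _)
    have hxa : ∀ y ∈ I, ¬ H.Adj y x := fun y hy h => hcon y hy (mem_insert_of_mem (by simp [hx, h]))
    have := hmax (insert x I) (by
      rw [mem_filter, mem_powerset]
      refine ⟨insert_subset hx hI.1, ?_⟩
      intro a ha b hb
      rw [mem_insert] at ha hb
      rcases ha with rfl | ha <;> rcases hb with rfl | hb
      · exact H.irrefl
      · intro h; exact hxa b hb h.symm
      · exact hxa a ha
      · exact hI.2 a ha b hb)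
    rw [card_insert_of_notMem hxI] at this
    omega
  calc B.card ≤ _ := card_le_card hsub
    _ ≤ ∑ y ∈ I, (insert y (B.filter fun x => H.Adj y x)).card := card_biUnion_le
    _ ≤ _ := sum_le_sum fun y _ => by
      refine (card_insert_le _ _).trans ?_
      unfold hsDg; omega

lemma hs_one_solo {H : SimpleGraph V} {W : Finset V} {f : V → ℕ} {w0 : ℕ} {y z : V}
    (h : hsDg H (hsCls W f w0) y = 1) (hz : z ∈ W) (hzw : f z = w0) (hadj : H.Adj y z) :
    ∀ x ∈ W, f x = w0 → H.Adj y x → x = z := by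
  intro x hx hxw hxa
  unfold hsDg at h
  obtain ⟨u, hu⟩ := card_eq_one.1 h
  have h1 : x ∈ ({u} : Finset V) := by rw [← hu]; simp [mem_hsCls, hx, hxw, hxa]
  have h2 : z ∈ ({u} : Finset V) := by rw [← hu]; simp [mem_hsCls, hz, hzw, hadj]
  rw [mem_singleton] at h1 h2
  rw [h1, h2]

lemma hs_pair {H : SimpleGraph V} {W : Finset V} {f : V → ℕ} {C : Finset ℕ} {s cm cp : ℕ}
    (hN : hsNear H W f C s cm cp) (hdeg : ∀ v ∈ W, hsDg H W v < C.card)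
    {A : Finset ℕ} (hA : A ⊆ C) (hcm : cm ∈ A) (hcp : cp ∉ A)
    (hBmov : ∀ y ∈ hsB W f A, ∀ X ∈ A, ¬ hsMov H W f y X)
    {U : ℕ} (hU : U ∈ A) {A' : Finset ℕ} (hA' : A' ⊆ A.erase U) (hA'ne : A'.Nonempty) (hcmA' : cm ∉ A')
    (h1 : ∀ w0 ∈ A', ∀ x ∈ W, f x = w0 → ∀ X ∈ A, X ≠ U → X ∉ A' → ¬ hsMov H W f x X)
    (h2 : ∀ w0 ∈ A', ∀ z ∈ W, f z = w0 → ∀ y ∈ hsB W f A, H.Adj y z →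
      (∀ x ∈ W, f x = w0 → H.Adj y x → x = z) → ∀ X ∈ A, X ≠ w0 → ¬ hsMov H W f z X) :
    ∃ w0 ∈ A', ∃ z ∈ W, f z = w0 ∧ ∃ y1 ∈ hsB W f A, ∃ y2 ∈ hsB W f A, y1 ≠ y2 ∧ ¬ H.Adj y1 y2 ∧
      H.Adj y1 z ∧ (∀ x ∈ W, f x = w0 → H.Adj y1 x → x = z) ∧
      (∀ x ∈ W, f x = w0 → H.Adj y2 x → x = z) ∧ hsDg H (hsB W f A) z ≤ (C \ A).card := by
  set B := hsB W f A with hBdef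
  set b := (C \ A).card with hb
  have hk : A.card + b = C.card := by
    rw [hb, card_sdiff_of_subset hA]; have := card_le_card hA; omega
  have hBcard : B.card = b * s + 1 := hsB_card hN hA hcm hcp
  have hBW : B ⊆ W := filter_subset _ _
  have hA'A : A' ⊆ A := hA'.trans (erase_subset _ _)
  have hsz : ∀ w0 ∈ A', (hsCls W f w0).card = s := by
    intro w0 hw0
    refine hN.siz w0 (hA (hA'A hw0)) ?_ ?_
    · rintro rfl; exact hcmA' hw0
    · rintro rfl; exact hcp (hA'A hw0)
  -- solo vertices have few neighbours in B
  have hsoloB : ∀ w0 ∈ A', ∀ z ∈ W, f z = w0 → ∀ y ∈ B, H.Adj y z →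
      hsDg H (hsCls W f w0) y = 1 → hsDg H B z ≤ b := by
    intro w0 hw0 z hz hzw y hy hadj hone
    have hm := h2 w0 hw0 z hz hzw y hy hadj (hs_one_solo hone hz hzw hadj)
    have hd := hdeg z hz
    rw [hsDg_split H W f A z] at hd
    have h3 : (A.erase w0).card ≤ ∑ c ∈ A, hsDg H (hsCls W f c) z := by
      rw [card_eq_sum_ones]
      refine (sum_le_sum fun X hX => ?_).trans (sum_le_sum_of_subset (erase_subset w0 A))
      rw [mem_erase] at hX
      exact hsDg_pos (hm X hX.2 hX.1)
    rw [card_erase_of_mem (hA'A hw0)] at h3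
    have : B = hsB W f A := rfl
    rw [← this] at hd
    omega
  have hany : ∀ w0 ∈ A', ∀ z ∈ W, f z = w0 → hsDg H B z ≤ b + A'.card := by
    intro w0 hw0 z hz hzw
    have hd := hdeg z hz
    rw [hsDg_split H W f A z] at hd
    have h3 : ((A.erase U) \ A').card ≤ ∑ c ∈ A, hsDg H (hsCls W f c) z := by
      rw [card_eq_sum_ones]
      refine (sum_le_sum fun X hX => ?_).trans
        (sum_le_sum_of_subset (sdiff_subset.trans (erase_subset U A)))
      rw [mem_sdiff, mem_erase] at hX
      exact hsDg_pos (h1 w0 hw0 z hz hzw X hX.1.2 hX.1.1 hX.2)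
    rw [card_sdiff_of_subset hA', card_erase_of_mem hU] at h3
    have : B = hsB W f A := rfl
    rw [← this] at hd
    omega
  -- a' > b
  have hab : b < A'.card := by
    by_contra hle
    push Not at hle
    obtain ⟨w0, hw0⟩ := hA'ne
    have e1 : 2 * B.card ≤ ∑ y ∈ B, (hsDg H (hsCls W f w0) y +
        if hsDg H (hsCls W f w0) y = 1 then hsDg H (hsCls W f w0) y else 0) := by
      rw [mul_comm, ← smul_eq_mul]
      refine card_nsmul_le_sum _ _ _ fun y hy => ?_
      have := hsDg_pos (hBmov y hy w0 (hA'A hw0))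
      split_ifs <;> omega
    rw [sum_add_distrib, ← sum_filter, hsDg_comm H _ B, hsDg_comm H _ (B.filter _), ← sum_add_distrib] at e1
    have e2 : ∑ x ∈ hsCls W f w0, (hsDg H B x + hsDg H (B.filter fun y => hsDg H (hsCls W f w0) y = 1) x)
        ≤ s * (2 * b) := by
      rw [← hsz w0 hw0, ← smul_eq_mul]
      refine sum_le_card_nsmul _ _ _ fun z hz => ?_
      rw [mem_hsCls] at hz
      have m := hsDg_mono H (filter_subset (fun y => hsDg H (hsCls W f w0) y = 1) B) z
      by_cases hzero : hsDg H (B.filter fun y => hsDg H (hsCls W f w0) y = 1) z = 0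
      · have := hany w0 hw0 z hz.1 hz.2
        omega
      · obtain ⟨y, hy⟩ := card_pos.1 (Nat.pos_of_ne_zero hzero)
        simp only [mem_filter] at hy
        have := hsoloB w0 hw0 z hz.1 hz.2 y hy.1.1 hy.2.symm hy.1.2
        omega
    have e3 : s * (2 * b) = 2 * (b * s) := by ring
    omega
  by_contra hcon
  push Not at hcon
  obtain ⟨I, hIB, hI, hIc⟩ := hs_indep H B
  -- count t
  have ht : ∀ y ∈ B, A'.card + 1 + hsDg H B y ≤
      (A'.filter fun w0 => hsDg H (hsCls W f w0) y = 1).card + b := by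
    intro y hy
    have hd := hdeg y (hBW hy)
    rw [hsDg_split H W f A y] at hd
    have : B = hsB W f A := rfl
    rw [← this] at hd
    have e0 : ∑ c ∈ A, hsDg H (hsCls W f c) y =
      ∑ c ∈ A \ A', hsDg H (hsCls W f c) y + ∑ c ∈ A', hsDg H (hsCls W f c) y :=
      (sum_sdiff hA'A).symm
    have e1 : (A \ A').card ≤ ∑ c ∈ A \ A', hsDg H (hsCls W f c) y := by
      rw [card_eq_sum_ones]
      refine sum_le_sum fun X hX => hsDg_pos (hBmov y hy X (mem_sdiff.1 hX).1)
    rw [card_sdiff_of_subset hA'A] at e1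
    have e2 : A'.card * 2 ≤ ∑ c ∈ A', (hsDg H (hsCls W f c) y +
        if hsDg H (hsCls W f c) y = 1 then 1 else 0) := by
      rw [← smul_eq_mul]
      refine card_nsmul_le_sum _ _ _ fun X hX => ?_
      have := hsDg_pos (hBmov y hy X (hA'A hX))
      split_ifs <;> omega
    rw [sum_add_distrib, ← card_filter] at e2
    have := card_le_card hA'A
    omega
  have hup : ∑ y ∈ I, (A'.filter fun w0 => hsDg H (hsCls W f w0) y = 1).card ≤ A'.card * s := by
    simp only [card_filter]
    rw [sum_comm, ← smul_eq_mul]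
    refine sum_le_card_nsmul _ _ _ fun w0 hw0 => ?_
    rw [← card_filter]
    have e1 : (I.filter fun y => hsDg H (hsCls W f w0) y = 1).card =
        ∑ y ∈ I.filter (fun y => hsDg H (hsCls W f w0) y = 1), hsDg H (hsCls W f w0) y := by
      rw [card_eq_sum_ones]
      exact sum_congr rfl fun y hy => ((mem_filter.1 hy).2).symm
    rw [e1, hsDg_comm, ← hsz w0 hw0, card_eq_sum_ones]
    refine sum_le_sum fun z hz => ?_
    rw [mem_hsCls] at hz
    refine card_le_one.2 ?_
    intro y1 hy1 y2 hy2
    simp only [mem_filter] at hy1 hy2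
    by_contra hne
    have := hcon w0 hw0 z hz.1 hz.2 y1 (hIB hy1.1.1) y2 (hIB hy2.1.1) hne (hI _ hy1.1.1 _ hy2.1.1)
      hy1.2.symm (hs_one_solo hy1.1.2 hz.1 hz.2 hy1.2.symm) (hs_one_solo hy2.1.2 hz.1 hz.2 hy2.2.symm)
    have := hsoloB w0 hw0 z hz.1 hz.2 y1 (hIB hy1.1.1) hy1.2.symm hy1.1.2
    omega
  have hlow : ∑ y ∈ I, (A'.card + (1 + hsDg H B y)) ≤
      ∑ y ∈ I, ((A'.filter fun w0 => hsDg H (hsCls W f w0) y = 1).card + b) :=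
    sum_le_sum fun y hy => by have := ht y (hIB hy); omega
  rw [sum_add_distrib (f := fun _ => A'.card), sum_add_distrib (g := fun _ => b), sum_const, sum_const,
    smul_eq_mul, smul_eq_mul] at hlow
  have hIs : s < I.card := by
    have e1 : ∑ y ∈ I, (1 + hsDg H B y) ≤ I.card * b := by
      rw [← smul_eq_mul]
      refine sum_le_card_nsmul _ _ _ fun y hy => ?_
      have hd := hdeg y (hBW (hIB hy))
      rw [hsDg_split H W f A y] at hd
      have : B = hsB W f A := rfl
      rw [← this] at hd
      have e1 : A.card ≤ ∑ c ∈ A, hsDg H (hsCls W f c) y := by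
        rw [card_eq_sum_ones]
        refine sum_le_sum fun X hX => hsDg_pos (hBmov y (hIB hy) X hX)
      omega
    by_contra hle
    push Not at hle
    have : I.card * b ≤ b * s := by rw [mul_comm]; exact Nat.mul_le_mul_left _ hle
    omega
  obtain ⟨e, he⟩ := Nat.exists_eq_add_of_lt hab
  rw [he] at hlow hup
  have : s * e ≤ I.card * e := Nat.mul_le_mul_right _ hIs.le
  nlinarith

lemma hs_main (C : Finset ℕ) (IH : ∀ b < C.card, HSk V b) : ∀ (t : ℕ) (H : SimpleGraph V)
    (W : Finset V) (f : V → ℕ) (s cm cp : ℕ),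
    hsNear H W f C s cm cp → (∀ v ∈ W, hsDg H W v < C.card) →
    C.card ≤ (hsA H W f C cm).card + t → ∃ f', hsEq H W f' C s := by
  intro t
  induction t with
  | zero =>
    intro H W f s cm cp hN hdeg ht
    have : hsA H W f C cm = C := eq_of_subset_of_card_le (filter_subset _ _) (by omega)
    have h := hN.hp
    rw [← this] at h
    exact hs_done hN (hsA_mem.1 h).2
  | succ t ih =>
    intro H W f s cm cp hN hdeg ht
    by_cases hcpA : cp ∈ hsA H W f C cm
    · exact hs_done hN (hsA_mem.1 hcpA).2
    obtain ⟨A, hAdef⟩ : ∃ A, A = hsA H W f C cm := ⟨_, rfl⟩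
    rw [← hAdef] at hcpA ht
    have hA : A ⊆ C := by rw [hAdef]; exact filter_subset _ _
    have hcm : cm ∈ A := by rw [hAdef]; exact hsA_mem.2 ⟨hN.hm, {cm}, by simpa using hN.hm, hsAcc.base⟩
    have hBmov : ∀ y ∈ hsB W f A, ∀ X ∈ A, ¬ hsMov H W f y X := by
      intro y hy X hX hmov
      rw [mem_hsB] at hy
      apply hy.2
      rw [hAdef] at hX ⊢
      exact hsA_mem.2 ⟨hN.col y hy.1, hsR_step y hy.1 (hN.col y hy.1) hmov (hsA_mem.1 hX).2⟩
    have ha := hs_two_le hN hdeg hA hcm hcpA hBmov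
    have hacc : ∀ X ∈ A, hsR H W f cm A X := by
      intro X hX
      rw [hAdef] at hX
      obtain ⟨D, hD, h⟩ := (hsA_mem.1 hX).2
      exact ⟨D, by rw [hAdef]; exact hsA_sub hD h, h⟩
    obtain ⟨U, hU, A', hA', hA'ne, hcmA', h1, hterm⟩ := hs_terminal hcm hacc ha
    have hA'A : A' ⊆ A := hA'.trans (erase_subset _ _)
    have hk : A.card + (C \ A).card = C.card := by
      rw [card_sdiff_of_subset hA]; have := card_le_card hA; omega
    have hBcard := hsB_card hN hA hcm hcpA
    have hBd : ∀ y ∈ hsB W f A, hsDg H (hsB W f A) y < (C \ A).card := by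
      intro y hy
      have hd := hdeg y (mem_hsB.1 hy).1
      rw [hsDg_split H W f A y] at hd
      have e1 : A.card ≤ ∑ c ∈ A, hsDg H (hsCls W f c) y := by
        rw [card_eq_sum_ones]
        refine sum_le_sum fun X hX => hsDg_pos (hBmov y hy X hX)
      omega
    have hgex : ∀ y ∈ hsB W f A, ∃ g, hsEq H ((hsB W f A).erase y) g (C \ A) s := by
      intro y hy
      refine IH (C \ A).card (by omega) H _ _ s rfl ?_ ?_
      · rw [card_erase_of_mem hy, hBcard]; simp
      · intro v hv
        exact (hsDg_mono H (erase_subset _ _) v).trans_lt (hBd v (mem_erase.1 hv).2)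
    by_cases hsm : ∃ w0 ∈ A', ∃ z ∈ W, f z = w0 ∧ ∃ y ∈ hsB W f A, H.Adj y z ∧
      (∀ x ∈ W, f x = w0 → H.Adj y x → x = z) ∧ ∃ X ∈ A, X ≠ w0 ∧ hsMov H W f z X
    · obtain ⟨w0, hw0, z, hz, hzw, y, hy, _, hsolo, X, hX, hXw, hmov⟩ := hsm
      obtain ⟨g, hg⟩ := hgex y hy
      exact hs_solo_move hN hA hcpA (hA'A hw0) (by rintro rfl; exact hcmA' hw0) hz hzw hy hsolo
        (hterm w0 hw0 X hX hXw) hmov hg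
    push Not at hsm
    obtain ⟨w0, hw0, z, hz, hzw, y1, hy1, y2, hy2, hne, hna, hadj1, hs1, hs2, hdB⟩ :=
      hs_pair hN hdeg hA hcm hcpA hBmov hU hA' hA'ne hcmA' h1
        (fun w0 hw0 z hz hzw y hy hadj hsolo X hX hXw => hsm w0 hw0 z hz hzw y hy hadj hsolo X hX hXw)
    obtain ⟨g, hg⟩ := hgex y1 hy1
    have hcex : ∃ c ∈ C \ A, ∀ x ∈ (hsB W f A).erase y1, g x = c → ¬ H.Adj z x := by
      by_contra hcon
      push Not at hcon
      have e1 : (C \ A).card ≤ ((((hsB W f A).erase y1).filter fun x => H.Adj z x).image g).card := by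
        refine card_le_card fun c hc => ?_
        obtain ⟨x, hx, hgx, hadj⟩ := hcon c hc
        rw [mem_image]
        exact ⟨x, mem_filter.2 ⟨hx, hadj⟩, hgx⟩
      have e2 := e1.trans card_image_le
      have hm : y1 ∈ (hsB W f A).filter fun x => H.Adj z x := mem_filter.2 ⟨hy1, hadj1.symm⟩
      have e3 : ((hsB W f A).erase y1).filter (fun x => H.Adj z x) =
        ((hsB W f A).filter fun x => H.Adj z x).erase y1 := by
        ext x; simp only [mem_filter, mem_erase]; tauto
      rw [e3, card_erase_of_mem hm] at e2
      unfold hsDg at hdB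
      have := card_pos.2 ⟨y1, hm⟩
      omega
    obtain ⟨c, hc, hcz⟩ := hcex
    obtain ⟨f', hN', hlt⟩ := hs_swap hN hAdef hcpA (hA'A hw0) (by rintro rfl; exact hcmA' hw0)
      (hterm w0 hw0) hz hzw
      (fun X hX hXw => hsm w0 hw0 z hz hzw y1 hy1 hadj1 hs1 X hX hXw)
      hy1 hy2 hne hna hs1 hs2 hg hc hcz
    exact ih H W f' s cm c hN' hdeg (by omega)

end HSz4



section HSz5
open scoped Classical

lemma hs_part (C : Finset ℕ) : ∀ (W : Finset V) (s : ℕ), W.card = C.card * s →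
    ∃ f : V → ℕ, (∀ v ∈ W, f v ∈ C) ∧ ∀ c ∈ C, (hsCls W f c).card = s := by
  induction C using Finset.induction_on with
  | empty =>
    intro W s h
    simp at h
    subst h
    exact ⟨fun _ => 0, by simp, by simp⟩
  | insert c C hc ih =>
    intro W s h
    rw [card_insert_of_notMem hc] at h
    obtain ⟨T, hT, hTc⟩ := exists_subset_card_eq (s := W) (n := s) (by rw [h]; nlinarith)
    obtain ⟨f, hf1, hf2⟩ := ih (W \ T) s (by rw [card_sdiff_of_subset hT, h, hTc, Nat.succ_mul]; simp)
    refine ⟨fun x => if x ∈ T then c else f x, ?_, ?_⟩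
    · intro v hv
      by_cases h1 : v ∈ T
      · simp [h1]
      · simp [h1, hf1 v (by simp [hv, h1])]
    · intro e he
      by_cases hec : e = c
      · subst hec
        rw [← hTc]; congr 1
        ext x; simp only [mem_hsCls]
        by_cases h1 : x ∈ T
        · simp [h1, hT h1]
        · simp only [h1, if_false, iff_false, not_and]
          intro hx h; exact hc (h ▸ hf1 x (by simp [hx, h1]))
      · rw [← hf2 e ((mem_insert.1 he).resolve_left hec)]
        congr 1
        ext x; simp only [mem_hsCls, mem_sdiff]
        by_cases h1 : x ∈ T
        · simp [h1, Ne.symm hec]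
        · simp [h1]

def hsRes (H : SimpleGraph V) (S : Finset V) : SimpleGraph V where
  Adj x y := H.Adj x y ∧ x ∈ S ∧ y ∈ S
  symm := ⟨fun _ _ h => ⟨h.1.symm, h.2.2, h.2.1⟩⟩
  loopless := ⟨fun _ h => h.1.ne rfl⟩

theorem hs_all (k : ℕ) : HSk V k := by
  induction k using Nat.strong_induction_on with
  | _ k IH =>
  intro H W C s hC hW hdeg
  subst hC
  have key : ∀ S : Finset V, S ⊆ W → ∃ f, hsEq (hsRes H S) W f C s := by
    intro S
    induction S using Finset.induction_on with
    | empty =>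
      intro _
      obtain ⟨f, h1, h2⟩ := hs_part C W s hW
      exact ⟨f, h1, fun x _ y _ h => absurd h.2.1 (notMem_empty _), h2⟩
    | insert x S hx ih =>
      intro hS
      obtain ⟨f, hf⟩ := ih ((subset_insert _ _).trans hS)
      have hxW : x ∈ W := hS (mem_insert_self _ _)
      have hdeg' : ∀ v ∈ W, hsDg (hsRes H (insert x S)) W v < C.card := by
        intro v hv
        refine lt_of_le_of_lt (card_le_card ?_) (hdeg v hv)
        intro y; simp only [mem_filter]; rintro ⟨h1, h2⟩; exact ⟨h1, h2.1⟩
      have hcex : ∃ c ∈ C, hsMov (hsRes H (insert x S)) W f x c := by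
        by_contra hcon
        push Not at hcon
        have e1 := hsDg_split (hsRes H (insert x S)) W f C x
        have e2 : C.card ≤ ∑ c ∈ C, hsDg (hsRes H (insert x S)) (hsCls W f c) x := by
          rw [card_eq_sum_ones]
          exact sum_le_sum fun c hc => hsDg_pos (hcon c hc)
        have := hdeg' x hxW
        omega
      obtain ⟨c, hc, hmov⟩ := hcex
      have hsame : ∀ a b, a ≠ x → b ≠ x → (hsRes H (insert x S)).Adj a b → (hsRes H S).Adj a b := by
        rintro a b ha hb ⟨h1, h2, h3⟩
        rw [mem_insert] at h2 h3
        exact ⟨h1, h2.resolve_left ha, h3.resolve_left hb⟩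
      have hprop : hsProper (hsRes H (insert x S)) W (Function.update f x c) := by
        intro a ha b hb hab
        by_cases h1 : a = x
        · subst h1
          have h2 : b ≠ a := hab.ne'
          simp only [Function.update_self, Function.update_of_ne h2]
          intro h3; exact hmov b hb h3.symm hab
        · by_cases h2 : b = x
          · subst h2
            simp only [Function.update_self, Function.update_of_ne h1]
            intro h3; exact hmov a ha h3 hab.symm
          · simp only [Function.update_of_ne h1, Function.update_of_ne h2]
            exact hf.prop a ha b hb (hsame a b h1 h2 hab)
      by_cases hcx : c = f x
      · refine ⟨f, hf.col, ?_, hf.siz⟩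
        rw [hcx, Function.update_eq_self] at hprop
        exact hprop
      have hxm : x ∈ hsCls W f (f x) := mem_hsCls.2 ⟨hxW, rfl⟩
      have hnear : hsNear (hsRes H (insert x S)) W (Function.update f x c) C s (f x) c := by
        refine ⟨?_, hprop, hf.col x hxW, hc, Ne.symm hcx, ?_, ?_, ?_⟩
        · intro v hv
          by_cases h1 : v = x
          · subst h1; simpa using hc
          · rw [Function.update_of_ne h1]; exact hf.col v hv
        · have e : hsCls W (Function.update f x c) (f x) = (hsCls W f (f x)).erase x := by
            ext y; simp only [mem_hsCls, mem_erase]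
            by_cases h1 : y = x
            · subst h1; simp [hcx]
            · rw [Function.update_of_ne h1]; tauto
          have := card_pos.2 ⟨x, hxm⟩
          rw [e, card_erase_of_mem hxm, ← hf.siz _ (hf.col x hxW)]
          omega
        · have e : hsCls W (Function.update f x c) c = insert x (hsCls W f c) := by
            ext y; simp only [mem_hsCls, mem_insert]
            by_cases h1 : y = x
            · subst h1; simp [hxW]
            · rw [Function.update_of_ne h1]; tauto
          rw [e, card_insert_of_notMem, hf.siz c hc]
          simp [mem_hsCls]; intro _ h; exact hcx h.symm
        · intro e he h1 h2
          rw [← hf.siz e he]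
          congr 1
          ext y; simp only [mem_hsCls]
          by_cases h3 : y = x
          · subst h3; simp [Ne.symm h2, Ne.symm h1]
          · rw [Function.update_of_ne h3]
      exact hs_main C IH C.card _ W _ s _ _ hnear hdeg' (by omega)
  obtain ⟨f, hf⟩ := key W subset_rfl
  exact ⟨f, hf.col, fun x hx y hy h => hf.prop x hx y hy ⟨h, hx, hy⟩, hf.siz⟩

end HSz5

open scoped Classical in
theorem hs_tiling [DecidableEq V] (G : SimpleGraph V) (r μ : ℕ) (hr : 1 ≤ r) (U : Finset V)
    (hdvd : r ∣ U.card) (hmiss : ∀ x ∈ U, (U.filter fun y => ¬ G.Adj x y).card ≤ μ)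
    (hμ : r * μ ≤ U.card) : ∃ T, IsKrTilingOn G r T U := by
  obtain ⟨k, hk⟩ := hdvd
  have hμk : μ ≤ k := by rw [hk] at hμ; exact Nat.le_of_mul_le_mul_left hμ hr
  obtain ⟨f, hf⟩ := hs_all (V := V) k Gᶜ U (range k) r (card_range k) (by rw [hk, mul_comm]) (by
    intro v hv
    have h1 := hmiss v hv
    have h3 : hsDg Gᶜ U v ≤ ((U.filter fun y => ¬ G.Adj v y).erase v).card := by
      refine card_le_card ?_
      intro x; simp only [mem_filter, mem_erase, SimpleGraph.compl_adj]
      rintro ⟨h1, h2, h3⟩; exact ⟨h2.symm, h1, h3⟩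
    have hm : v ∈ U.filter fun y => ¬ G.Adj v y := by simp [hv]
    rw [card_erase_of_mem hm] at h3
    have := card_pos.2 ⟨v, hm⟩
    omega)
  refine ⟨(range k).image (hsCls U f), ?_, ?_, ?_⟩
  · intro K hK
    rw [mem_image] at hK
    obtain ⟨c, hc, rfl⟩ := hK
    refine ⟨?_, hf.siz c hc⟩
    intro x hx y hy hxy
    have hx' := mem_hsCls.1 (mem_coe.1 hx)
    have hy' := mem_hsCls.1 (mem_coe.1 hy)
    by_contra h
    exact hf.prop x hx'.1 y hy'.1 ((SimpleGraph.compl_adj _ _ _).2 ⟨hxy, h⟩) (hx'.2.trans hy'.2.symm)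
  · intro K hK K' hK' hne
    rw [mem_image] at hK hK'
    obtain ⟨c, hc, rfl⟩ := hK
    obtain ⟨c', hc', rfl⟩ := hK'
    rw [disjoint_left]
    intro x hx hx'
    rw [mem_hsCls] at hx hx'
    exact hne (by rw [← hx.2, ← hx'.2])
  · ext x
    simp only [mem_biUnion, mem_image, id]
    constructor
    · rintro ⟨_, ⟨c, _, rfl⟩, hx⟩; exact (mem_hsCls.1 hx).1
    · intro hx; exact ⟨_, ⟨f x, hf.col x hx, rfl⟩, mem_hsCls.2 ⟨hx, rfl⟩⟩



section PotB
variable [DecidableEq V]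
set_option linter.unusedSectionVars false

def cntK {q : ℕ} (f : Sym2 V → Fin q) (c : Fin q) (K : Finset V) : ℕ :=
  (K.sym2.filter fun e => ¬ e.IsDiag ∧ f e = c).card

def phK {q : ℕ} (f : Sym2 V → Fin q) (c : Fin q) (x y : V) : ℕ := if f s(x, y) = c then 1 else 0

lemma phK_comm {q : ℕ} (f : Sym2 V → Fin q) (c : Fin q) (x y : V) : phK f c x y = phK f c y x := by
  unfold phK; rw [Sym2.eq_swap]

lemma cntK_insert {q : ℕ} (f : Sym2 V → Fin q) (c : Fin q) {u : V} {A : Finset V} (hu : u ∉ A) :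
    cntK f c (insert u A) = cntK f c A + ∑ a ∈ A, phK f c u a := by
  unfold cntK phK
  rw [sym2_insert, filter_union, card_union_of_disjoint, add_comm]
  · congr 1
    rw [← card_filter, filter_image, card_image_of_injOn]
    · congr 1
      ext a
      simp only [mem_filter, mem_insert, Sym2.mk_isDiag_iff]
      constructor
      · rintro ⟨h1 | h1, h2, h3⟩
        · exact absurd h1.symm h2
        · exact ⟨h1, h3⟩
      · rintro ⟨h1, h2⟩
        exact ⟨Or.inr h1, by rintro rfl; exact hu h1, h2⟩
    · intro a _ b _ hab
      rcases (by simpa using hab : a = b ∨ u = b ∧ a = u) with h | h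
      · exact h
      · exact h.2.trans h.1
  · rw [disjoint_left]
    intro e he he'
    simp only [mem_filter, mem_image, mem_insert] at he he'
    obtain ⟨⟨a, _, rfl⟩, _⟩ := he
    rw [mk_mem_sym2_iff] at he'
    exact hu he'.1.1

lemma tiling_card {G : SimpleGraph V} {r : ℕ} {T : Finset (Finset V)} {S : Finset V}
    (h : IsKrTilingOn G r T S) : S.card = T.card * r := by
  rw [← h.2.2, card_biUnion (t := id) (fun K hK K' hK' hne => h.2.1 K hK K' hK' hne)]
  exact sum_const_nat fun K hK => (h.1 K hK).card_eq

lemma gad1 {G : SimpleGraph V} {r q : ℕ} (f : Sym2 V → Fin q) {ι : Type} [Fintype ι] [DecidableEq ι]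
    (v : ι → V) (hv : Function.Injective v) (A : ι → Finset V)
    (hA : ∀ i j, i ≠ j → Disjoint (A i) (A j)) (hvA : ∀ i j, v i ∉ A j)
    (hK : ∀ i, G.IsNClique r (insert (v i) (A i))) :
    IsKrTilingOn G r (univ.image fun i => insert (v i) (A i)) (univ.biUnion A ∪ univ.image v) ∧
    ∀ c, tilingColorCount f (univ.image fun i => insert (v i) (A i)) c =
      ∑ i, cntK f c (insert (v i) (A i)) := by
  have hinj : Function.Injective fun i => insert (v i) (A i) := by
    intro i j hij
    by_contra hne
    have h1 : v i ∈ insert (v j) (A j) := by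
      have : insert (v i) (A i) = insert (v j) (A j) := hij
      rw [← this]; exact mem_insert_self _ _
    rcases mem_insert.1 h1 with h | h
    · exact hne (hv h)
    · exact hvA i j h
  refine ⟨⟨?_, ?_, ?_⟩, ?_⟩
  · intro K h
    rw [mem_image] at h
    obtain ⟨i, _, rfl⟩ := h
    exact hK i
  · intro K h K' h' hne
    rw [mem_image] at h h'
    obtain ⟨i, _, rfl⟩ := h
    obtain ⟨j, _, rfl⟩ := h'
    have hij : i ≠ j := by rintro rfl; exact hne rfl
    rw [disjoint_left]
    intro x hx hx'
    rw [mem_insert] at hx hx'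
    rcases hx with rfl | hx
    · rcases hx' with h | h
      · exact hij (hv h)
      · exact hvA i j h
    · rcases hx' with rfl | h
      · exact hvA j i hx
      · exact disjoint_left.1 (hA i j hij) hx h
  · ext x
    simp only [mem_biUnion, mem_image, mem_union, id, mem_univ, true_and]
    constructor
    · rintro ⟨_, ⟨i, rfl⟩, hx⟩
      rcases mem_insert.1 hx with rfl | hx
      · exact Or.inr ⟨i, rfl⟩
      · exact Or.inl ⟨i, hx⟩
    · rintro (⟨i, hx⟩ | ⟨i, rfl⟩)
      · exact ⟨_, ⟨i, rfl⟩, mem_insert_of_mem hx⟩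
      · exact ⟨_, ⟨i, rfl⟩, mem_insert_self _ _⟩
  · intro c
    unfold tilingColorCount cntK
    rw [sum_image (fun i _ j _ h => hinj h)]

/-- no small gadgets inside `V'` -/
def NoGad (G : SimpleGraph V) (r : ℕ) {q : ℕ} (f : Sym2 V → Fin q) (V' : Finset V) : Prop :=
  ∀ S ⊆ V', S.card ≤ 3 * r → ∀ T1 T2, IsKrTilingOn G r T1 S → IsKrTilingOn G r T2 S →
    ∀ c, tilingColorCount f T1 c = tilingColorCount f T2 c

lemma gad2 {G : SimpleGraph V} {r q : ℕ} {f : Sym2 V → Fin q} {V' : Finset V} (hng : NoGad G r f V')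
    {ι : Type} [Fintype ι] [DecidableEq ι] (hι : Fintype.card ι ≤ 3)
    (v : ι → V) (hv : Function.Injective v) (A : ι → Finset V) (σ : Equiv.Perm ι)
    (hvV : ∀ i, v i ∈ V') (hAV : ∀ i, A i ⊆ V')
    (hA : ∀ i j, i ≠ j → Disjoint (A i) (A j)) (hvA : ∀ i j, v i ∉ A j)
    (hK : ∀ i, G.IsNClique r (insert (v i) (A i)))
    (hK' : ∀ i, G.IsNClique r (insert (v (σ i)) (A i))) (c : Fin q) :
    ∑ i, cntK f c (insert (v i) (A i)) = ∑ i, cntK f c (insert (v (σ i)) (A i)) := by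
  obtain ⟨h1, h2⟩ := gad1 f v hv A hA hvA hK
  obtain ⟨h3, h4⟩ := gad1 f (fun i => v (σ i)) (hv.comp σ.injective) A hA (fun i j => hvA _ _) hK'
  have e : univ.image (fun i => v (σ i)) = univ.image v := by
    ext x; simp only [mem_image, mem_univ, true_and]
    constructor
    · rintro ⟨i, rfl⟩; exact ⟨_, rfl⟩
    · rintro ⟨i, rfl⟩; exact ⟨σ.symm i, by simp⟩
  rw [e] at h3
  rw [← h2, ← h4]
  refine hng _ ?_ ?_ _ _ h1 h3 c
  · intro x
    simp only [mem_biUnion, mem_image, mem_union, mem_univ, true_and]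
    rintro (⟨i, hx⟩ | ⟨i, rfl⟩)
    · exact hAV i hx
    · exact hvV i
  · rw [tiling_card h1]
    refine Nat.mul_le_mul_right _ (card_image_le.trans ?_)
    simpa using hι

/-- common neighbour property -/
def CNbr (G : SimpleGraph V) (r L : ℕ) (V' : Finset V) : Prop :=
  ∀ X ⊆ V', X.card ≤ r → ∀ Y : Finset V, Y.card ≤ L → ∃ w ∈ V', w ∉ Y ∧ ∀ x ∈ X, G.Adj x w

lemma cn_ext {G : SimpleGraph V} {r L : ℕ} {V' : Finset V} (hcn : CNbr G r L V') (B Y : Finset V)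
    (hB : B ⊆ V') (hY : Y.card ≤ L) : ∀ (k : ℕ) (C : Finset V), C ⊆ V' → G.IsClique C →
    (∀ b ∈ B, ∀ a ∈ C, G.Adj b a) → B.card + C.card + k ≤ r + 1 →
    ∃ C', C ⊆ C' ∧ C' ⊆ V' ∧ G.IsClique C' ∧ (∀ b ∈ B, ∀ a ∈ C', G.Adj b a) ∧
      C'.card = C.card + k ∧ ∀ a ∈ C', a ∉ C → a ∉ Y := by
  intro k
  induction k with
  | zero =>
    intro C h1 h2 h3 _
    exact ⟨C, subset_rfl, h1, h2, h3, rfl, fun a h h' => absurd h h'⟩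
  | succ k ih =>
    intro C h1 h2 h3 h4
    obtain ⟨w, hw, hwY, hwa⟩ := hcn (B ∪ C) (union_subset hB h1)
      ((card_union_le _ _).trans (by omega)) Y hY
    have hwC : w ∉ C := fun h => (hwa w (mem_union_right _ h)).ne rfl
    obtain ⟨C', g1, g2, g3, g4, g5, g6⟩ := ih (insert w C) (insert_subset hw h1) (by
        rw [coe_insert]
        refine h2.insert ?_
        intro b hb _
        exact (hwa b (mem_union_right _ hb)).symm) (by
        intro b hb a ha
        rcases mem_insert.1 ha with rfl | ha
        · exact hwa b (mem_union_left _ hb)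
        · exact h3 b hb a ha) (by rw [card_insert_of_notMem hwC]; omega)
    refine ⟨C', (subset_insert _ _).trans g1, g2, g3, g4, ?_, ?_⟩
    · rw [g5, card_insert_of_notMem hwC]; omega
    · intro a ha haC
      by_cases haw : a = w
      · subst haw; exact hwY
      · exact g6 a ha (by simp [haw, haC])

/-- `A` is an `(r-1)`-clique in `V'` joined to both x and y -/
structure Lnk (G : SimpleGraph V) (r : ℕ) (V' : Finset V) (x y : V) (A : Finset V) : Prop where
  sub : A ⊆ V'
  left : x ∉ A
  right : y ∉ A
  cl : G.IsNClique r (insert x A)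
  cr : G.IsNClique r (insert y A)

lemma Lnk.symm {G : SimpleGraph V} {r : ℕ} {V' : Finset V} {x y : V} {A : Finset V}
    (h : Lnk G r V' x y A) : Lnk G r V' y x A := ⟨h.sub, h.right, h.left, h.cr, h.cl⟩

lemma Lnk.card {G : SimpleGraph V} {r : ℕ} {V' : Finset V} {x y : V} {A : Finset V}
    (h : Lnk G r V' x y A) : A.card + 1 = r := by
  have := h.cl.card_eq
  rwa [card_insert_of_notMem h.left] at this

lemma lnk_exists {G : SimpleGraph V} {r L : ℕ} {V' : Finset V} (hcn : CNbr G r L V') (hr : 1 ≤ r)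
    {x y : V} (hx : x ∈ V') (hy : y ∈ V') (Y : Finset V) (hY : Y.card ≤ L) :
    ∃ A, Lnk G r V' x y A ∧ Disjoint A Y := by
  obtain ⟨A, _, h2, h3, h4, h5, h6⟩ := cn_ext hcn {x, y} Y (by
      intro a ha; simp at ha; rcases ha with rfl | rfl <;> assumption) hY (r - 1) ∅ (by simp) (by simp)
      (by simp) (by have := card_le_two (a := x) (b := y); simp; omega)
  have hx' : x ∉ A := fun h => (h4 x (by simp) x h).ne rfl
  have hy' : y ∉ A := fun h => (h4 y (by simp) y h).ne rfl
  refine ⟨A, ⟨h2, hx', hy', ⟨?_, ?_⟩, ⟨?_, ?_⟩⟩, ?_⟩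
  · rw [coe_insert]; exact h3.insert fun b hb _ => h4 x (by simp) b hb
  · rw [card_insert_of_notMem hx', h5]; simp; omega
  · rw [coe_insert]; exact h3.insert fun b hb _ => h4 y (by simp) b hb
  · rw [card_insert_of_notMem hy', h5]; simp; omega
  · rw [disjoint_left]; intro a ha; exact h6 a ha (notMem_empty _)

def dfK {q : ℕ} (f : Sym2 V → Fin q) (c : Fin q) (x y : V) (A : Finset V) : ℤ :=
  (cntK f c (insert y A) : ℤ) - cntK f c (insert x A)

lemma df_disj {G : SimpleGraph V} {r q : ℕ} {f : Sym2 V → Fin q} {V' : Finset V}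
    (hng : NoGad G r f V') {x y : V} (hx : x ∈ V') (hy : y ∈ V') (hxy : x ≠ y) {A A' : Finset V}
    (hA : Lnk G r V' x y A) (hA' : Lnk G r V' x y A') (hd : Disjoint A A') (c : Fin q) :
    dfK f c x y A = dfK f c x y A' := by
  have := gad2 hng (ι := Fin 2) (by simp) ![x, y] (by
      intro i j; fin_cases i <;> fin_cases j <;> simp [hxy, hxy.symm]) ![A, A'] (Equiv.swap 0 1)
    (by intro i; fin_cases i <;> simp [hx, hy])
    (by intro i; fin_cases i <;> simp [hA.sub, hA'.sub])
    (by intro i j; fin_cases i <;> fin_cases j <;> simp [hd, hd.symm])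
    (by intro i j; fin_cases i <;> fin_cases j <;> simp [hA.left, hA.right, hA'.left, hA'.right])
    (by intro i; fin_cases i <;> simp [hA.cl, hA'.cr])
    (by intro i; fin_cases i <;> simp [hA.cr, hA'.cl]) c
  simp [Fin.sum_univ_two] at this
  unfold dfK
  omega

lemma df_eq {G : SimpleGraph V} {r q : ℕ} {f : Sym2 V → Fin q} {V' : Finset V} (hr : 1 ≤ r)
    (hng : NoGad G r f V') (hcn : CNbr G r (3 * r) V')
    {x y : V} (hx : x ∈ V') (hy : y ∈ V') (hxy : x ≠ y) {A A' : Finset V}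
    (hA : Lnk G r V' x y A) (hA' : Lnk G r V' x y A') (c : Fin q) :
    dfK f c x y A = dfK f c x y A' := by
  obtain ⟨A2, h, hd⟩ := lnk_exists hcn hr hx hy (A ∪ A') (by
    have := hA.card; have := hA'.card; have := card_union_le A A'; omega)
  rw [disjoint_union_right] at hd
  rw [df_disj hng hx hy hxy hA h hd.1.symm, df_disj hng hx hy hxy hA' h hd.2.symm]

lemma df_tri {G : SimpleGraph V} {r q : ℕ} {f : Sym2 V → Fin q} {V' : Finset V} (hr : 1 ≤ r)
    (hng : NoGad G r f V') (hcn : CNbr G r (3 * r) V')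
    {x y z : V} (hx : x ∈ V') (hy : y ∈ V') (hz : z ∈ V') (hxy : x ≠ y) (hyz : y ≠ z) (hxz : x ≠ z)
    {A1 A2 A3 : Finset V}
    (h1 : Lnk G r V' x y A1) (h2 : Lnk G r V' y z A2) (h3 : Lnk G r V' x z A3) (c : Fin q) :
    dfK f c x y A1 + dfK f c y z A2 = dfK f c x z A3 := by
  obtain ⟨B1, k1, d1⟩ := lnk_exists hcn hr hx hy {x, y, z} (by
    have := card_le_three (a := x) (b := y) (c := z); omega)
  obtain ⟨B2, k2, d2⟩ := lnk_exists hcn hr hy hz (B1 ∪ {x}) (by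
    have := k1.card; have := card_union_le B1 {x}; rw [card_singleton] at this; omega)
  obtain ⟨B3, k3, d3⟩ := lnk_exists hcn hr hz hx (B1 ∪ B2 ∪ {y}) (by
    have := k1.card; have := k2.card; have := card_union_le (B1 ∪ B2) {y}
    have := card_union_le B1 B2; simp at *; omega)
  rw [df_eq hr hng hcn hx hy hxy h1 k1, df_eq hr hng hcn hy hz hyz h2 k2,
    df_eq hr hng hcn hx hz hxz h3 k3.symm]
  simp only [disjoint_union_right, disjoint_singleton_right] at d2 d3
  have d1z : z ∉ B1 := fun h => disjoint_left.1 d1 h (by simp)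
  have := gad2 hng (ι := Fin 3) (by simp) ![x, y, z] (by
      intro i j; fin_cases i <;> fin_cases j <;> simp [hxy, hxy.symm, hyz, hyz.symm, hxz, hxz.symm])
    ![B1, B2, B3] (finRotate 3)
    (by intro i; fin_cases i <;> simp [hx, hy, hz])
    (by intro i; fin_cases i <;> simp [k1.sub, k2.sub, k3.sub])
    (by intro i j; fin_cases i <;> fin_cases j <;>
          simp [d2.1, d2.1.symm, d3.1.1, d3.1.1.symm, d3.1.2, d3.1.2.symm])
    (by intro i j; fin_cases i <;> fin_cases j <;>
          simp [k1.left, k1.right, k2.left, k2.right, k3.left, k3.right, d1z, d2.2, d3.2])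
    (by intro i; fin_cases i <;> simp [k1.cl, k2.cl, k3.cl])
    (by intro i; fin_cases i <;> simp [k1.cr, k2.cr, k3.cr]) c
  simp [Fin.sum_univ_three] at this
  unfold dfK
  omega

end PotB



section PotC
variable [DecidableEq V]

lemma clique_insert {G : SimpleGraph V} {C : Finset V} {w : V} (hC : G.IsClique (C : Set V))
    (h : ∀ b ∈ C, G.Adj b w) : G.IsClique ((insert w C : Finset V) : Set V) := by
  rw [coe_insert]
  exact hC.insert fun b hb _ => (h b hb).symm

/-- invariance under single swaps implies constancy -/
lemma swap_const {G : SimpleGraph V} {r L : ℕ} {V' : Finset V} (hcn : CNbr G r L V')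
    (F : Finset V → ℚ)
    (hF : ∀ x y A, x ∈ V' → y ∈ V' → x ≠ y → Lnk G r V' x y A → F (insert x A) = F (insert y A)) :
    ∀ (d : ℕ) (K K' : Finset V), K ⊆ V' → K' ⊆ V' → G.IsNClique r K → G.IsNClique r K' →
      (K \ K').card ≤ d → F K = F K' := by
  have hY0 : (∅ : Finset V).card ≤ L := by simp
  have cards : ∀ K K' : Finset V, K.card = r → K'.card = r → (K ∩ K').card + (K \ K').card = r := by
    intro K K' h _; rw [add_comm, card_sdiff_add_card_inter, h]
  intro d
  induction d with
  | zero =>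
    intro K K' _ _ h1 h2 hd
    have : K ⊆ K' := by rw [← sdiff_eq_empty_iff_subset, ← card_eq_zero]; omega
    rw [eq_of_subset_of_card_le this (by rw [h1.card_eq, h2.card_eq])]
  | succ d ih =>
    intro K K' hK hK' h1 h2 hd
    by_cases hlt : (K \ K').card ≤ d
    · exact ih K K' hK hK' h1 h2 hlt
    have hc : (K \ K').card = d + 1 := by omega
    have hc' : (K' \ K).card = d + 1 := by
      have e1 := cards K K' h1.card_eq h2.card_eq
      have e2 := cards K' K h2.card_eq h1.card_eq
      rw [inter_comm] at e2
      omega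
    have hCc := cards K K' h1.card_eq h2.card_eq
    obtain ⟨x, hx⟩ : (K \ K').Nonempty := card_pos.1 (by omega)
    obtain ⟨y, hy⟩ : (K' \ K).Nonempty := card_pos.1 (by omega)
    have hx1 := mem_sdiff.1 hx
    have hy1 := mem_sdiff.1 hy
    have hxy : x ≠ y := by rintro rfl; exact hx1.2 hy1.1
    rcases Nat.eq_zero_or_pos d with hd0 | hdpos
    · subst hd0
      have hKx : K = insert x (K ∩ K') := by
        ext a
        simp only [mem_insert, mem_inter]
        constructor
        · intro ha
          by_cases haK : a ∈ K'
          · exact Or.inr ⟨ha, haK⟩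
          · exact Or.inl (card_le_one.1 (by omega) a (mem_sdiff.2 ⟨ha, haK⟩) x hx)
        · rintro (rfl | h)
          · exact hx1.1
          · exact h.1
      have hKy : K' = insert y (K ∩ K') := by
        ext a
        simp only [mem_insert, mem_inter]
        constructor
        · intro ha
          by_cases haK : a ∈ K
          · exact Or.inr ⟨haK, ha⟩
          · exact Or.inl (card_le_one.1 (by omega) a (mem_sdiff.2 ⟨ha, haK⟩) y hy)
        · rintro (rfl | h)
          · exact hy1.1
          · exact h.2
      have hl : Lnk G r V' x y (K ∩ K') :=
        ⟨inter_subset_left.trans hK, fun h => hx1.2 (mem_inter.1 h).2, fun h => hy1.2 (mem_inter.1 h).1,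
          hKx ▸ h1, hKy ▸ h2⟩
      have := hF x y _ (hK hx1.1) (hK' hy1.1) hxy hl
      rwa [← hKx, ← hKy] at this
    · set C := K ∩ K' with hC
      have hCV : C ⊆ V' := inter_subset_left.trans hK
      have hCcl : G.IsClique (C : Set V) := h1.isClique.subset (by rw [hC, coe_inter]; exact Set.inter_subset_left)
      obtain ⟨w, hw, _, hwa⟩ := hcn (insert x (insert y C))
        (insert_subset (hK hx1.1) (insert_subset (hK' hy1.1) hCV))
        ((card_insert_le _ _).trans (by have := card_insert_le y C; omega)) ∅ hY0
      have hwx : G.Adj x w := hwa x (by simp)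
      have hwy : G.Adj y w := hwa y (by simp)
      have hwC : ∀ a ∈ C, G.Adj a w := fun a ha => hwa a (by simp [ha])
      have hwnC : w ∉ C := fun h => (hwC w h).ne rfl
      have ext1 : ∀ t, t ∈ V' → t ∉ C → (∀ a ∈ C, G.Adj a t) → G.Adj t w →
          ∃ K1, insert w (insert t C) ⊆ K1 ∧ K1 ⊆ V' ∧ G.IsNClique r K1 := by
        intro t htV htC hta htw
        have hwt : w ∉ insert t C := by
          rw [mem_insert]; rintro (h | h)
          · exact htw.ne h.symm
          · exact hwnC h
        have hcard : (insert w (insert t C)).card = C.card + 2 := by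
          rw [card_insert_of_notMem hwt, card_insert_of_notMem htC]
        obtain ⟨K1, g1, g2, g3, _, g5, _⟩ := cn_ext hcn ∅ ∅ (by simp) hY0 (r - (C.card + 2))
          (insert w (insert t C)) (insert_subset hw (insert_subset htV hCV))
          (clique_insert (clique_insert hCcl hta) (by
            intro b hb; rcases mem_insert.1 hb with rfl | hb
            · exact htw
            · exact hwC b hb)) (by simp) (by rw [hcard]; simp; omega)
        exact ⟨K1, g1, g2, g3, by rw [g5, hcard]; omega⟩
      have hxC : x ∉ C := fun h => hx1.2 (mem_inter.1 h).2
      have hyC : y ∉ C := fun h => hy1.2 (mem_inter.1 h).1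
      obtain ⟨K1, a1, a2, a3⟩ := ext1 x (hK hx1.1) hxC (fun a ha =>
        h1.isClique (mem_inter.1 ha).1 hx1.1 (by rintro rfl; exact hxC ha)) hwx
      obtain ⟨K2, b1, b2, b3⟩ := ext1 y (hK' hy1.1) hyC (fun a ha =>
        h2.isClique (mem_inter.1 ha).2 hy1.1 (by rintro rfl; exact hyC ha)) hwy
      have dist : ∀ (K K' D : Finset V), K.card = r → K'.card = r → D ⊆ K → D ⊆ K' → D.card = C.card + 1 →
          (K \ K').card ≤ d := by
        intro K K' D e1 e2 e3 e4 e5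
        have := cards K K' e1 e2
        have := card_le_card (subset_inter e3 e4)
        omega
      have s1 : F K = F K1 := ih K K1 hK a2 h1 a3 (dist K K1 (insert x C) h1.card_eq a3.card_eq
        (insert_subset hx1.1 inter_subset_left) ((subset_insert _ _).trans a1) (card_insert_of_notMem hxC))
      have s2 : F K1 = F K2 := ih K1 K2 a2 b2 a3 b3 (dist K1 K2 (insert w C) a3.card_eq b3.card_eq
        ((insert_subset_insert _ (subset_insert _ _)).trans a1)
        ((insert_subset_insert _ (subset_insert _ _)).trans b1) (card_insert_of_notMem hwnC))
      have s3 : F K2 = F K' := ih K2 K' b2 hK' b3 h2 (dist K2 K' (insert y C) b3.card_eq h2.card_eq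
        ((subset_insert _ _).trans b1) (insert_subset hy1.1 inter_subset_right) (card_insert_of_notMem hyC))
      rw [s1, s2, s3]

theorem potential {G : SimpleGraph V} {r q : ℕ} {f : Sym2 V → Fin q} {V' : Finset V} (hr : 1 ≤ r)
    (hng : NoGad G r f V') (hcn : CNbr G r (3 * r) V') (c : Fin q) :
    ∃ p : V → ℚ, ∀ K ⊆ V', G.IsNClique r K → (cntK f c K : ℚ) = ∑ x ∈ K, p x := by
  obtain ⟨o, ho, _⟩ := hcn ∅ (by simp) (by simp) ∅ (by simp)
  have hL : ∀ x, ∃ A, x ∈ V' → Lnk G r V' o x A := by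
    intro x
    by_cases hx : x ∈ V'
    · obtain ⟨A, h, _⟩ := lnk_exists hcn hr ho hx ∅ (by simp)
      exact ⟨A, fun _ => h⟩
    · exact ⟨∅, fun h => absurd h hx⟩
  choose A hA using hL
  let d : V → ℤ := fun x => dfK f c o x (A x)
  have hd : ∀ x y B, x ∈ V' → y ∈ V' → x ≠ y → Lnk G r V' x y B → dfK f c x y B = d y - d x := by
    intro x y B hx hy hxy hB
    by_cases hox : x = o
    · subst hox
      have : d x = 0 := by simp [d, dfK]
      rw [this, df_eq hr hng hcn hx hy hxy hB (hA y hy)]; simp [d]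
    by_cases hoy : y = o
    · subst hoy
      have : d y = 0 := by simp [d, dfK]
      rw [this, df_eq hr hng hcn hx hy hxy hB (hA x hx).symm]; simp [d, dfK]
    · have := df_tri hr hng hcn ho hx hy (Ne.symm hox) hxy (Ne.symm hoy) (hA x hx) hB (hA y hy) c
      simp only [d]; omega
  let F : Finset V → ℚ := fun K => (cntK f c K : ℚ) - ∑ x ∈ K, (d x : ℚ)
  have hF : ∀ x y A, x ∈ V' → y ∈ V' → x ≠ y → Lnk G r V' x y A → F (insert x A) = F (insert y A) := by
    intro x y B hx hy hxy hB
    have h1 := hd x y B hx hy hxy hB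
    unfold dfK at h1
    have h2 : (cntK f c (insert y B) : ℚ) - cntK f c (insert x B) = d y - d x := by exact_mod_cast h1
    simp only [F]
    rw [sum_insert hB.left, sum_insert hB.right]
    linarith
  obtain ⟨K0, _, g2, g3, _, g5, _⟩ := cn_ext hcn ∅ ∅ (by simp) (by simp) r ∅ (by simp) (by simp) (by simp)
    (by simp)
  have hK0 : G.IsNClique r K0 := ⟨g3, by simpa using g5⟩
  refine ⟨fun x => d x + F K0 / r, ?_⟩
  intro K hK hKc
  have e := swap_const hcn F hF _ K K0 hK g2 hKc hK0 le_rfl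
  rw [sum_add_distrib, sum_const, hKc.card_eq, nsmul_eq_mul, ← e]
  have : (r : ℚ) ≠ 0 := by positivity
  field_simp
  simp [F]

end PotC



section StrC
variable [DecidableEq V]
open scoped Classical
set_option linter.unusedSectionVars false

def degK {q : ℕ} (f : Sym2 V → Fin q) (c : Fin q) (Q : Finset V) (x : V) : ℕ :=
  ∑ y ∈ Q.erase x, phK f c x y

lemma phK_le {q : ℕ} (f : Sym2 V → Fin q) (c : Fin q) (x y : V) : phK f c x y ≤ 1 := by
  unfold phK; split_ifs <;> simp

lemma sum_phK {q : ℕ} (f : Sym2 V → Fin q) (x y : V) : ∑ c, phK f c x y = 1 := by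
  unfold phK; simp

lemma sum_phK_le {q : ℕ} (f : Sym2 V → Fin q) (Z : Finset (Fin q)) (x y : V) :
    ∑ c ∈ Z, phK f c x y ≤ 1 := by
  rw [← sum_phK f x y]
  exact sum_le_sum_of_subset (subset_univ _)

lemma cntK_erase {q : ℕ} (f : Sym2 V → Fin q) (c : Fin q) {Q : Finset V} {x : V} (hx : x ∈ Q) :
    cntK f c Q = cntK f c (Q.erase x) + degK f c Q x := by
  conv_lhs => rw [← insert_erase hx]
  rw [cntK_insert f c (notMem_erase x Q)]; rfl

lemma degK_le_cntK {q : ℕ} (f : Sym2 V → Fin q) (c : Fin q) {Q : Finset V} {x : V} (hx : x ∈ Q) :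
    degK f c Q x ≤ cntK f c Q := by rw [cntK_erase f c hx]; omega

lemma sum_degK_le {q : ℕ} (f : Sym2 V → Fin q) (Z : Finset (Fin q)) {Q : Finset V} {x : V} (hx : x ∈ Q) :
    ∑ c ∈ Z, degK f c Q x + 1 ≤ Q.card := by
  unfold degK
  rw [sum_comm]
  have := sum_le_sum (s := Q.erase x) fun y _ => sum_phK_le f Z x y
  rw [sum_const, card_erase_of_mem hx, smul_eq_mul] at this
  have := card_pos.2 ⟨x, hx⟩
  omega

lemma degK_lt {q : ℕ} (f : Sym2 V → Fin q) (c : Fin q) {Q : Finset V} {x : V} (hx : x ∈ Q) :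
    degK f c Q x + 1 ≤ Q.card := by simpa using sum_degK_le f {c} hx

lemma handshake {q : ℕ} (f : Sym2 V → Fin q) (c : Fin q) (K : Finset V) :
    ∑ x ∈ K, degK f c K x = 2 * cntK f c K := by
  induction K using Finset.induction_on with
  | empty => simp [cntK]
  | insert u A hu ih =>
    rw [sum_insert hu, cntK_insert f c hu]
    have e1 : degK f c (insert u A) u = ∑ a ∈ A, phK f c u a := by
      unfold degK; rw [erase_insert hu]
    have e2 : ∀ x ∈ A, degK f c (insert u A) x = phK f c u x + degK f c A x := by
      intro x hx
      unfold degK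
      have hxu : u ≠ x := by rintro rfl; exact hu hx
      rw [erase_insert_of_ne hxu, sum_insert (fun h => hu (mem_of_mem_erase h)), phK_comm]
    rw [e1, sum_congr rfl e2, sum_add_distrib, ih]
    omega

lemma sum_cntK {q : ℕ} (f : Sym2 V → Fin q) (K : Finset V) : ∑ c, cntK f c K = K.card.choose 2 := by
  induction K using Finset.induction_on with
  | empty => simp [cntK]
  | insert u A hu ih =>
    simp_rw [cntK_insert f _ hu]
    rw [sum_add_distrib, ih, sum_comm, sum_congr rfl fun a _ => sum_phK f u a, card_insert_of_notMem hu,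
      Nat.choose_succ_succ' A.card 1]
    simp; omega

noncomputable def missS (G : SimpleGraph V) (U : Finset V) (x : V) : Finset V := U.filter fun y => ¬ G.Adj x y

lemma mem_missS {G : SimpleGraph V} {U : Finset V} {x y : V} :
    y ∈ missS G U x ↔ y ∈ U ∧ ¬ G.Adj x y := by simp [missS]

structure Ctx (G : SimpleGraph V) {q : ℕ} (f : Sym2 V → Fin q) (r μ : ℕ) (U : Finset V)
    (p : Fin q → V → ℚ) : Prop where
  hr : 3 ≤ r
  miss : ∀ x ∈ U, (missS G U x).card ≤ μ
  big : r * μ < U.card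
  pot : ∀ c, ∀ K ⊆ U, G.IsNClique r K → (cntK f c K : ℚ) = ∑ x ∈ K, p c x

def IsQ (G : SimpleGraph V) (r : ℕ) (U Q : Finset V) : Prop := Q ⊆ U ∧ G.IsNClique (r + 1) Q

def ZRes (G : SimpleGraph V) {q : ℕ} (f : Sym2 V → Fin q) (r : ℕ) (U : Finset V) (c : Fin q) : Prop :=
  ∀ Q, IsQ G r U Q → r ∣ cntK f c Q

lemma cnbr_of_miss {G : SimpleGraph V} {r μ L : ℕ} {U : Finset V}
    (hm : ∀ x ∈ U, (missS G U x).card ≤ μ) (hb : r * μ + L < U.card) : CNbr G r L U := by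
  intro X hX hXr Y hY
  by_contra hcon
  push Not at hcon
  have hsub : U ⊆ X.biUnion (missS G U) ∪ Y := by
    intro w hw
    rw [mem_union, mem_biUnion]
    by_cases hwY : w ∈ Y
    · exact Or.inr hwY
    · obtain ⟨x, hx, h⟩ := hcon w hw hwY
      exact Or.inl ⟨x, hx, mem_missS.2 ⟨hw, h⟩⟩
  have h1 := (card_le_card hsub).trans (card_union_le _ _)
  have h2 : (X.biUnion (missS G U)).card ≤ X.card * μ :=
    card_biUnion_le_card_mul _ _ _ fun x hx => hm x (hX hx)
  have h3 : X.card * μ ≤ r * μ := Nat.mul_le_mul_right _ hXr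
  omega

variable {G : SimpleGraph V} {q : ℕ} {f : Sym2 V → Fin q} {r μ : ℕ} {U : Finset V} {p : Fin q → V → ℚ}

lemma Ctx.cn (h : Ctx G f r μ U p) : CNbr G r 0 U := cnbr_of_miss h.miss (by simpa using h.big)

lemma Ctx.ext (h : Ctx G f r μ U p) {C : Finset V} (hC : C ⊆ U) (hcl : G.IsClique (C : Set V))
    (hc : C.card ≤ r + 1) : ∃ Q, C ⊆ Q ∧ IsQ G r U Q := by
  obtain ⟨Q, h1, h2, h3, _, h5, _⟩ := cn_ext h.cn ∅ ∅ (by simp) (by simp) (r + 1 - C.card) C hC hcl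
    (by simp) (by simp; omega)
  exact ⟨Q, h1, h2, h3, by omega⟩

lemma Ctx.ext1 (h : Ctx G f r μ U p) {x : V} (hx : x ∈ U) : ∃ Q, x ∈ Q ∧ IsQ G r U Q := by
  obtain ⟨Q, h1, h2⟩ := h.ext (C := {x}) (by simpa using hx) (by simp) (by simp)
  exact ⟨Q, h1 (by simp), h2⟩

lemma Ctx.ext2 (h : Ctx G f r μ U p) {x y : V} (hx : x ∈ U) (hy : y ∈ U) (hxy : G.Adj x y) :
    ∃ Q, x ∈ Q ∧ y ∈ Q ∧ IsQ G r U Q := by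
  obtain ⟨Q, h1, h2⟩ := h.ext (C := {x, y}) (by
    intro a ha; simp at ha; rcases ha with rfl | rfl <;> assumption)
    (by rw [coe_insert, coe_singleton]; exact (SimpleGraph.isClique_pair).2 fun _ => hxy)
    (card_le_two.trans (by have := h.hr; omega))
  exact ⟨Q, h1 (by simp), h1 (by simp), h2⟩

lemma IsQ.erase {Q : Finset V} (hQ : IsQ G r U Q) {x : V} (hx : x ∈ Q) :
    (Q.erase x) ⊆ U ∧ G.IsNClique r (Q.erase x) := by
  refine ⟨(erase_subset _ _).trans hQ.1, hQ.2.isClique.subset ?_, ?_⟩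
  · rw [coe_erase]; exact Set.diff_subset
  · rw [card_erase_of_mem hx, hQ.2.card_eq]; rfl

lemma Ctx.rpos (h : Ctx G f r μ U p) : (0 : ℚ) < r := by have := h.hr; exact_mod_cast (by omega : 0 < r)

/-- F1 -/
lemma Ctx.F1 (h : Ctx G f r μ U p) {Q : Finset V} (hQ : IsQ G r U Q) {x : V} (hx : x ∈ Q) (c : Fin q) :
    p c x = degK f c Q x - (cntK f c Q : ℚ) / r := by
  have hr := h.rpos
  have key : ∀ y ∈ Q, (cntK f c Q : ℚ) - degK f c Q y = ∑ z ∈ Q, p c z - p c y := by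
    intro y hy
    have e1 := h.pot c _ (hQ.erase hy).1 (hQ.erase hy).2
    have e2 := add_sum_erase Q (p c) hy
    have e3 := cntK_erase f c hy
    have e4 : (cntK f c Q : ℚ) = cntK f c (Q.erase y) + degK f c Q y := by exact_mod_cast e3
    linarith
  have s := sum_congr rfl key
  rw [sum_sub_distrib, sum_sub_distrib, sum_const, sum_const, hQ.2.card_eq] at s
  have hs : ∑ x ∈ Q, (degK f c Q x : ℚ) = 2 * cntK f c Q := by exact_mod_cast handshake f c Q
  rw [hs] at s
  simp only [nsmul_eq_mul] at s
  push_cast at s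
  have k := key x hx
  have hP : ∑ z ∈ Q, p c z = (r - 1) * cntK f c Q / r := by
    field_simp; linarith
  rw [hP] at k
  field_simp at k ⊢
  linarith

lemma Ctx.res_share (h : Ctx G f r μ U p) {Q Q' : Finset V} (hQ : IsQ G r U Q) (hQ' : IsQ G r U Q')
    {x : V} (hx : x ∈ Q) (hx' : x ∈ Q') (c : Fin q) : (cntK f c Q : ℤ) ≡ cntK f c Q' [ZMOD r] := by
  have e1 := h.F1 hQ hx c
  have e2 := h.F1 hQ' hx' c
  have hr := h.rpos
  rw [e1] at e2
  have e3 : (cntK f c Q' : ℚ) - cntK f c Q = r * (degK f c Q' x - degK f c Q x) := by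
    field_simp at e2; linarith
  rw [Int.modEq_iff_dvd]
  exact ⟨degK f c Q' x - degK f c Q x, by exact_mod_cast e3⟩

/-- F2 -/
lemma Ctx.res (h : Ctx G f r μ U p) {Q Q' : Finset V} (hQ : IsQ G r U Q) (hQ' : IsQ G r U Q')
    (c : Fin q) : (cntK f c Q : ℤ) ≡ cntK f c Q' [ZMOD r] := by
  obtain ⟨x, hx⟩ : Q.Nonempty := card_pos.1 (by rw [hQ.2.card_eq]; omega)
  obtain ⟨y, hy⟩ : Q'.Nonempty := card_pos.1 (by rw [hQ'.2.card_eq]; omega)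
  have hr := h.hr
  obtain ⟨w, hw, _, hwa⟩ := h.cn {x, y} (by
    intro a ha; simp at ha; rcases ha with rfl | rfl
    · exact hQ.1 hx
    · exact hQ'.1 hy) (card_le_two.trans (by omega)) ∅ (by simp)
  obtain ⟨Q1, a1, a2, a3⟩ := h.ext2 (hQ.1 hx) hw (hwa x (by simp))
  obtain ⟨Q2, b1, b2, b3⟩ := h.ext2 (hQ'.1 hy) hw (hwa y (by simp))
  exact (h.res_share hQ a3 hx a1 c).trans ((h.res_share a3 b3 a2 b2 c).trans (h.res_share b3 hQ' b1 hy c))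

lemma Ctx.zres_of_zero (h : Ctx G f r μ U p) {Q : Finset V} (hQ : IsQ G r U Q) {c : Fin q}
    (hc : r ∣ cntK f c Q) : ZRes G f r U c := by
  intro Q' hQ'
  have := h.res hQ hQ' c
  have h1 : (r : ℤ) ∣ cntK f c Q := by exact_mod_cast hc
  have h2 : (r : ℤ) ∣ cntK f c Q' := by
    rw [Int.modEq_iff_dvd] at this
    have := dvd_add this h1
    simpa using this
  exact_mod_cast h2

lemma Ctx.p_zero (h : Ctx G f r μ U p) {Q : Finset V} (hQ : IsQ G r U Q) {x : V} (hx : x ∈ Q) {c : Fin q}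
    (hc : cntK f c Q = 0) : p c x = 0 := by
  have := degK_le_cntK f c hx
  rw [h.F1 hQ hx c, hc, show degK f c Q x = 0 by omega]; simp

lemma Ctx.PB (h : Ctx G f r μ U p) {Z : Finset (Fin q)} (hZ : ∀ c ∈ Z, ZRes G f r U c) {y : V}
    (hy : y ∈ U) : ∑ c ∈ Z, p c y ≤ r - 1 := by
  obtain ⟨Q, hyQ, hQ⟩ := h.ext1 hy
  have hr := h.rpos
  have hr1 : (1 : ℚ) ≤ r := by have := h.hr; exact_mod_cast (by omega : 1 ≤ r)
  by_cases hz : ∀ c ∈ Z, cntK f c Q = 0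
  · rw [sum_eq_zero fun c hc => h.p_zero hQ hyQ (hz c hc)]; linarith
  push Not at hz
  obtain ⟨c, hc, hne⟩ := hz
  rw [sum_congr rfl fun c _ => h.F1 hQ hyQ c, sum_sub_distrib, ← sum_div]
  have e1 : (∑ c ∈ Z, (degK f c Q y : ℚ)) + 1 ≤ r + 1 := by
    have := sum_degK_le f Z hyQ
    rw [hQ.2.card_eq] at this
    exact_mod_cast this
  have e2 : (r : ℚ) ≤ ∑ c ∈ Z, (cntK f c Q : ℚ) := by
    have h1 : r ≤ cntK f c Q := Nat.le_of_dvd (Nat.pos_of_ne_zero hne) (hZ c hc Q hQ)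
    have h2 : cntK f c Q ≤ ∑ c ∈ Z, cntK f c Q := single_le_sum (f := fun c => cntK f c Q) (fun _ _ => Nat.zero_le _) hc
    exact_mod_cast h1.trans h2
  have e3 : 1 ≤ (∑ c ∈ Z, (cntK f c Q : ℚ)) / r := by rw [le_div_iff₀ hr]; linarith
  linarith

def Concl (q r μ : ℕ) (U : Finset V) (p : Fin q → V → ℚ) : Prop :=
  ∃ Z : Finset (Fin q), q ≤ Z.card + r.choose 2 ∧ ∑ x ∈ U, ∑ c ∈ Z, p c x ≤ ((r : ℚ) - 1) * μ

/-- generic finishing: zero off a small set -/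
lemma Ctx.finish (h : Ctx G f r μ U p) {Z : Finset (Fin q)} (hZ : ∀ c ∈ Z, ZRes G f r U c)
    (hcard : q ≤ Z.card + r.choose 2) (B : Finset V) (hBU : B ⊆ U) (hB : B.card ≤ μ)
    (h0 : ∀ x ∈ U, x ∉ B → ∀ c ∈ Z, p c x = 0) : Concl q r μ U p := by
  refine ⟨Z, hcard, ?_⟩
  rw [← sum_sdiff hBU, sum_eq_zero (s := U \ B), zero_add]
  · refine (sum_le_card_nsmul B _ ((r : ℚ) - 1) fun x hx => h.PB hZ (hBU hx)).trans ?_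
    rw [nsmul_eq_mul, mul_comm]
    have hr1 : (1 : ℚ) ≤ r := by have := h.hr; exact_mod_cast (by omega : 1 ≤ r)
    have : (B.card : ℚ) ≤ μ := by exact_mod_cast hB
    exact mul_le_mul_of_nonneg_left this (by linarith)
  · intro x hx
    rw [mem_sdiff] at hx
    exact sum_eq_zero fun c hc => h0 x hx.1 hx.2 c hc

lemma choose_two_succ (r : ℕ) : (r + 1).choose 2 = r.choose 2 + r := by
  rw [Nat.choose_succ_succ' r 1]; simp; omega

lemma Ctx.star (h : Ctx G f r μ U p) {c : Fin q} (hc : ZRes G f r U c) {x : V} (hx : x ∈ U)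
    (hpx : p c x = r - 1) : Concl q r μ U p := by
  have hr := h.rpos
  have h3 := h.hr
  have key : ∀ Q, IsQ G r U Q → x ∈ Q → degK f c Q x = r ∧ cntK f c Q = r := by
    intro Q hQ hxQ
    obtain ⟨m, hm⟩ := hc Q hQ
    have e1 := h.F1 hQ hxQ c
    rw [hpx, hm] at e1
    push_cast at e1
    rw [mul_div_cancel_left₀ _ hr.ne'] at e1
    have e2 : r + m = degK f c Q x + 1 := by
      have : (r : ℚ) + m = degK f c Q x + 1 := by linarith
      exact_mod_cast this
    have e3 := degK_lt f c hxQ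
    rw [hQ.2.card_eq] at e3
    have e4 := degK_le_cntK f c hxQ
    have hm1 : m ≤ 1 := by omega
    interval_cases m
    · omega
    · simp at hm; omega
  obtain ⟨Q0, hx0, hQ0⟩ := h.ext1 hx
  let N : Finset (Fin q) := univ.filter fun d => d ≠ c ∧ p d x ≠ 0
  -- other colours at x
  have oth : ∀ Q, IsQ G r U Q → x ∈ Q → ∀ d, d ≠ c → (p d x = 0 ↔ cntK f d Q = 0) := by
    intro Q hQ hxQ d hd
    have e0 : degK f d Q x = 0 := by
      have := sum_degK_le f {c, d} hxQ
      rw [sum_pair hd.symm, (key Q hQ hxQ).1, hQ.2.card_eq] at this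
      omega
    rw [h.F1 hQ hxQ d, e0]
    constructor
    · intro e
      have : (cntK f d Q : ℚ) / r = 0 := by simpa using e
      rw [div_eq_zero_iff] at this
      rcases this with h | h
      · exact_mod_cast h
      · exact absurd h hr.ne'
    · intro e; rw [e]; simp
  have hN : N.card ≤ r.choose 2 := by
    have e1 := sum_cntK f Q0
    rw [hQ0.2.card_eq, choose_two_succ, ← add_sum_erase univ _ (mem_univ c), (key Q0 hQ0 hx0).2] at e1
    have e2 : N.card ≤ ∑ d ∈ univ.erase c, cntK f d Q0 := by
      rw [card_eq_sum_ones]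
      refine (sum_le_sum (g := fun d => cntK f d Q0) fun d hd => ?_).trans (sum_le_sum_of_subset ?_)
      · simp only [N, mem_filter] at hd
        have := mt (oth Q0 hQ0 hx0 d hd.2.1).2 hd.2.2
        omega
      · intro d hd; simp only [N, mem_filter] at hd; simp [hd.2.1]
    omega
  have hZm : ∀ d ∈ Nᶜ, d ≠ c → p d x = 0 := by
    intro d hd hdc
    simp only [N, mem_compl, mem_filter, mem_univ, true_and, not_and, not_not] at hd
    exact hd hdc
  refine h.finish (Z := Nᶜ) ?_ ?_ (missS G U x) (filter_subset _ _) (h.miss x hx) ?_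
  · intro d hd
    by_cases hdc : d = c
    · rw [hdc]; exact hc
    · refine h.zres_of_zero hQ0 ?_
      rw [(oth Q0 hQ0 hx0 d hdc).1 (hZm d hd hdc)]; simp
  · rw [card_compl, Fintype.card_fin]; omega
  · intro y hy hym d hd
    have hadj : G.Adj x y := by
      by_contra hn; exact hym (mem_missS.2 ⟨hy, hn⟩)
    obtain ⟨Q, hxQ, hyQ, hQ⟩ := h.ext2 hx hy hadj
    by_cases hdc : d = c
    · subst hdc
      obtain ⟨k1, k2⟩ := key Q hQ hxQ
      have e0 := cntK_erase f d hxQ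
      have hyx : y ∈ Q.erase x := mem_erase.2 ⟨hadj.ne', hyQ⟩
      have e1 := degK_le_cntK f d hyx
      have e2 : phK f d x y = 1 := by
        by_contra hne
        have hz : phK f d x y = 0 := by have := phK_le f d x y; omega
        have e3 : degK f d Q x = phK f d x y + ∑ z ∈ (Q.erase x).erase y, phK f d x z :=
          (add_sum_erase _ _ hyx).symm
        have e4 := sum_le_sum (s := (Q.erase x).erase y) fun z _ => phK_le f d x z
        rw [sum_const, card_erase_of_mem hyx, card_erase_of_mem hxQ, hQ.2.card_eq, smul_eq_mul] at e4
        omega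
      have hxy : x ∈ Q.erase y := mem_erase.2 ⟨hadj.ne, hxQ⟩
      have e3 : degK f d Q y = phK f d y x + ∑ z ∈ (Q.erase y).erase x, phK f d y z :=
        (add_sum_erase _ _ hxy).symm
      rw [erase_right_comm, phK_comm, e2] at e3
      have e5 : degK f d (Q.erase x) y = ∑ z ∈ (Q.erase x).erase y, phK f d y z := rfl
      have e6 : degK f d Q y = 1 := by omega
      rw [h.F1 hQ hyQ d, e6, k2]
      field_simp; simp
    · exact h.p_zero hQ hyQ ((oth Q hQ hxQ d hdc).1 (hZm d hd hdc))

end StrC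



section StrC2
variable [DecidableEq V]
open scoped Classical
set_option linter.unusedSectionVars false

lemma cntK_mono {q : ℕ} (f : Sym2 V → Fin q) (c : Fin q) {A R : Finset V} (h : A ⊆ R) :
    cntK f c A ≤ cntK f c R :=
  card_le_card (filter_subset_filter _ (sym2_mono h))

lemma cntK_eq_zero {q : ℕ} {f : Sym2 V → Fin q} {c : Fin q} {K : Finset V}
    (h : ∀ a ∈ K, ∀ b ∈ K, a ≠ b → f s(a, b) ≠ c) : cntK f c K = 0 := by
  unfold cntK
  rw [card_eq_zero, filter_eq_empty_iff]
  intro e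
  induction e using Sym2.ind with
  | _ a b =>
    rw [mk_mem_sym2_iff, Sym2.mk_isDiag_iff]
    rintro ⟨ha, hb⟩ ⟨hne, hf⟩
    exact h a ha b hb hne hf

variable {G : SimpleGraph V} {q : ℕ} {f : Sym2 V → Fin q} {r μ : ℕ} {U : Finset V} {p : Fin q → V → ℚ}

def NoStar (G : SimpleGraph V) {q : ℕ} (f : Sym2 V → Fin q) (r : ℕ) (U : Finset V)
    (p : Fin q → V → ℚ) : Prop := ∀ c, ZRes G f r U c → ∀ x ∈ U, p c x ≠ r - 1

lemma clique_mono {A R : Finset V} (h : G.IsClique (R : Set V)) (hA : A ⊆ R) : G.IsClique (A : Set V) :=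
  h.subset (by exact_mod_cast hA)

lemma Ctx.zero_on (h : Ctx G f r μ U p) {R : Finset V} (hR : R ⊆ U) (hcl : G.IsClique (R : Set V))
    (hc : r + 1 ≤ R.card) {c : Fin q} (h0 : cntK f c R = 0) {x : V} (hx : x ∈ R) : 
    p c x = 0 ∧ ZRes G f r U c := by
  obtain ⟨Q, h1, h2, h3⟩ := exists_subsuperset_card_eq (s := {x}) (t := R) (n := r + 1)
    (by simpa using hx) (by simp) hc
  have hQ : IsQ G r U Q := ⟨h2.trans hR, clique_mono hcl h2, h3⟩
  have hz : cntK f c Q = 0 := by have := cntK_mono f c h2; omega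
  exact ⟨h.p_zero hQ (h1 (by simp)) hz, h.zres_of_zero hQ (by rw [hz]; simp)⟩

lemma Ctx.clone (h : Ctx G f r μ U p) (hns : NoStar G f r U p) {R : Finset V} (hR : R ⊆ U)
    (hcl : G.IsClique (R : Set V)) (hc : r + 1 ≤ R.card) {c : Fin q} (h0 : cntK f c R = 0) {x : V}
    (hx : x ∈ U) (hxr : r ≤ (R.filter (G.Adj x)).card) : p c x = 0 := by
  have hr := h.rpos
  have hr3 := h.hr
  by_cases hxR : x ∈ R
  · exact (h.zero_on hR hcl hc h0 hxR).1
  obtain ⟨N, hN, hNc⟩ := exists_subset_card_eq hxr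
  have hNR : N ⊆ R := hN.trans (filter_subset _ _)
  have hxN : x ∉ N := fun hh => hxR (hNR hh)
  have hQ : IsQ G r U (insert x N) := by
    refine ⟨insert_subset hx (hNR.trans hR), clique_insert (clique_mono hcl hNR) ?_, ?_⟩
    · intro b hb; exact (mem_filter.1 (hN hb)).2.symm
    · rw [card_insert_of_notMem hxN, hNc]
  have hz : cntK f c N = 0 := by have := cntK_mono f c hNR; omega
  obtain ⟨y0, hy0⟩ : N.Nonempty := card_pos.1 (by omega)
  have hZ := (h.zero_on hR hcl hc h0 (hNR hy0)).2
  obtain ⟨m, hm⟩ := hZ _ hQ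
  have key : ∀ y ∈ N, phK f c x y = m := by
    intro y hy
    have e1 := (h.zero_on hR hcl hc h0 (hNR hy)).1
    rw [h.F1 hQ (mem_insert_of_mem hy) c, hm] at e1
    push_cast at e1
    rw [mul_div_cancel_left₀ _ hr.ne', sub_eq_zero] at e1
    have e2 : degK f c (insert x N) y = m := by exact_mod_cast e1
    have hxy : x ≠ y := by rintro rfl; exact hxN hy
    have e3 : degK f c (insert x N) y = phK f c y x + degK f c N y := by
      unfold degK
      rw [erase_insert_of_ne hxy, sum_insert (fun hh => hxN (mem_of_mem_erase hh))]
    have e4 := degK_le_cntK f c hy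
    rw [phK_comm]; omega
  have hd : degK f c (insert x N) x = r * m := by
    unfold degK
    rw [erase_insert hxN, sum_congr rfl key, sum_const, hNc]; rfl
  have hp : p c x = (r - 1) * m := by
    rw [h.F1 hQ (mem_insert_self x N) c, hd, hm]; push_cast; field_simp
  have hm1 : m ≤ 1 := by rw [← key y0 hy0]; exact phK_le _ _ _ _
  interval_cases m
  · simpa using hp
  · exact absurd (by simpa using hp) (hns c hZ x hx)

def MaxC (G : SimpleGraph V) (U R : Finset V) : Prop :=
  R ⊆ U ∧ G.IsClique (R : Set V) ∧ ∀ x ∈ U, ∃ b ∈ R, ¬ G.Adj x b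

lemma exists_maxC {C : Finset V} (hC : C ⊆ U) (hcl : G.IsClique (C : Set V)) :
    ∃ R, C ⊆ R ∧ MaxC G U R := by
  obtain ⟨R, hR, hm⟩ := exists_max_image (U.powerset.filter fun R => C ⊆ R ∧ G.IsClique (R : Set V)) card
    ⟨C, by simp [hC, hcl]⟩
  simp only [mem_filter, mem_powerset] at hR hm
  refine ⟨R, hR.2.1, hR.1, hR.2.2, ?_⟩
  intro x hx
  by_contra hcon
  push Not at hcon
  have hxR : x ∉ R := fun hh => (hcon x hh).ne rfl
  have := hm (insert x R) ⟨insert_subset hx hR.1, hR.2.1.trans (subset_insert _ _),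
    clique_insert hR.2.2 fun b hb => (hcon b hb).symm⟩
  rw [card_insert_of_notMem hxR] at this
  omega

noncomputable def bdS (G : SimpleGraph V) (r : ℕ) (U R : Finset V) : Finset V :=
  U.filter fun x => (R.filter (G.Adj x)).card < r

lemma Ctx.bad_count (h : Ctx G f r μ U p) {R : Finset V} (hR : MaxC G U R) {t : ℕ} (hc : R.card = r + t) :
    U.card + t * (bdS G r U R).card ≤ (r + t) * μ := by
  have e1 : ∑ x ∈ U, (R.filter fun y => ¬ G.Adj x y).card = ∑ y ∈ R, (missS G U y).card := by
    simp_rw [card_eq_sum_ones, missS, sum_filter]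
    rw [sum_comm]
    refine sum_congr rfl fun y _ => sum_congr rfl fun x _ => ?_
    simp [G.adj_comm]
  have e2 : ∑ y ∈ R, (missS G U y).card ≤ (r + t) * μ := by
    rw [← hc]; exact sum_le_card_nsmul _ _ _ fun y hy => h.miss y (hR.1 hy)
  have e3 : ∑ x ∈ U, (1 + if x ∈ bdS G r U R then t else 0) ≤
      ∑ x ∈ U, (R.filter fun y => ¬ G.Adj x y).card := by
    refine sum_le_sum fun x hx => ?_
    have s := card_filter_add_card_filter_not (s := R) (G.Adj x)
    split_ifs with hb
    · have := (mem_filter.1 hb).2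
      omega
    · obtain ⟨b, hb, hn⟩ := hR.2.2 x hx
      exact card_pos.2 ⟨b, mem_filter.2 ⟨hb, hn⟩⟩
  rw [sum_add_distrib, ← sum_filter, sum_const, sum_const, filter_mem_eq_inter,
    inter_eq_right.2 (show bdS G r U R ⊆ U from filter_subset _ _)] at e3
  simp only [smul_eq_mul, mul_one] at e3
  rw [mul_comm t]
  omega

lemma Ctx.bad_le (h : Ctx G f r μ U p) {R : Finset V} (hR : MaxC G U R) (hc : r + 1 ≤ R.card) :
    (bdS G r U R).card ≤ μ := by
  obtain ⟨t, ht⟩ := Nat.exists_eq_add_of_le hc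
  have e := h.bad_count hR (t := t + 1) (by omega)
  have b := h.big
  by_contra hcon
  push Not at hcon
  have : (t + 1) * μ ≤ (t + 1) * (bdS G r U R).card := Nat.mul_le_mul_left _ hcon.le
  nlinarith

noncomputable def colS {q : ℕ} (f : Sym2 V → Fin q) (R : Finset V) : Finset (Fin q) :=
  univ.filter fun c => cntK f c R ≠ 0

lemma Ctx.few (h : Ctx G f r μ U p) (hns : NoStar G f r U p) {R : Finset V} (hR : MaxC G U R)
    (hc : r + 1 ≤ R.card) (hcol : (colS f R).card ≤ r.choose 2) : Concl q r μ U p := by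
  have hz : ∀ c ∈ (colS f R)ᶜ, cntK f c R = 0 := by intro c hc; simpa [colS] using hc
  obtain ⟨x, hx⟩ : R.Nonempty := card_pos.1 (by omega)
  refine h.finish (Z := (colS f R)ᶜ) (fun c hcc => (h.zero_on hR.1 hR.2.1 hc (hz c hcc) hx).2) ?_
    (bdS G r U R) (filter_subset _ _) (h.bad_le hR hc) ?_
  · rw [card_compl, Fintype.card_fin]; omega
  · intro x hx hxb c hcc
    refine h.clone hns hR.1 hR.2.1 hc (hz c hcc) hx ?_
    by_contra hlt
    exact hxb (mem_filter.2 ⟨hx, by omega⟩)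

lemma Ctx.four (h : Ctx G f r μ U p) {R : Finset V} (hR : R ⊆ U) (hcl : G.IsClique (R : Set V))
    (hc : r + 2 ≤ R.card) {u v a b : V} (hu : u ∈ R) (hv : v ∈ R) (ha : a ∈ R) (hb : b ∈ R)
    (huv : u ≠ v) (hua : u ≠ a) (hub : u ≠ b) (hva : v ≠ a) (hvb : v ≠ b) (hab : a ≠ b) :
    (f s(u, a) = f s(u, b) ∧ f s(v, a) = f s(v, b)) ∨ (f s(u, a) = f s(v, a) ∧ f s(u, b) = f s(v, b)) := by
  have hr3 := h.hr
  have e0 : r - 2 ≤ (R \ {u, v, a, b}).card := by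
    have := le_card_sdiff {u, v, a, b} R
    have : ({u, v, a, b} : Finset V).card ≤ 4 := card_le_four
    omega
  obtain ⟨A, hA, hAc⟩ := exists_subset_card_eq e0
  have hAn : ∀ x ∈ A, x ∈ R ∧ x ≠ u ∧ x ≠ v ∧ x ≠ a ∧ x ≠ b := by
    intro x hx; have := hA hx; simpa using this
  have hAR : A ⊆ R := fun x hx => (hAn x hx).1
  have nu : u ∉ A := fun hh => (hAn u hh).2.1 rfl
  have nv : v ∉ A := fun hh => (hAn v hh).2.2.1 rfl
  have na : a ∉ A := fun hh => (hAn a hh).2.2.2.1 rfl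
  have nb : b ∉ A := fun hh => (hAn b hh).2.2.2.2 rfl
  have gen : ∀ x y, x ∈ R → y ∈ R → x ∉ A → y ∉ A → x ≠ y → ∀ c,
      (cntK f c A : ℚ) + ∑ z ∈ A, (phK f c y z : ℚ) + (phK f c x y + ∑ z ∈ A, (phK f c x z : ℚ))
        = p c x + (p c y + ∑ z ∈ A, p c z) := by
    intro x y hx hy nx ny hxy c
    have n2 : x ∉ insert y A := by simp [hxy, nx]
    have hs : insert x (insert y A) ⊆ R := insert_subset hx (insert_subset hy hAR)
    have := h.pot c (insert x (insert y A)) (hs.trans hR) ⟨clique_mono hcl hs, by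
      rw [card_insert_of_notMem n2, card_insert_of_notMem ny]; omega⟩
    rw [cntK_insert f c n2, cntK_insert f c ny, sum_insert ny, sum_insert n2, sum_insert ny] at this
    push_cast at this
    exact this
  have key : ∀ c, phK f c u a + phK f c v b = phK f c u b + phK f c v a := by
    intro c
    have g1 := gen u a hu ha nu na hua c
    have g2 := gen u b hu hb nu nb hub c
    have g3 := gen v a hv ha nv na hva c
    have g4 := gen v b hv hb nv nb hvb c
    have : (phK f c u a : ℚ) + phK f c v b = phK f c u b + phK f c v a := by linarith
    exact_mod_cast this
  have k1 := key (f s(u, a))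
  have k2 := key (f s(v, b))
  have k3 := key (f s(u, b))
  simp only [phK, if_true] at k1 k2 k3
  grind

set_option maxHeartbeats 1000000 in
lemma Ctx.big_clique (h : Ctx G f r μ U p) (hns : NoStar G f r U p) {C : Finset V} (hC : C ⊆ U)
    (hcl : G.IsClique (C : Set V)) (hc : r + 2 ≤ C.card) : Concl q r μ U p := by
  obtain ⟨R, hCR, hR⟩ := exists_maxC hC hcl
  have hr3 := h.hr
  have hRc : r + 2 ≤ R.card := hc.trans (card_le_card hCR)
  refine h.few hns hR (by omega) ?_
  have h3 : 3 ≤ r.choose 2 := by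
    calc 3 = (3 : ℕ).choose 2 := by decide
      _ ≤ r.choose 2 := Nat.choose_le_choose 2 hr3
  have four := fun {u v a b : V} => @Ctx.four V _ G q f r μ U p h R hR.1 hR.2.1 hRc u v a b
  have two : ∃ c1 c2, ∀ a ∈ R, ∀ b ∈ R, a ≠ b → f s(a, b) = c1 ∨ f s(a, b) = c2 := by
    by_cases hex : ∃ u ∈ R, ∃ v ∈ R, ∃ w ∈ R, u ≠ v ∧ u ≠ w ∧ v ≠ w ∧ f s(u, v) ≠ f s(u, w)
    · obtain ⟨u, hu, v, hv, w, hw, huv, huw, hvw, hne⟩ := hex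
      refine ⟨f s(u, v), f s(u, w), ?_⟩
      have fx : ∀ x ∈ R, x ≠ u → x ≠ v → x ≠ w → f s(x, v) = f s(u, v) ∧ f s(x, w) = f s(u, w) ∧
          (f s(x, u) = f s(u, v) ∨ f s(x, u) = f s(u, w)) ∧ 
          (f s(v, w) = f s(u, v) ∨ f s(v, w) = f s(u, w)) := by
        intro x hx h1 h2 h3
        have t1 := four hu hx hv hw h1.symm huv huw h2 h3 hvw
        have t2 := four hu hv hw hx huv huw h1.symm hvw h2.symm h3.symm
        have t3 := four hu hw hv hx huw huv h1.symm hvw.symm h3.symm h2.symm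
        have s1 : f s(v, x) = f s(x, v) := by rw [Sym2.eq_swap]
        have s2 : f s(w, x) = f s(x, w) := by rw [Sym2.eq_swap]
        have s3 : f s(u, x) = f s(x, u) := by rw [Sym2.eq_swap]
        have s4 : f s(w, v) = f s(v, w) := by rw [Sym2.eq_swap]
        grind
      have main : ∀ a ∈ R, ∀ b ∈ R, a ≠ b → a ≠ u → a ≠ v → a ≠ w → 
          f s(a, b) = f s(u, v) ∨ f s(a, b) = f s(u, w) := by
        intro a ha b hb hab h1 h2 h3
        have := fx a ha h1 h2 h3
        by_cases b1 : b = u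
        · subst b1; exact this.2.2.1
        by_cases b2 : b = v
        · subst b2; exact Or.inl this.1
        by_cases b3 : b = w
        · subst b3; exact Or.inr this.2.1
        have t2 := fx b hb b1 b2 b3
        have t := four ha hv hb hu h2 hab h1 (Ne.symm b2) huv.symm b1
        have s1 : f s(v, b) = f s(b, v) := by rw [Sym2.eq_swap]
        have s2 : f s(v, u) = f s(u, v) := by rw [Sym2.eq_swap]
        grind
      obtain ⟨x, hx, hxn⟩ : ∃ x ∈ R, x ∉ ({u, v, w} : Finset V) := by
        apply exists_mem_notMem_of_card_lt_card
        have : ({u, v, w} : Finset V).card ≤ 3 := card_le_three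
        omega
      simp only [mem_insert, mem_singleton, not_or] at hxn
      have hvw' := (fx x hx hxn.1 hxn.2.1 hxn.2.2).2.2.2
      intro a ha b hb hab
      have s2 : f s(v, u) = f s(u, v) := by rw [Sym2.eq_swap]
      have s3 : f s(w, u) = f s(u, w) := by rw [Sym2.eq_swap]
      have s4 : f s(w, v) = f s(v, w) := by rw [Sym2.eq_swap]
      have m1 := main a ha b hb hab
      have m2 := main b hb a ha hab.symm
      rw [Sym2.eq_swap] at m2
      by_cases a0 : a ≠ u ∧ a ≠ v ∧ a ≠ w
      · exact m1 a0.1 a0.2.1 a0.2.2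
      by_cases b0 : b ≠ u ∧ b ≠ v ∧ b ≠ w
      · exact m2 b0.1 b0.2.1 b0.2.2
      have a0' : a = u ∨ a = v ∨ a = w := by
        by_contra hh; rw [not_or, not_or] at hh; exact a0 hh
      have b0' : b = u ∨ b = v ∨ b = w := by
        by_contra hh; rw [not_or, not_or] at hh; exact b0 hh
      clear m1 m2 main fx four
      rcases a0' with rfl | rfl | rfl <;> rcases b0' with rfl | rfl | rfl <;>
        first
        | exact absurd rfl hab
        | exact Or.inl rfl
        | exact Or.inr rfl
        | exact Or.inl s2
        | exact Or.inr s3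
        | exact hvw'
        | (rw [s4]; exact hvw')
    · push Not at hex
      obtain ⟨u, hu, v, hv, huv⟩ := one_lt_card.1 (by omega : 1 < R.card)
      refine ⟨f s(u, v), f s(u, v), fun a ha b hb hab => Or.inl ?_⟩
      have at' : ∀ b ∈ R, b ≠ u → f s(u, b) = f s(u, v) := by
        intro b hb hbu
        by_cases hbv : b = v
        · rw [hbv]
        · exact hex u hu b hb v hv hbu.symm huv hbv
      by_cases hau : a = u
      · rw [hau]; exact at' b hb (by rw [← hau]; exact hab.symm)
      by_cases hbu : b = u
      · rw [hbu, Sym2.eq_swap]; exact at' a ha hau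
      rw [hex a ha b hb u hu hab hau hbu, Sym2.eq_swap]; exact at' a ha hau
  obtain ⟨c1, c2, hcc⟩ := two
  have : colS f R ⊆ {c1, c2} := by
    intro c hc
    simp only [colS, mem_filter] at hc
    by_contra hn
    simp only [mem_insert, mem_singleton, not_or] at hn
    refine hc.2 (cntK_eq_zero fun a ha b hb hab hf => ?_)
    rcases hcc a ha b hb hab with e | e
    · exact hn.1 (hf.symm.trans e)
    · exact hn.2 (hf.symm.trans e)
  have := (card_le_card this).trans card_le_two
  omega

end StrC2



section StrC3
variable [DecidableEq V]
open scoped Classical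
set_option linter.unusedSectionVars false

variable {G : SimpleGraph V} {q : ℕ} {f : Sym2 V → Fin q} {r μ : ℕ} {U : Finset V} {p : Fin q → V → ℚ}

lemma Ctx.one_color (h : Ctx G f r μ U p) {Q : Finset V} (hQ : IsQ G r U Q)
    (hm : r.choose 2 + 1 ≤ (colS f Q).card) {c : Fin q} (hc : ZRes G f r U c) (h0 : cntK f c Q ≠ 0) :
    cntK f c Q = r ∧ (colS f Q).card = r.choose 2 + 1 ∧ ∀ d, d ≠ c → cntK f d Q ≤ 1 := by
  have h1 : r ≤ cntK f c Q := Nat.le_of_dvd (Nat.pos_of_ne_zero h0) (hc Q hQ)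
  have hs := sum_cntK f Q
  rw [hQ.2.card_eq, choose_two_succ, ← add_sum_erase univ _ (mem_univ c)] at hs
  have hcc : c ∈ colS f Q := by simp [colS, h0]
  have ce : ((colS f Q).erase c).card + 1 = (colS f Q).card := card_erase_add_one hcc
  have hsub : (colS f Q).erase c ⊆ univ.erase c := erase_subset_erase _ (subset_univ _)
  have e1 : ∑ d ∈ (colS f Q).erase c, 1 ≤ ∑ d ∈ (colS f Q).erase c, cntK f d Q := by
    refine sum_le_sum fun d hd => ?_
    have := (mem_filter.1 (mem_of_mem_erase hd)).2
    omega
  have e2 : ∑ d ∈ (colS f Q).erase c, cntK f d Q ≤ ∑ d ∈ univ.erase c, cntK f d Q :=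
    sum_le_sum_of_subset hsub
  rw [← card_eq_sum_ones] at e1
  refine ⟨by omega, by omega, fun d hd => ?_⟩
  by_contra hlt
  have hdm : d ∈ (colS f Q).erase c := mem_erase.2 ⟨hd, by simp [colS]; omega⟩
  have e3 : ∑ d ∈ (colS f Q).erase c, 1 < ∑ d ∈ (colS f Q).erase c, cntK f d Q := by
    refine sum_lt_sum (fun d hd => ?_) ⟨d, hdm, by omega⟩
    have := (mem_filter.1 (mem_of_mem_erase hd)).2
    omega
  rw [← card_eq_sum_ones] at e3
  omega

lemma exists_pos_of (hpos : ∀ c, 0 < ∑ x ∈ U, p c x) (c : Fin q) : ∃ x ∈ U, p c x ≠ 0 := by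
  by_contra hcon
  push Not at hcon
  have := hpos c
  rw [sum_eq_zero hcon] at this
  exact lt_irrefl _ this

lemma Ctx.Zexists (h : Ctx G f r μ U p) (hq : (r + 1).choose 2 + 1 ≤ q) (hpos : ∀ c, 0 < ∑ x ∈ U, p c x)
    (hm : ∀ Q, IsQ G r U Q → r.choose 2 + 1 ≤ (colS f Q).card) :
    ∃ Z : Finset (Fin q), q = Z.card + r.choose 2 ∧ (∀ c ∈ Z, ZRes G f r U c) ∧
      ∀ Q, IsQ G r U Q → ∃ c ∈ Z, cntK f c Q = r ∧ ∀ d ∈ Z, d ≠ c → cntK f d Q = 0 := by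
  have hr3 := h.hr
  obtain ⟨Q0, _, hQ0⟩ := h.ext (C := ∅) (by simp) (by simp) (by simp)
  obtain ⟨c0, hc0⟩ : ∃ c0, cntK f c0 Q0 = 0 := by
    by_contra hcon
    push Not at hcon
    have hs := sum_cntK f Q0
    have : ∑ c : Fin q, 1 ≤ ∑ c, cntK f c Q0 := sum_le_sum fun c _ => by have := hcon c; omega
    rw [hs, hQ0.2.card_eq] at this
    simp at this
    omega
  have hz0 : ZRes G f r U c0 := h.zres_of_zero hQ0 (by rw [hc0]; simp)
  obtain ⟨x, hx, hpx⟩ := exists_pos_of hpos c0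
  obtain ⟨Q1, hxQ, hQ1⟩ := h.ext1 hx
  have hne : cntK f c0 Q1 ≠ 0 := fun hh => hpx (h.p_zero hQ1 hxQ hh)
  obtain ⟨a1, a2, a3⟩ := h.one_color hQ1 (hm Q1 hQ1) hz0 hne
  have hcc : c0 ∈ colS f Q1 := by simp [colS, hne]
  have ce : ((colS f Q1).erase c0).card + 1 = (colS f Q1).card := card_erase_add_one hcc
  have hZ : ∀ c ∈ ((colS f Q1).erase c0)ᶜ, ZRes G f r U c := by
    intro c hc
    by_cases hcc : c = c0
    · rw [hcc]; exact hz0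
    refine h.zres_of_zero hQ1 ?_
    have : cntK f c Q1 = 0 := by simpa [colS, hcc] using hc
    rw [this]; simp
  refine ⟨((colS f Q1).erase c0)ᶜ, ?_, hZ, ?_⟩
  · rw [card_compl, Fintype.card_fin]
    have : (r + 1).choose 2 = r.choose 2 + r := choose_two_succ r
    omega
  · intro Q hQ
    obtain ⟨c, hcQ, hcn⟩ : ∃ c ∈ colS f Q, c ∉ (colS f Q1).erase c0 := by
      apply exists_mem_notMem_of_card_lt_card
      have := hm Q hQ
      omega
    have hcZ : c ∈ ((colS f Q1).erase c0)ᶜ := mem_compl.2 hcn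
    obtain ⟨b1, b2, b3⟩ := h.one_color hQ (hm Q hQ) (hZ c hcZ) (mem_filter.1 hcQ).2
    refine ⟨c, hcZ, b1, fun d hd hdc => ?_⟩
    have t1 := b3 d hdc
    have t2 := hZ d hd Q hQ
    by_contra h0
    have := Nat.le_of_dvd (Nat.pos_of_ne_zero h0) t2
    omega

/-- the extremal structure -/
structure ZC (G : SimpleGraph V) {q : ℕ} (f : Sym2 V → Fin q) (r : ℕ) (U : Finset V)
    (Z : Finset (Fin q)) : Prop where
  zr : ∀ c ∈ Z, ZRes G f r U c
  one : ∀ Q, IsQ G r U Q → ∃ c ∈ Z, cntK f c Q = r ∧ ∀ d ∈ Z, d ≠ c → cntK f d Q = 0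

variable {Z : Finset (Fin q)}

lemma ZC.nadj (hz : ZC G f r U Z) (h : Ctx G f r μ U p) {c d : Fin q} (hc : c ∈ Z) (hd : d ∈ Z) (hcd : c ≠ d)
    {x y : V} (hx : x ∈ U) (hy : y ∈ U) (hpx : p c x ≠ 0) (hpy : p d y ≠ 0) : ¬ G.Adj x y := by
  intro hadj
  obtain ⟨Q, hxQ, hyQ, hQ⟩ := h.ext2 hx hy hadj
  obtain ⟨e, he, _, h2⟩ := hz.one Q hQ
  have h1 : c = e := by by_contra hn; exact hpx (h.p_zero hQ hxQ (h2 c hc hn))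
  have h1' : d = e := by by_contra hn; exact hpy (h.p_zero hQ hyQ (h2 d hd hn))
  exact hcd (h1.trans h1'.symm)

/-- values on a clique Q with its unique colour c -/
lemma ZC.val (h : Ctx G f r μ U p) {Q : Finset V} (hQ : IsQ G r U Q) {c : Fin q}
    (h1 : cntK f c Q = r) {x : V} (hx : x ∈ Q) : p c x = degK f c Q x - 1 := by
  rw [h.F1 hQ hx c, h1, div_self h.rpos.ne']

lemma ZC.sumQ (h : Ctx G f r μ U p) {Q : Finset V} (hQ : IsQ G r U Q) {c : Fin q}
    (h1 : cntK f c Q = r) : ∑ x ∈ Q, p c x = r - 1 := by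
  rw [sum_congr rfl fun x hx => ZC.val h hQ h1 hx, sum_sub_distrib, sum_const, hQ.2.card_eq]
  have : ∑ x ∈ Q, (degK f c Q x : ℚ) = 2 * cntK f c Q := by exact_mod_cast handshake f c Q
  rw [this, h1]; simp; ring

lemma ZC.Pval (h : Ctx G f r μ U p) {Q : Finset V} (hQ : IsQ G r U Q) {c : Fin q} (hc : c ∈ Z)
    (h2 : ∀ d ∈ Z, d ≠ c → cntK f d Q = 0) {x : V} (hx : x ∈ Q) :
    ∑ d ∈ Z, p d x = p c x := by
  rw [sum_eq_single_of_mem c hc]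
  intro d hd hdc
  exact h.p_zero hQ hx (h2 d hd hdc)

lemma ZC.PsumQ (hz : ZC G f r U Z) (h : Ctx G f r μ U p) {Q : Finset V} (hQ : IsQ G r U Q) :
    ∑ x ∈ Q, ∑ d ∈ Z, p d x = r - 1 := by
  obtain ⟨c, hc, h1, h2⟩ := hz.one Q hQ
  rw [sum_congr rfl fun x hx => ZC.Pval h hQ hc h2 hx]
  exact ZC.sumQ h hQ h1

lemma ZC.propagate (hz : ZC G f r U Z) (h : Ctx G f r μ U p) (hns : NoStar G f r U p)
    {Q : Finset V} (hQ : IsQ G r U Q) {c : Fin q} (hc : c ∈ Z)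
    (h1 : cntK f c Q = r) {t x : V} (ht : t ∈ Q) (hpt : p c t ≠ 0) (hx : x ∈ U)
    (hadj : ∀ b ∈ Q, b ≠ t → G.Adj x b) : p c x ≠ 0 := by
  have hr := h.rpos
  have hr3 := h.hr
  by_cases hxt : x = t
  · rw [hxt]; exact hpt
  have hxQ : x ∉ Q := fun hh => (hadj x hh hxt).ne rfl
  have hxe : x ∉ Q.erase t := fun hh => hxQ (mem_of_mem_erase hh)
  have hQ' : IsQ G r U (insert x (Q.erase t)) := by
    have he := hQ.erase ht
    refine ⟨insert_subset hx he.1, clique_insert he.2.isClique ?_, ?_⟩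
    · intro b hb; exact (hadj b (mem_of_mem_erase hb) (ne_of_mem_erase hb)).symm
    · rw [card_insert_of_notMem hxe, he.2.card_eq]
  obtain ⟨m, hm⟩ := hz.zr c hc _ hQ'
  have key : ∀ b ∈ Q.erase t, phK f c x b + 1 = phK f c t b + m := by
    intro b hb
    have hbt := ne_of_mem_erase hb
    have hbQ := mem_of_mem_erase hb
    have e1 := h.F1 hQ hbQ c
    rw [h.F1 hQ' (mem_insert_of_mem hb) c, hm, h1, div_self hr.ne'] at e1
    push_cast at e1
    rw [mul_div_cancel_left₀ _ hr.ne'] at e1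
    have e2 : degK f c (insert x (Q.erase t)) b + 1 = degK f c Q b + m := by
      have : (degK f c (insert x (Q.erase t)) b : ℚ) + 1 = degK f c Q b + m := by linarith
      exact_mod_cast this
    have hxb : x ≠ b := by rintro rfl; exact hxQ hbQ
    have e3 : degK f c (insert x (Q.erase t)) b = phK f c b x + ∑ z ∈ (Q.erase t).erase b, phK f c b z := by
      unfold degK
      rw [erase_insert_of_ne hxb, sum_insert (fun hh => hxe (mem_of_mem_erase hh))]
    have e4 : degK f c Q b = phK f c b t + ∑ z ∈ (Q.erase t).erase b, phK f c b z := by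
      unfold degK
      rw [erase_right_comm, add_sum_erase _ _ (mem_erase.2 ⟨hbt.symm, ht⟩)]
    rw [phK_comm f c x b, phK_comm f c t b]
    omega
  have dx : degK f c (insert x (Q.erase t)) x = ∑ b ∈ Q.erase t, phK f c x b := by
    unfold degK; rw [erase_insert hxe]
  have dt : degK f c Q t = ∑ b ∈ Q.erase t, phK f c t b := rfl
  have ds := sum_congr rfl key
  rw [sum_add_distrib, sum_add_distrib, ← dx, ← dt, sum_const, sum_const, (hQ.erase ht).2.card_eq,
    smul_eq_mul, smul_eq_mul] at ds
  have hpx := h.F1 hQ' (mem_insert_self x _) c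
  have hpt' := ZC.val h hQ h1 ht
  rw [hm] at hpx
  push_cast at hpx
  rw [mul_div_cancel_left₀ _ hr.ne'] at hpx
  have dsq : (degK f c (insert x (Q.erase t)) x : ℚ) + r * 1 = degK f c Q t + r * m := by exact_mod_cast ds
  obtain ⟨b, hb⟩ : (Q.erase t).Nonempty := card_pos.1 (by rw [(hQ.erase ht).2.card_eq]; omega)
  have hm2 : m ≤ 2 := by
    have := key b hb
    have := phK_le f c x b
    omega
  have hm3 : m ≤ 1 := by
    by_contra hlt
    have : m = 2 := by omega
    subst this
    have e : p c x = p c t + (r - 1) := by rw [hpx, hpt']; push_cast at dsq ⊢; linarith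
    have b1 : degK f c Q t = 0 := by
      rw [dt]
      refine sum_eq_zero fun b hb => ?_
      have := key b hb
      have := phK_le f c x b
      omega
    have b2 : degK f c (insert x (Q.erase t)) x = r := by
      have := ds; rw [b1] at this; omega
    have b3 := degK_le_cntK f c (mem_insert_self x (Q.erase t))
    obtain ⟨d, hd, k1, k2⟩ := hz.one _ hQ'
    by_cases hcd : c = d
    · subst hcd; omega
    · have := k2 c hc hcd; omega
  interval_cases m
  · exfalso
    refine hns c (hz.zr c hc) t (hQ.1 ht) ?_
    have b1 : degK f c (insert x (Q.erase t)) x = 0 := by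
      have := degK_le_cntK f c (mem_insert_self x (Q.erase t)); omega
    have : degK f c Q t = r := by rw [b1] at ds; omega
    rw [hpt', this]
  · have : p c x = p c t := by rw [hpx, hpt']; push_cast at dsq ⊢; linarith
    rw [this]; exact hpt

lemma IsQ.maxC (hno : ∀ C ⊆ U, G.IsClique (C : Set V) → C.card ≤ r + 1) {Q : Finset V} (hQ : IsQ G r U Q) :
    MaxC G U Q := by
  obtain ⟨R, h1, h2⟩ := exists_maxC hQ.1 hQ.2.isClique
  have := hno R h2.1 h2.2.1
  rwa [eq_of_subset_of_card_le h1 (by rw [hQ.2.card_eq]; exact this)]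

lemma ZC.nonneg (hz : ZC G f r U Z) (h : Ctx G f r μ U p) (hns : NoStar G f r U p)
    (hno : ∀ C ⊆ U, G.IsClique (C : Set V) → C.card ≤ r + 1) (hpos : ∀ c, 0 < ∑ x ∈ U, p c x)
    (hZ2 : 2 ≤ Z.card) {y : V} (hy : y ∈ U) : 0 ≤ ∑ d ∈ Z, p d y := by
  have hr := h.rpos
  have hr3 := h.hr
  by_contra hneg
  push Not at hneg
  obtain ⟨Q, hyQ, hQ⟩ := h.ext1 hy
  obtain ⟨c, hc, h1, h2⟩ := hz.one Q hQ
  rw [ZC.Pval h hQ hc h2 hyQ] at hneg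
  let T := Q.filter fun t => p c t ≠ 0
  have hmax := hQ.maxC hno
  have hyT : y ∈ T := mem_filter.2 ⟨hyQ, hneg.ne⟩
  have hT : 3 ≤ T.card := by
    by_contra hlt
    have s := ZC.sumQ h hQ h1
    rw [← sum_filter_ne_zero, ← add_sum_erase _ _ hyT] at s
    have b : ∀ x ∈ T.erase y, p c x ≤ r - 1 := by
      intro x hx
      have hxQ : x ∈ Q := (mem_filter.1 (mem_of_mem_erase hx)).1
      rw [ZC.val h hQ h1 hxQ]
      have := degK_lt f c hxQ
      rw [hQ.2.card_eq] at this
      have : (degK f c Q x : ℚ) ≤ r := by exact_mod_cast (by omega : degK f c Q x ≤ r)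
      linarith
    have b2 := sum_le_card_nsmul _ _ _ b
    rw [card_erase_of_mem hyT, nsmul_eq_mul] at b2
    have b3 : ((T.card - 1 : ℕ) : ℚ) ≤ 1 := by exact_mod_cast (by omega : T.card - 1 ≤ 1)
    have r1 : (0 : ℚ) ≤ r - 1 := by
      have : (3 : ℚ) ≤ r := by exact_mod_cast hr3
      linarith
    nlinarith [mul_le_mul_of_nonneg_right b3 r1]
  obtain ⟨d, hd, hdc⟩ := exists_mem_ne (by omega : 1 < Z.card) c
  obtain ⟨z, hzU, hpz⟩ := exists_pos_of hpos d
  have cover : U ⊆ bdS G r U Q ∪ (Q \ T).biUnion (missS G U) ∪ missS G U z := by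
    intro x hx
    by_cases hbad : x ∈ bdS G r U Q
    · simp [hbad]
    by_cases hm : x ∈ (Q \ T).biUnion (missS G U)
    · exact mem_union_left _ (mem_union_right _ hm)
    refine mem_union_right _ (mem_missS.2 ⟨hx, ?_⟩)
    refine hz.nadj h hd hc hdc hzU hx hpz ?_
    obtain ⟨t, ht, hxt⟩ := hmax.2.2 x hx
    have htT : t ∈ T := by
      by_contra hn
      exact hm (mem_biUnion.2 ⟨t, mem_sdiff.2 ⟨ht, hn⟩, mem_missS.2 ⟨hx, fun hh => hxt hh.symm⟩⟩)
    refine hz.propagate h hns hQ hc h1 ht (mem_filter.1 htT).2 hx ?_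
    intro b hb hbt
    by_contra hxb
    refine hbad (mem_filter.2 ⟨hx, ?_⟩)
    have hsub : Q.filter (G.Adj x) ⊆ (Q.erase t).erase b := by
      intro a ha
      obtain ⟨ha, hxa⟩ := mem_filter.1 ha
      refine mem_erase.2 ⟨?_, mem_erase.2 ⟨?_, ha⟩⟩
      · rintro rfl; exact hxb hxa
      · rintro rfl; exact hxt hxa
    have := card_le_card hsub
    rw [card_erase_of_mem (mem_erase.2 ⟨hbt, hb⟩), card_erase_of_mem ht, hQ.2.card_eq] at this
    omega
  have c1 := (card_le_card cover).trans ((card_union_le _ _).trans (Nat.add_le_add_right (card_union_le _ _) _))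
  have c2 : ((Q \ T).biUnion (missS G U)).card ≤ (Q \ T).card * μ :=
    card_biUnion_le_card_mul _ _ _ fun x hx => h.miss x (hQ.1 (mem_sdiff.1 hx).1)
  have c3 : (Q \ T).card ≤ r - 2 := by
    rw [card_sdiff_of_subset (show T ⊆ Q from filter_subset _ _), hQ.2.card_eq]; omega
  have c4 := Nat.mul_le_mul_right μ c3
  have c5 := h.miss z hzU
  have c6 := h.bad_count hmax (t := 1) hQ.2.card_eq
  have c7 := h.big
  obtain ⟨s, rfl⟩ : ∃ s, r = s + 2 := ⟨r - 2, by omega⟩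
  simp only [Nat.add_sub_cancel] at c4
  nlinarith

lemma ZC.concl (hz : ZC G f r U Z) (h : Ctx G f r μ U p) (hq : q = Z.card + r.choose 2)
    (hno : ∀ C ⊆ U, G.IsClique (C : Set V) → C.card ≤ r + 1)
    (hP : ∀ y ∈ U, 0 ≤ ∑ d ∈ Z, p d y) : Concl q r μ U p := by
  refine ⟨Z, hq.le, ?_⟩
  obtain ⟨Q, _, hQ⟩ := h.ext (C := ∅) (by simp) (by simp) (by simp)
  have hmax := hQ.maxC hno
  have key : ∀ x ∈ U, ∑ d ∈ Z, p d x ≤ ∑ t ∈ Q.filter (fun t => ¬ G.Adj x t), ∑ d ∈ Z, p d t := by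
    intro x hx
    have hxn : x ∉ Q.filter (G.Adj x) := by simp
    obtain ⟨t, ht, hxt⟩ := hmax.2.2 x hx
    have hcard : (Q.filter (G.Adj x)).card ≤ r := by
      have hsub : Q.filter (G.Adj x) ⊆ Q.erase t := by
        intro a ha
        obtain ⟨ha, hxa⟩ := mem_filter.1 ha
        refine mem_erase.2 ⟨?_, ha⟩
        rintro rfl; exact hxt hxa
      have := card_le_card hsub
      rwa [card_erase_of_mem ht, hQ.2.card_eq] at this
    obtain ⟨Q', h1, h2⟩ := h.ext (C := insert x (Q.filter (G.Adj x)))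
      (insert_subset hx ((filter_subset _ _).trans hQ.1))
      (clique_insert (clique_mono hQ.2.isClique (filter_subset _ _)) fun b hb => (mem_filter.1 hb).2.symm)
      (by rw [card_insert_of_notMem hxn]; omega)
    have e1 := hz.PsumQ h h2
    have e2 := hz.PsumQ h hQ
    have e3 := sum_le_sum_of_subset_of_nonneg h1 (f := fun x => ∑ d ∈ Z, p d x)
      fun i hi _ => hP i (h2.1 hi)
    rw [sum_insert hxn] at e3
    have e4 := sum_filter_add_sum_filter_not Q (G.Adj x) (fun x => ∑ d ∈ Z, p d x)
    linarith
  refine (sum_le_sum key).trans ?_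
  have sw : ∑ x ∈ U, ∑ t ∈ Q.filter (fun t => ¬ G.Adj x t), ∑ d ∈ Z, p d t
      = ∑ t ∈ Q, (missS G U t).card * ∑ d ∈ Z, p d t := by
    simp_rw [sum_filter]
    rw [sum_comm]
    refine sum_congr rfl fun t _ => ?_
    rw [← sum_filter, sum_const, nsmul_eq_mul]
    congr 3
    ext x; simp [missS, G.adj_comm]
  rw [sw]
  have : ∑ t ∈ Q, ((missS G U t).card : ℚ) * ∑ d ∈ Z, p d t ≤ ∑ t ∈ Q, (μ : ℚ) * ∑ d ∈ Z, p d t := by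
    refine sum_le_sum fun t ht => mul_le_mul_of_nonneg_right ?_ (hP t (hQ.1 ht))
    exact_mod_cast h.miss t (hQ.1 ht)
  rw [← mul_sum, hz.PsumQ h hQ] at this
  linarith

theorem Ctx.structure (h : Ctx G f r μ U p) (hq : (r + 1).choose 2 + 1 ≤ q)
    (hpos : ∀ c, 0 < ∑ x ∈ U, p c x) : Concl q r μ U p := by
  by_contra hcon
  have hns : NoStar G f r U p := fun c hc x hx hp => hcon (h.star hc hx hp)
  have hno : ∀ C ⊆ U, G.IsClique (C : Set V) → C.card ≤ r + 1 := by
    intro C hC hcl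
    by_contra hlt
    exact hcon (h.big_clique hns hC hcl (by omega))
  have hm : ∀ Q, IsQ G r U Q → r.choose 2 + 1 ≤ (colS f Q).card := by
    intro Q hQ
    by_contra hlt
    exact hcon (h.few hns (hQ.maxC hno) (by rw [hQ.2.card_eq]) (by omega))
  obtain ⟨Z, h1, h2, h3⟩ := h.Zexists hq hpos hm
  have hz : ZC G f r U Z := ⟨h2, h3⟩
  have hr3 := h.hr
  have e : (r + 1).choose 2 = r.choose 2 + r := choose_two_succ r
  exact hcon (hz.concl h h1 hno fun y hy => hz.nonneg h hns hno hpos (by omega) hy)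

end StrC3



section AsmD
variable [DecidableEq V]
open scoped Classical
set_option linter.unusedSectionVars false

variable {G : SimpleGraph V} {q : ℕ} {f : Sym2 V → Fin q} {r μ : ℕ} {U : Finset V}

lemma colorCount_eq (f : Sym2 V → Fin q) (T : Finset (Finset V)) (c : Fin q) :
    tilingColorCount f T c = ∑ K ∈ T, cntK f c K := rfl

lemma core {TU : Finset (Finset V)} (hT : IsKrTilingOn G r TU U) (hr : 3 ≤ r)
    (hq : (r + 1).choose 2 + 1 ≤ q) (hm : ∀ x ∈ U, (missS G U x).card ≤ μ)
    (hb : r * μ + 3 * r < U.card) (hng : NoGad G r f U) (hpos : ∀ c, 0 < tilingColorCount f TU c) :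
    ∃ Z : Finset (Fin q), q ≤ Z.card + r.choose 2 ∧ ∑ c ∈ Z, tilingColorCount f TU c + μ ≤ r * μ := by
  have hp := fun c => potential (by omega) hng (cnbr_of_miss hm hb) c
  choose p hp using hp
  have hs : ∀ c, ∑ x ∈ U, p c x = (tilingColorCount f TU c : ℚ) := by
    intro c
    have hU := hT.2.2
    rw [← hU, sum_biUnion (t := id) (fun K hK K' hK' hne => hT.2.1 K hK K' hK' hne), colorCount_eq]
    push_cast
    refine sum_congr rfl fun K hK => (hp c K ?_ (hT.1 K hK)).symm
    rw [← hU]; exact subset_biUnion_of_mem id hK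
  have h : Ctx G f r μ U p := ⟨hr, hm, by omega, hp⟩
  obtain ⟨Z, h1, h2⟩ := h.structure hq (fun c => by rw [hs c]; exact_mod_cast hpos c)
  refine ⟨Z, h1, ?_⟩
  rw [sum_comm, sum_congr rfl fun c _ => hs c] at h2
  have : (∑ c ∈ Z, (tilingColorCount f TU c : ℚ)) + μ ≤ r * μ := by linarith
  exact_mod_cast this

lemma tiling_union {T1 T2 : Finset (Finset V)} {S1 S2 : Finset V} (hr : 1 ≤ r)
    (h1 : IsKrTilingOn G r T1 S1) (h2 : IsKrTilingOn G r T2 S2) (hd : Disjoint S1 S2) :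
    IsKrTilingOn G r (T1 ∪ T2) (S1 ∪ S2) ∧
      ∀ (f : Sym2 V → Fin q) c, tilingColorCount f (T1 ∪ T2) c = tilingColorCount f T1 c + tilingColorCount f T2 c := by
  have s1 : ∀ K ∈ T1, K ⊆ S1 := fun K hK => by rw [← h1.2.2]; exact subset_biUnion_of_mem id hK
  have s2 : ∀ K ∈ T2, K ⊆ S2 := fun K hK => by rw [← h2.2.2]; exact subset_biUnion_of_mem id hK
  have dd : ∀ K ∈ T1, ∀ K' ∈ T2, Disjoint K K' := fun K hK K' hK' =>
    disjoint_of_subset_left (s1 K hK) (disjoint_of_subset_right (s2 K' hK') hd)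
  refine ⟨⟨?_, ?_, ?_⟩, ?_⟩
  · intro K hK
    rcases mem_union.1 hK with h | h
    · exact h1.1 K h
    · exact h2.1 K h
  · intro K hK K' hK' hne
    rcases mem_union.1 hK with h | h <;> rcases mem_union.1 hK' with h' | h'
    · exact h1.2.1 K h K' h' hne
    · exact dd K h K' h'
    · exact (dd K' h' K h).symm
    · exact h2.2.1 K h K' h' hne
  · rw [union_biUnion, h1.2.2, h2.2.2]
  · intro f c
    unfold tilingColorCount
    rw [sum_union]
    rw [disjoint_left]
    intro K hK hK'
    have := dd K hK K hK'
    rw [disjoint_self] at this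
    have hc := (h1.1 K hK).card_eq
    rw [this] at hc
    simp at hc
    omega

lemma family_tiling (hr : 1 ≤ r) (τ : Finset V → Finset (Finset V)) (F : Finset (Finset V)) :
    (∀ S ∈ F, IsKrTilingOn G r (τ S) S) → (∀ S ∈ F, ∀ S' ∈ F, S ≠ S' → Disjoint S S') →
    ∃ T, IsKrTilingOn G r T (F.biUnion id) ∧
      ∀ (f : Sym2 V → Fin q) c, tilingColorCount f T c = ∑ S ∈ F, tilingColorCount f (τ S) c := by
  induction F using Finset.induction_on with
  | empty =>
    intro _ _
    exact ⟨∅, ⟨by simp, by simp, by simp⟩, by simp [tilingColorCount]⟩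
  | insert S F hS ih =>
    intro h1 h2
    obtain ⟨T, hT, hc⟩ := ih (fun S' hS' => h1 S' (mem_insert_of_mem hS'))
      (fun S' hS' S'' hS'' => h2 S' (mem_insert_of_mem hS') S'' (mem_insert_of_mem hS''))
    have hd : Disjoint S (F.biUnion id) := by
      rw [disjoint_biUnion_right]
      intro S' hS'
      exact h2 S (mem_insert_self _ _) S' (mem_insert_of_mem hS') (by rintro rfl; exact hS hS')
    obtain ⟨a, b⟩ := tiling_union (q := q) hr (h1 S (mem_insert_self _ _)) hT hd
    refine ⟨τ S ∪ T, ?_, ?_⟩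
    · rw [biUnion_insert]; exact a
    · intro f c; rw [b f c, hc f c, sum_insert hS]

lemma edgeK (K : Finset V) : (K.sym2.filter fun e => ¬ e.IsDiag).card = K.card.choose 2 := by
  rw [← sum_cntK (q := 1) (fun _ => 0) K]
  simp [cntK]

lemma edgeCount_eq {T : Finset (Finset V)} {S : Finset V} (h : IsKrTilingOn G r T S) :
    tilingEdgeCount T = T.card * r.choose 2 := by
  unfold tilingEdgeCount
  exact sum_const_nat fun K hK => by
    rw [edgeK, (h.1 K hK).card_eq]

lemma sum_colorCount (f : Sym2 V → Fin q) (T : Finset (Finset V)) :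
    ∑ c, tilingColorCount f T c = tilingEdgeCount T := by
  simp_rw [colorCount_eq]
  rw [sum_comm]
  unfold tilingEdgeCount
  exact sum_congr rfl fun K _ => by rw [sum_cntK, edgeK]

def Gad (G : SimpleGraph V) (r : ℕ) {q : ℕ} (f : Sym2 V → Fin q) (S : Finset V) (c : Fin q)
    (T1 T2 : Finset (Finset V)) : Prop :=
  S.Nonempty ∧ S.card ≤ 3 * r ∧ IsKrTilingOn G r T1 S ∧ IsKrTilingOn G r T2 S ∧
    tilingColorCount f T2 c < tilingColorCount f T1 c

lemma noGad_of (hr : 1 ≤ r) (h : ∀ S ⊆ U, ¬ ∃ c T1 T2, Gad G r f S c T1 T2) : NoGad G r f U := by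
  intro S hS hSc T1 T2 h1 h2 c
  by_contra hne
  refine h S hS ?_
  have hSn : S.Nonempty := by
    rw [nonempty_iff_ne_empty]
    rintro rfl
    have e : ∀ T, IsKrTilingOn G r T ∅ → T = ∅ := by
      intro T hT
      have := tiling_card hT
      simp at this
      rcases this with h | h
      · exact h
      · omega
    rw [e T1 h1, e T2 h2] at hne
    exact hne rfl
  rcases lt_or_gt_of_ne hne with hlt | hlt
  · exact ⟨c, T2, T1, hSn, hSc, h2, h1, hlt⟩
  · exact ⟨c, T1, T2, hSn, hSc, h1, h2, hlt⟩

/-- dichotomy on gadget families -/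
lemma gad_family [Fintype V] (hr : 1 ≤ r) (M : ℕ) : ∃ F : Finset (Finset V),
    F.card ≤ M ∧ (∀ S ∈ F, ∃ c T1 T2, Gad G r f S c T1 T2) ∧
    (∀ S ∈ F, ∀ S' ∈ F, S ≠ S' → Disjoint S S') ∧
    (F.card = M ∨ NoGad G r f (univ \ F.biUnion id)) := by
  obtain ⟨F, hF, hmax⟩ := exists_max_image ((univ : Finset (Finset (Finset V))).filter fun F =>
    F.card ≤ M ∧ (∀ S ∈ F, ∃ c T1 T2, Gad G r f S c T1 T2) ∧
    (∀ S ∈ F, ∀ S' ∈ F, S ≠ S' → Disjoint S S')) card ⟨∅, by simp⟩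
  simp only [mem_filter, mem_univ, true_and] at hF hmax
  refine ⟨F, hF.1, hF.2.1, hF.2.2, ?_⟩
  by_cases hM : F.card = M
  · exact Or.inl hM
  right
  refine noGad_of hr fun S hS hg => ?_
  have hd : ∀ S' ∈ F, Disjoint S S' := by
    intro S' hS'
    refine disjoint_of_subset_left hS (disjoint_of_subset_right ?_ sdiff_disjoint)
    exact subset_biUnion_of_mem id hS'
  have hSF : S ∉ F := by
    intro hh
    have := hd S hh
    rw [disjoint_self] at this
    obtain ⟨c, T1, T2, hg⟩ := hg
    exact hg.1.ne_empty this
  have := hmax (insert S F) ⟨by rw [card_insert_of_notMem hSF]; have := hF.1; omega, ?_, ?_⟩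
  · rw [card_insert_of_notMem hSF] at this; omega
  · intro S' hS'
    rcases mem_insert.1 hS' with rfl | h
    · exact hg
    · exact hF.2.1 S' h
  · intro S1 h1 S2 h2 hne
    rcases mem_insert.1 h1 with e1 | k1 <;> rcases mem_insert.1 h2 with e2 | k2
    · exact absurd (e1.trans e2.symm) hne
    · rw [e1]; exact hd S2 k2
    · rw [e2]; exact (hd S1 k1).symm
    · exact hF.2.2 S1 k1 S2 k2 hne

/-- combinatorial summary: either two tilings far apart in one colour, or an almost-perfect structured piece -/
lemma summary [Fintype V] (hr : 3 ≤ r) (hq : (r + 1).choose 2 + 1 ≤ q) (m : ℕ) (hdvd : r ∣ Fintype.card V)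
    (hm : ∀ x, ((univ : Finset V).filter fun y => ¬ G.Adj x y).card ≤ μ)
    (hb : r * μ + 3 * r + 3 * r * (q * m) < Fintype.card V) :
    (∃ T T' c, IsKrTiling G r T ∧ IsKrTiling G r T' ∧ tilingColorCount f T c + m ≤ tilingColorCount f T' c) ∨
    (∃ T, IsKrTiling G r T ∧ ∃ w : Fin q → ℕ, (∀ c, w c ≤ tilingColorCount f T c) ∧
      (∀ c, tilingColorCount f T c ≤ w c + r * (3 * r * (q * m))) ∧
      ((∀ c, 0 < w c) → ∃ Z : Finset (Fin q), q ≤ Z.card + r.choose 2 ∧ ∑ c ∈ Z, w c + μ ≤ r * μ)) := by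
  obtain ⟨F, h1, h2, h3, h4⟩ := gad_family (G := G) (f := f) (by omega : 1 ≤ r) (q * m)
  have h2' : ∀ S, ∃ c T1 T2, S ∈ F → Gad G r f S c T1 T2 := by
    intro S
    by_cases hS : S ∈ F
    · obtain ⟨c, T1, T2, h⟩ := h2 S hS; exact ⟨c, T1, T2, fun _ => h⟩
    · exact ⟨⟨0, by omega⟩, ∅, ∅, fun h => absurd h hS⟩
  choose col T1 T2 hg using h2'
  have hWc : (F.biUnion id).card ≤ 3 * r * (q * m) := by
    calc (F.biUnion id).card ≤ F.card * (3 * r) := card_biUnion_le_card_mul _ _ _ fun S hS => (hg S hS).2.1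
      _ ≤ (q * m) * (3 * r) := Nat.mul_le_mul_right _ h1
      _ = _ := by ring
  obtain ⟨TW, hTW, hTWc⟩ := family_tiling (q := q) (G := G) (by omega : 1 ≤ r) T1 F (fun S hS => (hg S hS).2.2.1) h3
  have hUc : (univ \ F.biUnion id).card + (F.biUnion id).card = Fintype.card V := by
    rw [card_sdiff_add_card_eq_card (subset_univ _), card_univ]
  have hmU : ∀ x ∈ univ \ F.biUnion id, (missS G (univ \ F.biUnion id) x).card ≤ μ := fun x _ =>
    (card_le_card (filter_subset_filter _ (subset_univ _))).trans (hm x)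
  obtain ⟨TU, hTU⟩ := hs_tiling G r μ (by omega) (univ \ F.biUnion id) (by
    rw [← Nat.dvd_add_left (show r ∣ (F.biUnion id).card from ⟨TW.card, by rw [tiling_card hTW]; ring⟩), hUc]
    exact hdvd) hmU (by omega)
  have full : ∀ T, IsKrTilingOn G r T (F.biUnion id) → IsKrTiling G r (TU ∪ T) ∧
      ∀ c, tilingColorCount f (TU ∪ T) c = tilingColorCount f TU c + tilingColorCount f T c := by
    intro T hT
    obtain ⟨a, b⟩ := tiling_union (q := q) (by omega) hTU hT sdiff_disjoint
    refine ⟨?_, b f⟩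
    rw [sdiff_union_of_subset (subset_univ _)] at a
    exact a
  rcases h4 with h4 | h4
  · left
    obtain ⟨c, _, hc⟩ := exists_le_card_fiber_of_mul_le_card_of_maps_to (s := F) (t := univ) (f := col) (n := m)
      (fun _ _ => mem_univ _) ⟨⟨0, by omega⟩, mem_univ _⟩ (by rw [card_univ, Fintype.card_fin]; exact h4.ge)
    obtain ⟨T', hT', hTc'⟩ := family_tiling (q := q) (G := G) (by omega : 1 ≤ r)
      (fun S => if col S = c then T2 S else T1 S) F (fun S hS => by
        split_ifs
        · exact (hg S hS).2.2.2.1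
        · exact (hg S hS).2.2.1) h3
    refine ⟨TU ∪ T', TU ∪ TW, c, (full T' hT').1, (full TW hTW).1, ?_⟩
    rw [(full T' hT').2, (full TW hTW).2, hTc', hTWc, add_assoc]
    refine Nat.add_le_add_left ?_ _
    calc _ ≤ ∑ S ∈ F, tilingColorCount f (if col S = c then T2 S else T1 S) c + ∑ S ∈ F, (if col S = c then 1 else 0) := by
          rw [← card_filter]; exact Nat.add_le_add_left hc _
      _ = ∑ S ∈ F, (tilingColorCount f (if col S = c then T2 S else T1 S) c + (if col S = c then 1 else 0)) := by
          rw [sum_add_distrib]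
      _ ≤ _ := by
          refine sum_le_sum fun S hS => ?_
          split_ifs with e
          · have := (hg S hS).2.2.2.2
            rw [e] at this
            omega
          · omega
  · right
    obtain ⟨a, b⟩ := full TW hTW
    refine ⟨TU ∪ TW, a, fun c => tilingColorCount f TU c, fun c => by rw [b]; exact Nat.le_add_right _ _, fun c => ?_, fun hpos => ?_⟩
    · rw [b]
      refine Nat.add_le_add_left ?_ _
      have e1 : tilingColorCount f TW c ≤ tilingEdgeCount TW := by
        rw [← sum_colorCount f TW]
        exact single_le_sum (f := fun c => tilingColorCount f TW c) (fun _ _ => Nat.zero_le _) (mem_univ c)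
      rw [edgeCount_eq hTW] at e1
      have e2 := tiling_card hTW
      have e3 : r.choose 2 ≤ r * r := by
        rw [Nat.choose_two_right]
        exact (Nat.div_le_self _ _).trans (Nat.mul_le_mul_left _ (by omega))
      calc _ ≤ _ := e1
        _ ≤ TW.card * (r * r) := Nat.mul_le_mul_left _ e3
        _ = r * (F.biUnion id).card := by rw [e2]; ring
        _ ≤ _ := Nat.mul_le_mul_left _ hWc
    · exact core hTU hr hq hmU (by omega) h4 hpos

end AsmD


lemma num_qK (r q : ℝ) (hr : 3 ≤ r) (hq : 1 ≤ q) : q ≤ r ^ 2 * q ^ 2 := by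
  have h1 : q ≤ q ^ 2 := by nlinarith
  have h2 : 1 ≤ r ^ 2 := by nlinarith
  have h3 : 1 * q ^ 2 ≤ r ^ 2 * q ^ 2 := mul_le_mul_of_nonneg_right h2 (by positivity)
  linarith

lemma num_D (r q n s ε K B A : ℝ) (hr : 3 ≤ r) (hq : 1 ≤ q) (hK : K = r ^ 2 * q ^ 2)
    (hs : 10 ≤ s) (hn : 1 ≤ n) (hεn : ε * n = 100 * (K * s)) (hε1 : ε * n ≤ n)
    (hB : B ≤ 3 * r ^ 2 * q * (s + 1)) (hA : q * A = n * (r - 1) / 2 + s) : 0 < A - s - B := by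
  have hK1 : 1 ≤ K := by rw [hK]; exact hq.trans (num_qK r q hr hq)
  have h1 : q * B ≤ q * (3 * r ^ 2 * q * (s + 1)) := mul_le_mul_of_nonneg_left hB (by linarith)
  have h2 : q * (3 * r ^ 2 * q * (s + 1)) = 3 * (K * s) + 3 * K := by rw [hK]; ring
  have h3 : q ≤ K := by rw [hK]; exact num_qK r q hr hq
  have h4 : q * s ≤ K * s := mul_le_mul_of_nonneg_right h3 (by linarith)
  have h5 : n ≤ n * (r - 1) / 2 := by nlinarith
  have h7 : K * 10 ≤ K * s := mul_le_mul_of_nonneg_left hs (by linarith)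
  have h6 : 0 < q * (A - s - B) := by
    have : q * (A - s - B) = q * A - q * s - q * B := by ring
    rw [this, hA]
    linarith
  exact pos_of_mul_pos_right h6 (by linarith)

/-- purely numerical contradiction -/
lemma num_final (r q n μ s ε K B A C z S : ℝ) (hr : 3 ≤ r) (hq : 1 ≤ q) (hK : K = r ^ 2 * q ^ 2)
    (hs : 10 ≤ s) (hεn : ε * n = 100 * (K * s)) 
    (hB : B ≤ 3 * r ^ 2 * q * (s + 1)) (hμ : r * μ ≤ n - r * (ε * n))
    (hA : q * A = n * (r - 1) / 2 + s) (hD : 0 < A - s - B) (hz : q ≤ z + C) (hC : 2 * q ≤ r * (q - C))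
    (hS1 : z * (A - s - B) ≤ S) (hS2 : S + μ ≤ r * μ) : False := by
  have hKs : 0 < K * s := by rw [hK]; positivity
  have hqB : q * B ≤ 3.3 * (K * s) := by
    have h1 : q * B ≤ q * (3 * r ^ 2 * q * (s + 1)) := mul_le_mul_of_nonneg_left hB (by linarith)
    have h2 : q * (3 * r ^ 2 * q * (s + 1)) = 3 * K * (s + 1) := by rw [hK]; ring
    have h3 : 0 < K := by rw [hK]; positivity
    nlinarith
  have hqs : q * s ≤ K * s := by
    refine mul_le_mul_of_nonneg_right ?_ (by linarith)
    rw [hK]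
    exact num_qK r q hr hq
  have h1 : (q - C) * (A - s - B) ≤ (r - 1) * μ := by
    have : (q - C) * (A - s - B) ≤ z * (A - s - B) := mul_le_mul_of_nonneg_right (by linarith) hD.le
    linarith
  have h2 : 2 * q * (A - s - B) ≤ r * (q - C) * (A - s - B) := mul_le_mul_of_nonneg_right hC hD.le
  have h3 : r * ((q - C) * (A - s - B)) ≤ r * ((r - 1) * μ) := mul_le_mul_of_nonneg_left h1 (by linarith)
  have h4 : (r - 1) * (r * μ) ≤ (r - 1) * (n - r * (ε * n)) := mul_le_mul_of_nonneg_left hμ (by linarith)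
  have h5 : 2 * (n * (r - 1) / 2 + s) - 2 * (q * s) - 2 * (q * B) ≤ (r - 1) * (n - r * (ε * n)) := by
    calc _ = 2 * q * (A - s - B) := by rw [← hA]; ring
      _ ≤ r * (q - C) * (A - s - B) := h2
      _ = r * ((q - C) * (A - s - B)) := by ring
      _ ≤ _ := h3
      _ = (r - 1) * (r * μ) := by ring
      _ ≤ _ := h4
  rw [hεn] at h5
  have h6 : 6 * (100 * (K * s)) ≤ (r - 1) * r * (100 * (K * s)) :=
    mul_le_mul_of_nonneg_right (by nlinarith) (by linarith)
  nlinarith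

lemma arith_rq (r q : ℕ) (hrq : (4 ≤ r ∧ (r + 1) * r / 2 + 2 ≤ q) ∨ (r = 3 ∧ 9 ≤ q)) :
    3 ≤ r ∧ (r + 1).choose 2 + 1 ≤ q ∧ 2 * (q : ℝ) ≤ r * (q - (r.choose 2 : ℕ)) := by
  have e : (r + 1) * r / 2 = (r + 1).choose 2 := by rw [Nat.choose_two_right]; simp
  rw [e] at hrq
  rcases hrq with ⟨h1, h2⟩ | ⟨rfl, h2⟩
  · refine ⟨by omega, by omega, ?_⟩
    have h3 : (((r + 1).choose 2 + 2 : ℕ) : ℝ) ≤ q := by exact_mod_cast h2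
    push_cast at h3
    rw [Nat.cast_choose_two] at h3 ⊢
    push_cast at h3
    have h4 : (4 : ℝ) ≤ r := by exact_mod_cast h1
    nlinarith
  · have : (3 + 1 : ℕ).choose 2 = 6 := by decide
    have h3 : (3 : ℕ).choose 2 = 3 := by decide
    refine ⟨le_rfl, by omega, ?_⟩
    have h2' : (9 : ℝ) ≤ q := by exact_mod_cast h2
    rw [h3]; push_cast; linarith

theorem delta_rq_le_existence_threshold (r q : ℕ)
    (hrq : (4 ≤ r ∧ (r + 1) * r / 2 + 2 ≤ q) ∨ (r = 3 ∧ 9 ≤ q))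
    (ε : ℝ) (hε : 0 < ε) :
    ∃ ζ : ℝ, 0 < ζ ∧ ∃ n₀ : ℕ, ∀ n : ℕ, n₀ ≤ n → r ∣ n →
      ∀ (G : SimpleGraph (Fin n)) [DecidableRel G.Adj],
        (((r : ℝ) - 1) / r + ε) * n ≤ G.minDegree →
        ∀ f : Sym2 (Fin n) → Fin q,
          ∃ T : Finset (Finset (Fin n)), IsKrTiling G r T ∧
            ∃ c : Fin q,
              ((tilingEdgeCount T : ℝ) + ζ * n) / q ≤ (tilingColorCount f T c : ℝ) := by
  obtain ⟨hr, hq, hC⟩ := arith_rq r q hrq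
  have hrR : (3 : ℝ) ≤ r := by exact_mod_cast hr
  have hqN : 1 ≤ q := by omega
  have hqR : (1 : ℝ) ≤ q := by exact_mod_cast hqN
  obtain ⟨K, hK⟩ : ∃ K : ℝ, K = (r : ℝ) ^ 2 * (q : ℝ) ^ 2 := ⟨_, rfl⟩
  have hK0 : 0 < K := by rw [hK]; positivity
  refine ⟨ε / (100 * K), by positivity, ⌈1000 * K / ε⌉₊ + 1, ?_⟩
  intro n hn hdvd G _ hdeg f
  have hn1 : 1 ≤ n := by omega
  have hnR : (1 : ℝ) ≤ n := by exact_mod_cast hn1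
  have hnK : 1000 * K ≤ ε * n := by
    have h1 : (1000 * K / ε) ≤ ((⌈1000 * K / ε⌉₊ : ℕ) : ℝ) := Nat.le_ceil _
    have h2 : ((⌈1000 * K / ε⌉₊ : ℕ) : ℝ) ≤ n := by exact_mod_cast (by omega : ⌈1000 * K / ε⌉₊ ≤ n)
    have := h1.trans h2
    rw [div_le_iff₀ hε] at this
    linarith
  obtain ⟨s, hs⟩ : ∃ s : ℝ, s = ε / (100 * K) * n := ⟨_, rfl⟩
  have hεn : ε * n = 100 * (K * s) := by rw [hs]; field_simp
  have hs10 : 10 ≤ s := by nlinarith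
  rw [← hs]
  by_contra hcon
  push Not at hcon
  -- degrees
  have : Nonempty (Fin n) := ⟨⟨0, by omega⟩⟩
  have hdl : G.minDegree < n := by
    have := G.minDegree_lt_card
    simpa using this
  have hε1 : ε * n ≤ n := by
    have h1 : (G.minDegree : ℝ) < n := by exact_mod_cast hdl
    have h2 : 0 ≤ ((r : ℝ) - 1) / r * n := by
      have : 0 ≤ (r : ℝ) - 1 := by linarith
      positivity
    nlinarith
  have hmiss : ∀ x, ((univ : Finset (Fin n)).filter fun y => ¬ G.Adj x y).card ≤ n - G.minDegree := by
    intro x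
    have h1 := card_filter_add_card_filter_not (s := (univ : Finset (Fin n))) (G.Adj x)
    have h2 : ((univ : Finset (Fin n)).filter (G.Adj x)).card = G.degree x := by
      rw [← G.card_neighborFinset_eq_degree, G.neighborFinset_eq_filter]
    have h3 := G.minDegree_le_degree x
    rw [h2, card_univ, Fintype.card_fin] at h1
    omega
  obtain ⟨μ, hμ⟩ : ∃ μ, μ = n - G.minDegree := ⟨_, rfl⟩
  rw [← hμ] at hmiss
  have hμR : (μ : ℝ) = n - G.minDegree := by rw [hμ, Nat.cast_sub hdl.le]
  have hrμ : (r : ℝ) * μ ≤ n - r * (ε * n) := by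
    have h1 : (r : ℝ) * ((((r : ℝ) - 1) / r + ε) * n) ≤ r * G.minDegree :=
      mul_le_mul_of_nonneg_left hdeg (by linarith)
    have h2 : (r : ℝ) * ((((r : ℝ) - 1) / r + ε) * n) = (r - 1) * n + r * (ε * n) := by
      field_simp
    rw [hμR]
    linarith
  obtain ⟨m, hm⟩ : ∃ m, m = ⌈s⌉₊ := ⟨_, rfl⟩
  have hm1 : s ≤ m := by rw [hm]; exact Nat.le_ceil _
  have hm2 : (m : ℝ) ≤ s + 1 := by rw [hm]; exact (Nat.ceil_lt_add_one (by linarith)).le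
  have hb : r * μ + 3 * r + 3 * r * (q * m) < Fintype.card (Fin n) := by
    rw [Fintype.card_fin]
    have : (r : ℝ) * μ + 3 * r + 3 * r * (q * m) < n := by
      rw [hεn] at hrμ
      have h1 : (q : ℝ) * m ≤ q * (s + 1) := mul_le_mul_of_nonneg_left hm2 (by linarith)
      have h2 : 3 * (r : ℝ) * (q * m) ≤ 3 * r * (q * (s + 1)) := mul_le_mul_of_nonneg_left h1 (by linarith)
      have h3 : (q : ℝ) ≤ K := by
        rw [hK]; exact num_qK r q hrR hqR
      have h4 : (q : ℝ) * (s + 1) ≤ K * (s + 1) := mul_le_mul_of_nonneg_right h3 (by linarith)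
      have h5 : 1 ≤ K := by linarith
      have h6 : 3 + 3 * (q * (s + 1)) < 100 * (K * s) := by nlinarith
      have h7 : r * (3 + 3 * (q * (s + 1))) < r * (100 * (K * s)) :=
        mul_lt_mul_of_pos_left h6 (by linarith)
      linarith
    exact_mod_cast this
  -- windows
  obtain ⟨A, hA⟩ : ∃ A : ℝ, A = ((n : ℝ) * (r - 1) / 2 + s) / q := ⟨_, rfl⟩
  have hqA : q * A = (n : ℝ) * (r - 1) / 2 + s := by rw [hA]; field_simp
  have hE : ∀ T, IsKrTiling G r T → (tilingEdgeCount T : ℝ) = (n : ℝ) * (r - 1) / 2 := by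
    intro T hT
    rw [edgeCount_eq hT]
    have := tiling_card hT
    rw [card_univ, Fintype.card_fin] at this
    have h2 : (n : ℝ) = T.card * r := by exact_mod_cast this
    have h3 := Nat.cast_choose_two ℝ r
    rw [Nat.cast_mul, h3]
    linear_combination (-((r : ℝ) - 1) / 2) * h2
  have hup : ∀ T, IsKrTiling G r T → ∀ c, (tilingColorCount f T c : ℝ) < A := by
    intro T hT c
    have := hcon T hT c
    rwa [hE T hT, ← hA] at this
  have hlow : ∀ T, IsKrTiling G r T → ∀ c, A - s ≤ (tilingColorCount f T c : ℝ) := by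
    intro T hT c
    have h1 : ∑ d, (tilingColorCount f T d : ℝ) = (n : ℝ) * (r - 1) / 2 := by
      rw [← hE T hT, ← sum_colorCount f T]; push_cast; rfl
    rw [← add_sum_erase univ _ (mem_univ c)] at h1
    have h2 := sum_le_card_nsmul (univ.erase c) (fun d => (tilingColorCount f T d : ℝ)) A
      fun d _ => (hup T hT d).le
    rw [card_erase_of_mem (mem_univ c), card_univ, Fintype.card_fin, nsmul_eq_mul, Nat.cast_sub hqN] at h2
    push_cast at h2
    linarith
  rcases summary (f := f) hr hq m (by rw [Fintype.card_fin]; exact hdvd) (by convert hmiss) hb with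
    ⟨T, T', c, hT, hT', hc⟩ | ⟨T, hT, w, _, hw2, hw3⟩
  · have h1 := hlow T hT c
    have h2 := hup T' hT' c
    have h3 : (tilingColorCount f T c : ℝ) + m ≤ tilingColorCount f T' c := by exact_mod_cast hc
    linarith
  · obtain ⟨B, hB⟩ : ∃ B : ℝ, B = (r : ℝ) * (3 * r * (q * m)) := ⟨_, rfl⟩
    have hB1 : B ≤ 3 * (r : ℝ) ^ 2 * q * (s + 1) := by
      calc B = 3 * (r : ℝ) ^ 2 * q * m := by rw [hB]; ring
        _ ≤ _ := mul_le_mul_of_nonneg_left hm2 (by positivity)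
    have hwl : ∀ c, A - s - B ≤ w c := by
      intro c
      have h1 := hlow T hT c
      have h2 : (tilingColorCount f T c : ℝ) ≤ w c + r * (3 * r * (q * m)) := by exact_mod_cast hw2 c
      rw [← hB] at h2
      linarith
    have hD : 0 < A - s - B := num_D r q n s ε K B A hrR hqR hK hs10 hnR hεn hε1 hB1 hqA
    obtain ⟨Z, hZ1, hZ2⟩ := hw3 fun c => by
      have := hD.trans_le (hwl c)
      exact_mod_cast this
    have hS1 : (Z.card : ℝ) * (A - s - B) ≤ ∑ c ∈ Z, (w c : ℝ) := by
      rw [← nsmul_eq_mul]; exact card_nsmul_le_sum _ _ _ fun c _ => hwl c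
    have hZ1' : (q : ℝ) ≤ Z.card + (r.choose 2 : ℕ) := by exact_mod_cast hZ1
    have hZ2' : ∑ c ∈ Z, (w c : ℝ) + μ ≤ r * μ := by exact_mod_cast hZ2
    exact num_final r q n μ s ε K B A (r.choose 2 : ℕ) Z.card (∑ c ∈ Z, (w c : ℝ)) hrR hqR hK hs10 hεn hB1 hrμ
      hqA hD hZ1' hC hS1 hZ2'
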